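/- Let ξ = exp(2πi/5). The fundamental groups π₁(ℙ²(ℂ) ∖ 𝒜^ξ) and π₁(ℙ²(ℂ) ∖ 𝒜^{ξ²}) of the complements of the line arrangements 𝒜^ξ and 𝒜^{ξ²} are not isomorphic as groups. -/

import Mathlib

open scoped LinearAlgebra.Projectivization
open Projectivization

abbrev P2 : Type := ℙ ℂ (Fin 3 → ℂ)

noncomputable instance : TopologicalSpace P2 :=
  inferInstanceAs (TopologicalSpace (Quotient (projectivizationSetoid ℂ (Fin 3 → ℂ))))

/-- The projective line `{[x:y:z] | v₀x + v₁y + v₂z = 0}` in `ℙ²(ℂ)`. -/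
def lineOf (v : Fin 3 → ℂ) : Set P2 :=
  {p | v 0 * p.rep 0 + v 1 * p.rep 1 + v 2 * p.rep 2 = 0}

/-- Coefficient vectors of the twelve lines of `𝒜^ζ`
(index `i : Fin 12` corresponds to the line `L_{i+1}`), with `ζ̄ = ζ⁻¹`. -/
noncomputable def coeffs (ζ : ℂ) : Fin 12 → Fin 3 → ℂ :=
  ![![1, 0, -1], ![1, 1, 0], ![1, 0, 1], ![1, -1, 0], ![0, 1, -1], ![0, 1, 1],
    ![1, -(ζ⁻¹ ^ 2 + ζ⁻¹), -(ζ ^ 2 + ζ)],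
    ![1, ζ⁻¹ + ζ ^ 2, -(ζ⁻¹ ^ 2 + ζ)],
    ![1, ζ ^ 2 + ζ, ζ⁻¹ ^ 2 + ζ⁻¹],
    ![1, -(ζ⁻¹ ^ 2 + ζ), ζ⁻¹ + ζ ^ 2],
    ![5, 1 + 2 * ζ + 3 * ζ ^ 2 - ζ⁻¹ ^ 2, -(2 + 4 * ζ + ζ ^ 2 + 3 * ζ⁻¹ ^ 2)],
    ![1, -(1 + ζ⁻¹), ζ⁻¹]]

/-- The line `L_{i+1}` of the arrangement `𝒜^ζ`. -/
noncomputable def lineA (ζ : ℂ) (i : Fin 12) : Set P2 := lineOf (coeffs ζ i)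

/-- The union of the twelve lines of the arrangement `𝒜^ζ`. -/
noncomputable def unionA (ζ : ℂ) : Set P2 := ⋃ i, lineA ζ i

/-- `ξ = exp(2πi/5)`. -/
noncomputable def xi : ℂ := Complex.exp (2 * Real.pi * Complex.I / 5)

open scoped unitInterval Topology

section Holonomy

variable {X Y T Γ Δ : Type*} [TopologicalSpace X] [TopologicalSpace Y] [TopologicalSpace T]
  [Group Γ] [Group Δ]

/-- A function of two variables satisfying the cocycle rule for triples of nearby points. -/
def IsLocalCocycle (c : X → X → Γ) : Prop :=
  ∀ x, ∃ U ∈ 𝓝 x, ∀ y ∈ U, ∀ z ∈ U, ∀ w ∈ U, c y z * c z w = c y w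

/-- `F` is a primitive of the local cocycle `c` along the map `γ`. -/
def IsLift (c : X → X → Γ) (γ : T → X) (F : T → Γ) : Prop :=
  ∀ t, ∃ V ∈ 𝓝 t, ∀ s ∈ V, ∀ s' ∈ V, F s' = F s * c (γ s) (γ s')

theorem IsLocalCocycle.comp {c : X → X → Γ} (hc : IsLocalCocycle c) {f : Y → X}
    (hf : Continuous f) : IsLocalCocycle fun y y' => c (f y) (f y') := fun y => by
  obtain ⟨U, hU, h⟩ := hc (f y)
  exact ⟨f ⁻¹' U, hf.continuousAt hU, fun a ha b hb d hd => h _ ha _ hb _ hd⟩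

theorem IsLift.unique {c : X → X → Γ} {γ : I → X} {F F' : I → Γ} (hF : IsLift c γ F)
    (hF' : IsLift c γ F') : (F 0)⁻¹ * F 1 = (F' 0)⁻¹ * F' 1 := by
  have h : IsLocallyConstant fun t => F t * (F' t)⁻¹ := by
    refine (IsLocallyConstant.iff_eventually_eq _).2 fun t => ?_
    obtain ⟨V, hV, h⟩ := hF t
    obtain ⟨V', hV', h'⟩ := hF' t
    filter_upwards [hV, hV'] with s hs hs'
    rw [h t (mem_of_mem_nhds hV) s hs, h' t (mem_of_mem_nhds hV') s hs']
    group
  have := h.apply_eq_of_preconnectedSpace 0 1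
  rw [mul_inv_eq_iff_eq_mul] at this
  rw [this]
  group

theorem IsLocalCocycle.exists_isLift {c : X → X → Γ} (hc : IsLocalCocycle c) {γ : I → X}
    (hγ : Continuous γ) : ∃ F : I → Γ, F 0 = 1 ∧ IsLift c γ F := by
  choose U hU hUc using hc
  obtain ⟨t, ht0, htm, ⟨m, hm⟩, ht⟩ :=
    exists_monotone_Icc_subset_open_cover_unitInterval
      (c := fun x : X => γ ⁻¹' interior (U x)) (fun x => isOpen_interior.preimage hγ)
      (fun s _ => Set.mem_iUnion.2 ⟨γ s, mem_interior_iff_mem_nhds.2 (hU (γ s))⟩)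
  have key : ∀ n, ∃ F : I → Γ, F 0 = 1 ∧ ∀ s ≤ t n, ∃ V ∈ 𝓝 s, ∀ r ∈ V, ∀ r' ∈ V,
      r ≤ t n → r' ≤ t n → F r' = F r * c (γ r) (γ r') := by
    intro n
    induction n with
    | zero =>
      refine ⟨fun _ => 1, rfl, fun s _ => ⟨Set.univ, Filter.univ_mem, fun r _ r' _ h h' => ?_⟩⟩
      rw [ht0] at h h'
      have e : r = 0 := le_antisymm h r.2.1
      have e' : r' = 0 := le_antisymm h' r'.2.1
      subst e e'
      have := hUc (γ 0) (γ 0) (mem_of_mem_nhds (hU _)) (γ 0) (mem_of_mem_nhds (hU _)) (γ 0)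
        (mem_of_mem_nhds (hU _))
      have e : c (γ 0) (γ 0) = 1 := by simpa using this
      simp [e]
    | succ n ih =>
      obtain ⟨F, hF0, hF⟩ := ih
      obtain ⟨x, hx⟩ := ht n
      have good : ∀ r r' r'', t n ≤ r → r ≤ t (n + 1) → t n ≤ r' → r' ≤ t (n + 1) →
          t n ≤ r'' → r'' ≤ t (n + 1) →
          c (γ r) (γ r') * c (γ r') (γ r'') = c (γ r) (γ r'') := fun r r' r'' a b a' b' a'' b'' =>
        hUc x _ (interior_subset (hx ⟨a, b⟩)) _ (interior_subset (hx ⟨a', b'⟩)) _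
          (interior_subset (hx ⟨a'', b''⟩))
      have hle : t n ≤ t (n + 1) := htm n.le_succ
      refine ⟨fun r => if r ≤ t n then F r else F (t n) * c (γ (t n)) (γ r), ?_, ?_⟩
      · simp only [if_pos (show (0 : I) ≤ t n from (t n).2.1), hF0]
      intro s hs
      rcases lt_trichotomy s (t n) with h | h | h
      · obtain ⟨V, hV, hV'⟩ := hF s h.le
        refine ⟨V ∩ Set.Iio (t n), Filter.inter_mem hV (Iio_mem_nhds h), ?_⟩
        rintro r ⟨hr, hr1⟩ r' ⟨hr', hr1'⟩ - -
        have hr1 : r < t n := hr1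
        have hr1' : r' < t n := hr1'
        simp only [if_pos hr1.le, if_pos hr1'.le]
        exact hV' r hr r' hr' hr1.le hr1'.le
      · subst h
        obtain ⟨V, hV, hV'⟩ := hF (t n) le_rfl
        set W := γ ⁻¹' U (γ (t n)) with hW
        have hWn : W ∈ 𝓝 (t n) := hγ.continuousAt (hU _)
        have tV := mem_of_mem_nhds hV
        have tW : γ (t n) ∈ U (γ (t n)) := mem_of_mem_nhds (hU _)
        refine ⟨V ∩ W, Filter.inter_mem hV hWn, ?_⟩
        rintro r ⟨hr, hr1⟩ r' ⟨hr', hr1'⟩ hrn hrn'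
        have hr1 : γ r ∈ U (γ (t n)) := hr1
        have hr1' : γ r' ∈ U (γ (t n)) := hr1'
        have e1 := hUc (γ (t n)) _ tW _ hr1 _ hr1'
        have e3 := hUc (γ (t n)) _ hr1 _ tW _ hr1'
        dsimp only
        by_cases a : r ≤ t n <;> by_cases a' : r' ≤ t n
        · rw [if_pos a, if_pos a']; exact hV' r hr r' hr' a a'
        · rw [if_pos a, if_neg a', hV' r hr (t n) tV a le_rfl, mul_assoc, e3]
        · rw [if_neg a, if_pos a', hV' (t n) tV r' hr' le_rfl a', mul_assoc, e1]
        · rw [if_neg a, if_neg a', mul_assoc, e1]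
      · refine ⟨Set.Ioi (t n), Ioi_mem_nhds h, ?_⟩
        intro r hr r' hr' hrn hrn'
        have hr : t n < r := hr
        have hr' : t n < r' := hr'
        dsimp only
        rw [if_neg (not_le.2 hr), if_neg (not_le.2 hr'), mul_assoc,
          good _ _ _ le_rfl hle hr.le hrn hr'.le hrn']
  obtain ⟨F, hF0, hF⟩ := key m
  have h1 : ∀ s : I, s ≤ t m := fun s => by rw [hm m le_rfl]; exact s.2.2
  refine ⟨F, hF0, fun s => ?_⟩
  obtain ⟨V, hV, h⟩ := hF s (h1 s)
  exact ⟨V, hV, fun r hr r' hr' => h r hr r' hr' (h1 r) (h1 r')⟩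

open Classical in
/-- The holonomy of a local cocycle along a path (equal to `1` if there is no primitive). -/
noncomputable def hol (c : X → X → Γ) (γ : I → X) : Γ :=
  if h : ∃ F : I → Γ, IsLift c γ F then (h.choose 0)⁻¹ * h.choose 1 else 1

theorem IsLift.hol_eq {c : X → X → Γ} {γ : I → X} {F : I → Γ} (hF : IsLift c γ F) :
    hol c γ = (F 0)⁻¹ * F 1 := by
  have h : ∃ F : I → Γ, IsLift c γ F := ⟨F, hF⟩
  rw [hol, dif_pos h]
  exact h.choose_spec.unique hF

theorem IsLift.map {c : X → X → Γ} {γ : T → X} {F : T → Γ} (hF : IsLift c γ F) (φ : Γ →* Δ) :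
    IsLift (fun x y => φ (c x y)) γ fun t => φ (F t) := fun t => by
  obtain ⟨V, hV, h⟩ := hF t
  exact ⟨V, hV, fun s hs s' hs' => by simp only [h s hs s' hs', map_mul]⟩

theorem hol_map {c : X → X → Γ} (hc : IsLocalCocycle c) {γ : I → X} (hγ : Continuous γ)
    (φ : Γ →* Δ) : hol (fun x y => φ (c x y)) γ = φ (hol c γ) := by
  obtain ⟨F, -, hF⟩ := hc.exists_isLift hγ
  rw [hF.hol_eq, (hF.map φ).hol_eq, map_mul, map_inv]

/-- Holonomy lies in every subgroup containing the nearby values of the cocycle. -/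
theorem hol_mem {c : X → X → Γ} (hc : IsLocalCocycle c) {γ : I → X} (hγ : Continuous γ)
    (H : Subgroup Γ) (hH : ∀ x, ∃ U ∈ 𝓝 x, ∀ y ∈ U, ∀ z ∈ U, c y z ∈ H) : hol c γ ∈ H := by
  obtain ⟨F, h0, hF⟩ := hc.exists_isLift hγ
  have h : IsLocallyConstant fun t => F t ∈ H := by
    refine (IsLocallyConstant.iff_eventually_eq _).2 fun t => ?_
    obtain ⟨V, hV, h⟩ := hF t
    obtain ⟨U, hU, h'⟩ := hH (γ t)
    filter_upwards [hV, hγ.continuousAt hU] with s hs hs'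
    rw [h t (mem_of_mem_nhds hV) s hs, eq_iff_iff]
    exact H.mul_mem_cancel_right (h' _ (mem_of_mem_nhds hU) _ hs')
  have := h.apply_eq_of_preconnectedSpace 0 1
  rw [hF.hol_eq, h0, inv_one, one_mul, ← this, h0]
  exact H.one_mem

/-- Two local cocycles that are locally gauge equivalent have conjugate holonomies. -/
theorem hol_gauge {c c' : X → X → Γ} (hc : IsLocalCocycle c) {γ : I → X} (hγ : Continuous γ)
    (s : X → Γ) (h : ∀ x, ∃ U ∈ 𝓝 x, ∀ y ∈ U, ∀ z ∈ U, c' y z = s y * c y z * (s z)⁻¹) :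
    hol c' γ = s (γ 0) * hol c γ * (s (γ 1))⁻¹ := by
  obtain ⟨F, h0, hF⟩ := hc.exists_isLift hγ
  have : IsLift c' γ fun t => F t * (s (γ t))⁻¹ := fun t => by
    obtain ⟨V, hV, h'⟩ := hF t
    obtain ⟨U, hU, h''⟩ := h (γ t)
    refine ⟨V ∩ γ ⁻¹' U, Filter.inter_mem hV (hγ.continuousAt hU), ?_⟩
    rintro r ⟨hr, hr1⟩ r' ⟨hr', hr1'⟩
    dsimp only
    rw [h' r hr r' hr', h'' _ hr1 _ hr1']
    group
  rw [this.hol_eq, hF.hol_eq]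
  group

variable {x y z : X}

theorem hol_trans {c : X → X → Γ} (hc : IsLocalCocycle c) (γ : Path x y) (δ : Path y z) :
    hol c (γ.trans δ) = hol c γ * hol c δ := by
  obtain ⟨F, h0, hF⟩ := hc.exists_isLift (γ.trans δ).continuous
  have hl : Continuous fun t : I => (⟨t / 2, by
      constructor <;> linarith [t.2.1, t.2.2]⟩ : I) := by fun_prop
  have hr : Continuous fun t : I => (⟨(t + 1) / 2, by
      constructor <;> linarith [t.2.1, t.2.2]⟩ : I) := by fun_prop
  have h1 : IsLift c γ (F ∘ fun t : I => (⟨t / 2, by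
      constructor <;> linarith [t.2.1, t.2.2]⟩ : I)) := fun t => by
    obtain ⟨V, hV, h⟩ := hF _
    refine ⟨_, hl.continuousAt hV, fun s hs s' hs' => ?_⟩
    have := h _ hs _ hs'
    have e : ∀ u : I, (γ.trans δ) ⟨u / 2, by constructor <;> linarith [u.2.1, u.2.2]⟩ = γ u := by
      intro u
      rw [Path.trans_apply, dif_pos (by simp only; linarith [u.2.2])]
      congr 1; ext; simp only; ring
    simpa only [Function.comp, e] using this
  have h2 : IsLift c δ (F ∘ fun t : I => (⟨(t + 1) / 2, by
      constructor <;> linarith [t.2.1, t.2.2]⟩ : I)) := fun t => by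
    obtain ⟨V, hV, h⟩ := hF _
    refine ⟨_, hr.continuousAt hV, fun s hs s' hs' => ?_⟩
    have := h _ hs _ hs'
    have e : ∀ u : I, (γ.trans δ) ⟨(u + 1) / 2, by constructor <;> linarith [u.2.1, u.2.2]⟩
        = δ u := by
      intro u
      rw [Path.trans_apply]
      split_ifs with hu
      · have hu : ((u : ℝ) + 1) / 2 ≤ 1 / 2 := hu
        have : u = 0 := le_antisymm (show (u : ℝ) ≤ 0 by linarith) u.2.1
        subst this; simp
      · congr 1; ext; simp; ring
    simpa only [Function.comp, e] using this
  rw [hF.hol_eq, h1.hol_eq, h2.hol_eq]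
  simp only [Function.comp]
  have e0 : (⟨((0 : I) : ℝ) / 2, by simp⟩ : I) = 0 := by ext; simp
  have e1 : (⟨((1 : I) : ℝ) / 2, by constructor <;> norm_num⟩ : I)
    = ⟨(((0 : I) : ℝ) + 1) / 2, by constructor <;> norm_num⟩ := by ext; simp
  have e2 : (⟨(((1 : I) : ℝ) + 1) / 2, by constructor <;> norm_num⟩ : I) = 1 := by ext; simp
  rw [e0, e1, e2]
  group

theorem hol_homotopic {c : X → X → Γ} (hc : IsLocalCocycle c) {γ δ : Path x y}
    (h : γ.Homotopic δ) : hol c γ = hol c δ := by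
  obtain ⟨H⟩ := h
  have hH : Continuous fun p : I × I => H p := H.continuous
  have key : IsLocallyConstant fun s : I => hol c (H.eval s) := by
    refine (IsLocallyConstant.iff_eventually_eq _).2 fun s₀ => ?_
    obtain ⟨F, h0, hF⟩ := hc.exists_isLift (H.eval s₀).continuous
    choose U hU hUc using hc
    have hn : ∀ t : I, ∃ A ∈ 𝓝 s₀, ∃ B ∈ 𝓝 t, ∀ a ∈ A, ∀ b ∈ B, H (a, b) ∈ U (H (s₀, t)) := by
      intro t
      have := hH.continuousAt (x := (s₀, t)) (hU (H (s₀, t)))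
      rw [Filter.mem_map, mem_nhds_prod_iff] at this
      obtain ⟨A, hA, B, hB, h⟩ := this
      exact ⟨A, hA, B, hB, fun a ha b hb => h (Set.mk_mem_prod ha hb)⟩
    choose A hA B hB hAB using hn
    obtain ⟨K, -, hK⟩ := isCompact_univ.elim_nhds_subcover (fun t => interior (B t))
      fun t _ => interior_mem_nhds.2 (hB t)
    have hK' : ∀ᶠ s in 𝓝 s₀, ∀ t ∈ K, s ∈ A t := (Filter.eventually_all_finset K).2
      fun t _ => hA t
    filter_upwards [hK'] with s hs
    have hs0 : ∀ t, s₀ ∈ A t := fun t => mem_of_mem_nhds (hA t)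
    have hsame : ∀ x, c x x = 1 := fun x => by
      have hx := mem_of_mem_nhds (hU x)
      simpa using hUc x x hx x hx x hx
    have hl : IsLift c (H.eval s) fun t => F t * c (H (s₀, t)) (H (s, t)) := by
      intro t
      obtain ⟨V, hV, hVc⟩ := hF t
      obtain ⟨k, hk, hkt⟩ : ∃ k ∈ K, t ∈ interior (B k) := by simpa using hK (Set.mem_univ t)
      refine ⟨V ∩ interior (B k), Filter.inter_mem hV (isOpen_interior.mem_nhds hkt), ?_⟩
      rintro r ⟨hr, hrk⟩ r' ⟨hr', hrk'⟩
      have hrk := interior_subset hrk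
      have hrk' := interior_subset hrk'
      have m0 := hAB k _ (hs0 k) _ hrk
      have m0' := hAB k _ (hs0 k) _ hrk'
      have m1 := hAB k _ (hs k hk) _ hrk
      have m1' := hAB k _ (hs k hk) _ hrk'
      have e : ∀ a b, (H.eval a) b = H (a, b) := fun _ _ => rfl
      dsimp only
      rw [hVc r hr r' hr', e, e, e, e, mul_assoc, mul_assoc, hUc _ _ m0 _ m0' _ m1',
        hUc _ _ m0 _ m1 _ m1']
    rw [hl.hol_eq, IsLift.hol_eq hF]
    simp [hsame]
  have := key.apply_eq_of_preconnectedSpace 0 1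
  simpa using this

/-- Holonomy as a function on homotopy classes of paths. -/
noncomputable def holQ {c : X → X → Γ} (hc : IsLocalCocycle c) :
    Path.Homotopic.Quotient x y → Γ :=
  Quotient.lift (fun γ : Path x y => hol c γ) fun _ _ h => hol_homotopic hc h

theorem holQ_trans {c : X → X → Γ} (hc : IsLocalCocycle c) (p : Path.Homotopic.Quotient x y)
    (q : Path.Homotopic.Quotient y z) : holQ hc (p.trans q) = holQ hc p * holQ hc q := by
  induction p using Quotient.ind
  induction q using Quotient.ind
  exact hol_trans hc _ _

theorem holQ_mul {c : X → X → Γ} (hc : IsLocalCocycle c) (p q : FundamentalGroup X x) :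
    holQ hc (p * q) = holQ hc q * holQ hc p :=
  holQ_trans hc _ _

end Holonomy

/-- The unipotent group carrying the iterated integrals of `du/u` and `du/(u-1)` needed below. -/
@[ext]
structure Unip where
  a : ℂ
  b : ℂ
  g : ℂ
  p : ℂ
  q : ℂ

namespace Unip

noncomputable instance : Mul Unip where
  mul x y := ⟨x.a + y.a, x.b + y.b, x.g + y.g + x.a * y.b,
    x.p + y.p + x.a * y.g + x.a ^ 2 / 2 * y.b, x.q + y.q + x.a * y.b ^ 2 / 2 + x.g * y.b⟩

instance : One Unip where
  one := ⟨0, 0, 0, 0, 0⟩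

noncomputable instance : Inv Unip where
  inv x := ⟨-x.a, -x.b, -x.g + x.a * x.b, -x.p + x.a * x.g - x.a ^ 2 * x.b / 2,
    -x.q - x.a * x.b ^ 2 / 2 + x.g * x.b⟩

@[simp] theorem mul_a (x y : Unip) : (x * y).a = x.a + y.a := rfl
@[simp] theorem mul_b (x y : Unip) : (x * y).b = x.b + y.b := rfl
@[simp] theorem mul_g (x y : Unip) : (x * y).g = x.g + y.g + x.a * y.b := rfl
@[simp] theorem mul_p (x y : Unip) :
    (x * y).p = x.p + y.p + x.a * y.g + x.a ^ 2 / 2 * y.b := rfl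
@[simp] theorem mul_q (x y : Unip) :
    (x * y).q = x.q + y.q + x.a * y.b ^ 2 / 2 + x.g * y.b := rfl
@[simp] theorem one_a : (1 : Unip).a = 0 := rfl
@[simp] theorem one_b : (1 : Unip).b = 0 := rfl
@[simp] theorem one_g : (1 : Unip).g = 0 := rfl
@[simp] theorem one_p : (1 : Unip).p = 0 := rfl
@[simp] theorem one_q : (1 : Unip).q = 0 := rfl
@[simp] theorem inv_a (x : Unip) : x⁻¹.a = -x.a := rfl
@[simp] theorem inv_b (x : Unip) : x⁻¹.b = -x.b := rfl
@[simp] theorem inv_g (x : Unip) : x⁻¹.g = -x.g + x.a * x.b := rfl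
theorem inv_p (x : Unip) : x⁻¹.p = -x.p + x.a * x.g - x.a ^ 2 * x.b / 2 := rfl
theorem inv_q (x : Unip) : x⁻¹.q = -x.q - x.a * x.b ^ 2 / 2 + x.g * x.b := rfl

noncomputable instance : Group Unip :=
  Group.ofLeftAxioms
    (fun x y z => by ext <;> simp <;> ring)
    (fun x => by ext <;> simp)
    (fun x => by ext <;> simp [inv_p, inv_q] <;> ring)

/-- The coordinate `g` made antisymmetric. -/
noncomputable def s (x : Unip) : ℂ := x.g - x.a * x.b / 2

theorem s_mul (x y : Unip) : (x * y).s = x.s + y.s + (x.a * y.b - x.b * y.a) / 2 := by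
  simp only [s, mul_a, mul_b, mul_g]; ring

theorem commute_ab {x y : Unip} (h : Commute x y) : x.a * y.b = y.a * x.b := by
  have := congrArg Unip.g h.eq
  simp only [mul_g] at this
  linear_combination this

theorem commute_as {x y : Unip} (h : Commute x y) : x.a * y.s = y.a * x.s := by
  have h1 := commute_ab h
  have h2 := congrArg Unip.p h.eq
  simp only [mul_p] at h2
  simp only [s]
  linear_combination h2 - (x.a + y.a) / 2 * h1

theorem commute_bs {x y : Unip} (h : Commute x y) : x.b * y.s = y.b * x.s := by
  have h1 := commute_ab h
  have h2 := congrArg Unip.q h.eq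
  simp only [mul_q] at h2
  simp only [s]
  linear_combination -h2 + (x.b + y.b) / 2 * h1

/-- The subgroup of elements whose first three coordinates are integers. -/
def intSubgroup : Subgroup Unip where
  carrier := {x | (∃ n : ℤ, x.a = n) ∧ (∃ n : ℤ, x.b = n) ∧ ∃ n : ℤ, x.g = n}
  mul_mem' := by
    rintro x y ⟨⟨a, ha⟩, ⟨b, hb⟩, ⟨g, hg⟩⟩ ⟨⟨a', ha'⟩, ⟨b', hb'⟩, ⟨g', hg'⟩⟩
    exact ⟨⟨a + a', by simp [ha, ha']⟩, ⟨b + b', by simp [hb, hb']⟩,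
      ⟨g + g' + a * b', by simp [hg, hg', ha, hb']⟩⟩
  one_mem' := ⟨⟨0, by simp⟩, ⟨0, by simp⟩, ⟨0, by simp⟩⟩
  inv_mem' := by
    rintro x ⟨⟨a, ha⟩, ⟨b, hb⟩, ⟨g, hg⟩⟩
    exact ⟨⟨-a, by simp [ha]⟩, ⟨-b, by simp [hb]⟩, ⟨-g + a * b, by simp [ha, hb, hg]⟩⟩

end Unip

/-- `f` solves the differential equation of the iterated integrals at all points of `U`. -/
structure IsSol (f : ℂ → Unip) (U : Set ℂ) : Prop where
  a : ∀ u ∈ U, HasDerivAt (fun u => (f u).a) (u⁻¹ / (2 * Real.pi * Complex.I)) u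
  b : ∀ u ∈ U, HasDerivAt (fun u => (f u).b) (-(1 - u)⁻¹ / (2 * Real.pi * Complex.I)) u
  g : ∀ u ∈ U, HasDerivAt (fun u => (f u).g)
    ((f u).a * (-(1 - u)⁻¹ / (2 * Real.pi * Complex.I))) u

/-- A solution together with the last two coordinates. -/
structure IsFullSol (f : ℂ → Unip) (U : Set ℂ) : Prop extends IsSol f U where
  p : ∀ u ∈ U, HasDerivAt (fun u => (f u).p)
    ((f u).a ^ 2 / 2 * (-(1 - u)⁻¹ / (2 * Real.pi * Complex.I))) u
  q : ∀ u ∈ U, HasDerivAt (fun u => (f u).q)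
    ((f u).g * (-(1 - u)⁻¹ / (2 * Real.pi * Complex.I))) u

section Sol

variable {f f' : ℂ → Unip} {U V : Set ℂ}

theorem IsSol.mono (h : IsSol f U) (hV : V ⊆ U) : IsSol f V :=
  ⟨fun u hu => h.a u (hV hu), fun u hu => h.b u (hV hu), fun u hu => h.g u (hV hu)⟩

theorem IsFullSol.mono (h : IsFullSol f U) (hV : V ⊆ U) : IsFullSol f V :=
  ⟨h.toIsSol.mono hV, fun u hu => h.p u (hV hu), fun u hu => h.q u (hV hu)⟩

theorem IsSol.mul (h : IsSol f U) (x : Unip) : IsSol (fun u => x * f u) U where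
  a u hu := by simpa using (h.a u hu).const_add x.a
  b u hu := by simpa using (h.b u hu).const_add x.b
  g u hu := by
    have := ((h.g u hu).const_add x.g).add ((h.b u hu).const_mul x.a)
    exact this.congr_deriv (by simp only [Unip.mul_a]; ring)

theorem IsFullSol.mul (h : IsFullSol f U) (x : Unip) : IsFullSol (fun u => x * f u) U where
  toIsSol := h.toIsSol.mul x
  p u hu := by
    have := (((h.p u hu).const_add x.p).add ((h.g u hu).const_mul x.a)).add
      ((h.b u hu).const_mul (x.a ^ 2 / 2))
    exact this.congr_deriv (by simp only [Unip.mul_a]; ring)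
  q u hu := by
    have := (((h.q u hu).const_add x.q).add ((((h.b u hu).mul (h.b u hu)).const_mul (x.a / 2)))).add
      ((h.b u hu).const_mul x.g)
    refine (this.congr_deriv (by simp only [Unip.mul_g]; ring)).congr_of_eventuallyEq
      (Filter.Eventually.of_forall fun u => ?_)
    simp only [Unip.mul_q, Pi.add_apply, Pi.mul_apply]
    ring

theorem eqOn_of_hasDerivAt {F G F' : ℂ → ℂ} (hU : IsOpen U) (hc : IsPreconnected U)
    (hF : ∀ u ∈ U, HasDerivAt F (F' u) u) (hG : ∀ u ∈ U, HasDerivAt G (F' u) u) {u₀ : ℂ}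
    (h₀ : u₀ ∈ U) (h : F u₀ = G u₀) : Set.EqOn F G U :=
  hU.eqOn_of_deriv_eq hc (fun u hu => (hF u hu).differentiableAt.differentiableWithinAt)
    (fun u hu => (hG u hu).differentiableAt.differentiableWithinAt)
    (fun u hu => by rw [(hF u hu).deriv, (hG u hu).deriv]) h₀ h

theorem IsSol.eqOn (h : IsSol f U) (h' : IsSol f' U) (hU : IsOpen U) (hc : IsPreconnected U)
    {u₀ : ℂ} (h₀ : u₀ ∈ U) (ha : (f u₀).a = (f' u₀).a) (hb : (f u₀).b = (f' u₀).b)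
    (hg : (f u₀).g = (f' u₀).g) :
    ∀ u ∈ U, (f u).a = (f' u).a ∧ (f u).b = (f' u).b ∧ (f u).g = (f' u).g := by
  have e := eqOn_of_hasDerivAt hU hc h.a h'.a h₀ ha
  have e' := eqOn_of_hasDerivAt hU hc h.b h'.b h₀ hb
  have e'' := eqOn_of_hasDerivAt hU hc h.g (fun u hu => by
    have := h'.g u hu
    rwa [show (f' u).a = (f u).a from (e hu).symm] at this) h₀ hg
  exact fun u hu => ⟨e hu, e' hu, e'' hu⟩

theorem IsFullSol.eqOn (h : IsFullSol f U) (h' : IsFullSol f' U) (hU : IsOpen U)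
    (hc : IsPreconnected U) {u₀ : ℂ} (h₀ : u₀ ∈ U) (he : f u₀ = f' u₀) : Set.EqOn f f' U := by
  have e := h.toIsSol.eqOn h'.toIsSol hU hc h₀ (by rw [he]) (by rw [he]) (by rw [he])
  have e1 := eqOn_of_hasDerivAt hU hc h.p (fun u hu => by
    have := h'.p u hu
    rwa [← (e u hu).1] at this) h₀ (by rw [he])
  have e2 := eqOn_of_hasDerivAt hU hc h.q (fun u hu => by
    have := h'.q u hu
    rwa [← (e u hu).2.2] at this) h₀ (by rw [he])
  exact fun u hu => Unip.ext (e u hu).1 (e u hu).2.1 (e u hu).2.2 (e1 hu) (e2 hu)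

theorem exists_primitive_ball {F : ℂ → ℂ} {x : ℂ} {r : ℝ}
    (h : ∀ u ∈ Metric.ball x r, DifferentiableAt ℂ F u) :
    ∃ G : ℂ → ℂ, G x = 0 ∧ ∀ u ∈ Metric.ball x r, HasDerivAt G (F u) u := by
  obtain ⟨G, hG⟩ := (show DifferentiableOn ℂ F (Metric.ball x r) from
    fun u hu => (h u hu).differentiableWithinAt).isExactOn_ball
  exact ⟨fun u => G u - G x, sub_self _, fun u hu => (hG u hu).sub_const _⟩

theorem exists_isFullSol {x : ℂ} {r : ℝ} (h : ∀ u ∈ Metric.ball x r, u ≠ 0 ∧ u ≠ 1) :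
    ∃ f : ℂ → Unip, f x = 1 ∧ IsFullSol f (Metric.ball x r) := by
  have d0 : ∀ u ∈ Metric.ball x r,
      DifferentiableAt ℂ (fun u : ℂ => u⁻¹ / (2 * Real.pi * Complex.I)) u := fun u hu =>
    (differentiableAt_inv (h u hu).1).div_const _
  have d1 : ∀ u ∈ Metric.ball x r,
      DifferentiableAt ℂ (fun u : ℂ => -(1 - u)⁻¹ / (2 * Real.pi * Complex.I)) u := fun u hu =>
    ((((differentiableAt_id).const_sub 1).inv (sub_ne_zero.2 (h u hu).2.symm)).neg).div_const _
  obtain ⟨a, ha0, ha⟩ := exists_primitive_ball d0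
  obtain ⟨b, hb0, hb⟩ := exists_primitive_ball d1
  obtain ⟨g, hg0, hg⟩ := exists_primitive_ball fun u hu =>
    ((ha u hu).differentiableAt).mul (d1 u hu)
  obtain ⟨p, hp0, hp⟩ := exists_primitive_ball fun u hu =>
    ((((ha u hu).differentiableAt).pow 2).div_const 2).mul (d1 u hu)
  obtain ⟨q, hq0, hq⟩ := exists_primitive_ball fun u hu =>
    ((hg u hu).differentiableAt).mul (d1 u hu)
  exact ⟨fun u => ⟨a u, b u, g u, p u, q u⟩, by ext <;> assumption, ⟨ha, hb, hg⟩, hp, hq⟩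

end Sol

/-- The complex plane without the points `0` and `1`. -/
abbrev TwicePunctured : Type := {u : ℂ // u ≠ 0 ∧ u ≠ 1}

namespace TwicePunctured

theorem ball_subset {x : ℂ} (r : ℝ) (h : r ≤ ‖x‖) (h' : r ≤ ‖1 - x‖) :
    ∀ u ∈ Metric.ball x r, u ≠ 0 ∧ u ≠ 1 := by
  intro u hu
  rw [Metric.mem_ball, dist_eq_norm] at hu
  constructor
  · rintro rfl
    rw [zero_sub, norm_neg] at hu
    linarith
  · rintro rfl
    linarith

/-- The distance to the boundary. -/
noncomputable def rad (x : ℂ) : ℝ := min ‖x‖ ‖1 - x‖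

theorem rad_pos (x : TwicePunctured) : 0 < rad x :=
  lt_min (norm_pos_iff.2 x.2.1) (norm_pos_iff.2 (sub_ne_zero.2 x.2.2.symm))

/-- The normalised solution at a base point. -/
noncomputable def sol (x : TwicePunctured) : ℂ → Unip :=
  (exists_isFullSol (ball_subset (rad x) (min_le_left _ _) (min_le_right _ _))).choose

theorem sol_self (x : TwicePunctured) : sol x x = 1 :=
  (exists_isFullSol (ball_subset (rad x) (min_le_left _ _) (min_le_right _ _))).choose_spec.1

theorem isFullSol_sol (x : TwicePunctured) : IsFullSol (sol x) (Metric.ball x (rad x)) :=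
  (exists_isFullSol (ball_subset (rad x) (min_le_left _ _) (min_le_right _ _))).choose_spec.2

theorem ball_subset_ball {x : TwicePunctured} {y : ℂ}
    (hy : y ∈ Metric.ball (x : ℂ) (rad x / 3)) :
    Metric.ball (x : ℂ) (rad x / 3) ⊆ Metric.ball y (rad y) := by
  have hd := Metric.mem_ball.1 hy
  have h1 : rad x - dist y x ≤ rad y := by
    have e1 : ‖(x : ℂ)‖ ≤ ‖y‖ + dist y x := by
      rw [dist_comm, dist_eq_norm]; linarith [norm_sub_norm_le (x : ℂ) y]
    have e2 : ‖1 - (x : ℂ)‖ ≤ ‖1 - y‖ + dist y x := by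
      rw [dist_eq_norm]
      calc ‖1 - (x : ℂ)‖ = ‖(1 - y) + (y - x)‖ := by ring_nf
        _ ≤ _ := norm_add_le _ _
    have e3 : rad (x : ℂ) ≤ ‖(x : ℂ)‖ := min_le_left _ _
    have e4 : rad (x : ℂ) ≤ ‖1 - (x : ℂ)‖ := min_le_right _ _
    exact le_min (by linarith) (by linarith)
  refine Metric.ball_subset_ball' ?_
  rw [dist_comm]
  linarith

/-- The cocycle of iterated integrals on the twice punctured plane. -/
noncomputable def cocycle (x y : TwicePunctured) : Unip := sol x y

theorem isLocalCocycle_cocycle : IsLocalCocycle cocycle := fun x => by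
  refine ⟨Subtype.val ⁻¹' Metric.ball (x : ℂ) (rad x / 3), continuous_subtype_val.continuousAt
    (Metric.ball_mem_nhds _ (by have := rad_pos x; positivity)), fun y hy z hz w hw => ?_⟩
  have h1 := ((isFullSol_sol z).mono (ball_subset_ball hz)).mul (sol y z)
  have h2 := (isFullSol_sol y).mono (ball_subset_ball hy)
  exact h1.eqOn h2 Metric.isOpen_ball (convex_ball _ _).isPreconnected hz
    (by rw [sol_self, mul_one]) hw

theorem exists_primitive_halfPlane {F : ℂ → ℂ} (hF : ∀ u : ℂ, u.re < 1 → DifferentiableAt ℂ F u) :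
    ∃ G : ℂ → ℂ, ∀ u : ℂ, u.re < 1 → HasDerivAt G (F u) u := by
  have hw : ∀ w ∈ Metric.ball (0 : ℂ) 1, w - 1 ≠ 0 ∧ (2 * w / (w - 1)).re < 1 := by
    intro w hw
    rw [mem_ball_zero_iff] at hw
    have hw1 : w - 1 ≠ 0 := fun h => by
      rw [sub_eq_zero] at h
      simp [h] at hw
    refine ⟨hw1, ?_⟩
    have hn : 0 < Complex.normSq (w - 1) := Complex.normSq_pos.2 hw1
    have hs : Complex.normSq w < 1 := by
      rw [Complex.normSq_eq_norm_sq]; nlinarith [norm_nonneg w]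
    rw [Complex.div_re, ← add_div, div_lt_one hn]
    simp only [Complex.normSq_apply, Complex.sub_re, Complex.sub_im, Complex.one_re,
      Complex.one_im, Complex.mul_re, Complex.mul_im, Complex.re_ofNat, Complex.im_ofNat] at hs ⊢
    nlinarith
  have dw : ∀ w : ℂ, w - 1 ≠ 0 → DifferentiableAt ℂ (fun w : ℂ => 2 * w / (w - 1)) w :=
    fun w hw => ((differentiableAt_id).const_mul 2).div ((differentiableAt_id).sub_const 1) hw
  obtain ⟨G, -, hG⟩ := exists_primitive_ball (F := fun w => F (2 * w / (w - 1)) * (-2 / (w - 1) ^ 2))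
    (x := 0) (r := 1) (fun w h => by
      refine DifferentiableAt.mul ((hF _ (hw w h).2).comp w (dw w (hw w h).1)) ?_
      exact (differentiableAt_const _).div (((differentiableAt_id).sub_const 1).pow 2)
        (pow_ne_zero 2 (hw w h).1))
  refine ⟨fun u => G (u / (u - 2)), fun u hu => ?_⟩
  have hu2 : u - 2 ≠ 0 := fun h => by
    rw [sub_eq_zero.1 h] at hu
    norm_num at hu
  have hub : u / (u - 2) ∈ Metric.ball (0 : ℂ) 1 := by
    rw [mem_ball_zero_iff, norm_div, div_lt_one (norm_pos_iff.2 hu2)]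
    refine lt_of_pow_lt_pow_left₀ 2 (norm_nonneg _) ?_
    rw [← Complex.normSq_eq_norm_sq, ← Complex.normSq_eq_norm_sq]
    simp only [Complex.normSq_apply, Complex.sub_re, Complex.sub_im, Complex.re_ofNat,
      Complex.im_ofNat]
    nlinarith
  have h1 : HasDerivAt (fun u : ℂ => u / (u - 2)) ((1 * (u - 2) - u * 1) / (u - 2) ^ 2) u :=
    (hasDerivAt_id u).div ((hasDerivAt_id u).sub_const 2) hu2
  have h2 := (hG _ hub).comp u h1
  have e1 : u / (u - 2) - 1 = 2 / (u - 2) := by field_simp; ring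
  refine h2.congr_deriv ?_
  have e2 : 2 * (u / (u - 2)) / (u / (u - 2) - 1) = u := by
    rw [e1]; field_simp
  rw [e2, e1]
  field_simp
  ring

theorem exists_primitive_log : ∃ Ψ : ℂ → ℂ, ∀ u : ℂ, u.re < 1 → u ≠ 0 → HasDerivAt Ψ
    (Complex.log (1 - u) / (2 * Real.pi * Complex.I) * (u⁻¹ / (2 * Real.pi * Complex.I))) u := by
  set f : ℂ → ℂ := fun u => Complex.log (1 - u) / (2 * Real.pi * Complex.I) /
    (2 * Real.pi * Complex.I) with hf
  have ho : IsOpen {u : ℂ | u.re < 1} := isOpen_lt Complex.continuous_re continuous_const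
  have hd : DifferentiableOn ℂ f {u : ℂ | u.re < 1} := fun u hu => by
    have : 1 - u ∈ Complex.slitPlane := Or.inl (by
      have : u.re < 1 := hu
      simpa using this)
    exact ((((Complex.hasDerivAt_log this).comp u ((hasDerivAt_id u).const_sub 1)).div_const
      _).div_const _).differentiableAt.differentiableWithinAt
  have hd' := (Complex.differentiableOn_dslope (c := 0) (ho.mem_nhds (by simp))).2 hd
  obtain ⟨Ψ, hΨ⟩ := exists_primitive_halfPlane (F := dslope f 0) fun u hu =>
    (hd' u hu).differentiableAt (ho.mem_nhds hu)
  refine ⟨Ψ, fun u hu h0 => (hΨ u hu).congr_deriv ?_⟩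
  rw [dslope_of_ne _ h0, slope_def_field, hf]
  simp
  ring

end TwicePunctured

namespace TwicePunctured

/-- The normalised logarithm. -/
noncomputable def nlog (u : ℂ) : ℂ := Complex.log u / (2 * Real.pi * Complex.I)

theorem exp_nlog {u : ℂ} (hu : u ≠ 0) : Complex.exp (2 * Real.pi * Complex.I * nlog u) = u := by
  rw [nlog, mul_div_cancel₀ _ Complex.two_pi_I_ne_zero, Complex.exp_log hu]

theorem hasDerivAt_nlog {u : ℂ} (hu : u ∈ Complex.slitPlane) :
    HasDerivAt nlog (u⁻¹ / (2 * Real.pi * Complex.I)) u :=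
  (Complex.hasDerivAt_log hu).div_const _

theorem hasDerivAt_nlog_one_sub {u : ℂ} (hu : 1 - u ∈ Complex.slitPlane) :
    HasDerivAt (fun u => nlog (1 - u)) (-(1 - u)⁻¹ / (2 * Real.pi * Complex.I)) u :=
  ((hasDerivAt_nlog hu).comp u ((hasDerivAt_id u).const_sub 1)).congr_deriv (by ring)

theorem exists_branch {x : ℂ} (hx : x ≠ 0) : ∃ A : ℂ → ℂ, ∀ u ∈ Metric.ball x ‖x‖,
    HasDerivAt A (u⁻¹ / (2 * Real.pi * Complex.I)) u ∧ ∃ n : ℤ, nlog u - A u = n := by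
  refine ⟨fun u => nlog (u / x) + nlog x, fun u hu => ?_⟩
  rw [Metric.mem_ball, dist_eq_norm] at hu
  have hxn := norm_pos_iff.2 hx
  have hu0 : u ≠ 0 := fun h => by simp [h] at hu
  have hs : u / x ∈ Complex.slitPlane := by
    have : ‖u / x - 1‖ < 1 := by
      rw [show u / x - 1 = (u - x) / x by field_simp, norm_div, div_lt_one hxn]
      exact hu
    have h2 := (abs_le.1 (Complex.abs_re_le_norm (u / x - 1))).1
    simp only [Complex.sub_re, Complex.one_re] at h2
    exact Or.inl (by linarith)
  refine ⟨(((hasDerivAt_nlog hs).comp u ((hasDerivAt_id u).div_const x)).add_const _).congr_deriv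
    ?_, ?_⟩
  · field_simp
  · have := Complex.exp_eq_exp_iff_exists_int (x := 2 * Real.pi * Complex.I * nlog u)
      (y := 2 * Real.pi * Complex.I * (nlog (u / x) + nlog x))
    rw [mul_add, Complex.exp_add, exp_nlog hu0, exp_nlog hx, exp_nlog (div_ne_zero hu0 hx),
      div_mul_cancel₀ _ hx] at this
    obtain ⟨n, hn⟩ := this.1 rfl
    refine ⟨n, mul_left_cancel₀ Complex.two_pi_I_ne_zero ?_⟩
    rw [mul_sub, hn]; ring

/-- A multivalued dilogarithm with jumps compatible with those of the logarithms. -/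
theorem exists_dilog : ∃ Λ Ψ : ℂ → ℂ,
    (∀ u : ℂ, 0 < u.re → u ≠ 1 → HasDerivAt Λ
      (nlog u * (-(1 - u)⁻¹ / (2 * Real.pi * Complex.I))) u) ∧
    (∀ u : ℂ, u.re < 1 → u ≠ 0 → HasDerivAt Ψ
      (nlog (1 - u) * (u⁻¹ / (2 * Real.pi * Complex.I))) u) ∧
    ∀ u : ℂ, u.re < 1 → Λ u = nlog u * nlog (1 - u) - Ψ u := by
  obtain ⟨Ψ, hΨ⟩ := exists_primitive_log
  have hΨ' : ∀ u : ℂ, 0 < u.re → u ≠ 1 → HasDerivAt (fun u => Ψ (1 - u))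
      (nlog u * (-(1 - u)⁻¹ / (2 * Real.pi * Complex.I))) u := fun u hu h1 => by
    have := (hΨ (1 - u) (by simpa using hu) (sub_ne_zero.2 h1.symm)).comp u
      ((hasDerivAt_id u).const_sub 1)
    refine this.congr_deriv ?_
    rw [sub_sub_cancel, nlog]; ring
  set S : Set ℂ := {u | 0 < u.re} ∩ {u | u.re < 1} with hS
  have hSo : IsOpen S := (isOpen_lt continuous_const Complex.continuous_re).inter
    (isOpen_lt Complex.continuous_re continuous_const)
  have hSc : Convex ℝ S := (convex_halfSpace_re_gt 0).inter (convex_halfSpace_re_lt 1)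
  have hd : ∀ u ∈ S, HasDerivAt (fun u => nlog u * nlog (1 - u) - Ψ u)
      (nlog u * (-(1 - u)⁻¹ / (2 * Real.pi * Complex.I))) u := fun u hu => by
    have h0 : u ≠ 0 := fun h => by
      have := hu.1
      simp [h] at this
    have h1 : 1 - u ∈ Complex.slitPlane := Or.inl (by simpa using hu.2)
    refine (((hasDerivAt_nlog (Or.inl hu.1)).mul (hasDerivAt_nlog_one_sub h1)).sub
      (hΨ u hu.2 h0)).congr_deriv ?_
    simp only [nlog]; ring
  have hhalf : (1 / 2 : ℂ) ∈ S := by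
    constructor <;> simp <;> norm_num
  obtain ⟨K, hK⟩ : ∃ K, ∀ u ∈ S, Ψ (1 - u) + K = nlog u * nlog (1 - u) - Ψ u := by
    refine ⟨nlog (1 / 2) * nlog (1 - 1 / 2) - Ψ (1 / 2) - Ψ (1 - 1 / 2), fun u hu => ?_⟩
    refine eqOn_of_hasDerivAt (F := fun u => Ψ (1 - u) + (nlog (1 / 2) * nlog (1 - 1 / 2) -
      Ψ (1 / 2) - Ψ (1 - 1 / 2))) hSo hSc.isPreconnected (fun v hv => ?_) hd hhalf (by ring) hu
    exact (hΨ' v hv.1 (fun h => by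
      have := hv.2
      simp [h] at this)).add_const _
  refine ⟨fun u => if u.re < 1 then nlog u * nlog (1 - u) - Ψ u else Ψ (1 - u) + K, Ψ, ?_, hΨ,
    fun u hu => if_pos hu⟩
  intro u hu h1
  refine ((hΨ' u hu h1).add_const K).congr_of_eventuallyEq ?_
  filter_upwards [(isOpen_lt continuous_const Complex.continuous_re).mem_nhds hu] with v hv
  split_ifs with h
  · exact (hK v ⟨hv, h⟩).symm
  · rfl

/-- The multivalued dilogarithm. -/
noncomputable def dilog : ℂ → ℂ := exists_dilog.choose

/-- A global section with integral jumps. -/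
noncomputable def gauge (u : TwicePunctured) : Unip := ⟨nlog u, nlog (1 - u), dilog u, 0, 0⟩

theorem exists_isSol_gauge (x : TwicePunctured) : ∃ r > 0, ∃ f : ℂ → Unip,
    IsSol f (Metric.ball x r) ∧
    ∀ y : TwicePunctured, (y : ℂ) ∈ Metric.ball (x : ℂ) r →
      gauge y * (f y)⁻¹ ∈ Unip.intSubgroup := by
  obtain ⟨Ψ, hΛ, hΨ, he⟩ := exists_dilog.choose_spec
  have hx0 : 0 < ‖(x : ℂ)‖ := norm_pos_iff.2 x.2.1
  have hx1 : 0 < ‖1 - (x : ℂ)‖ := norm_pos_iff.2 (sub_ne_zero.2 x.2.2.symm)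
  by_cases hx : (x : ℂ).re < 1
  · obtain ⟨A, hA⟩ := exists_branch x.2.1
    obtain ⟨r, hr, hrs⟩ := Metric.isOpen_iff.1
      (isOpen_lt Complex.continuous_re continuous_const) (x : ℂ) hx
    refine ⟨min r ‖(x : ℂ)‖, lt_min hr hx0,
      fun u => ⟨A u, nlog (1 - u), A u * nlog (1 - u) - Ψ u, 0, 0⟩, ?_, ?_⟩
    · have hs : ∀ u ∈ Metric.ball (x : ℂ) (min r ‖(x : ℂ)‖), 1 - u ∈ Complex.slitPlane := by
        intro u hu
        have : u.re < 1 := hrs (Metric.ball_subset_ball (min_le_left _ _) hu)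
        exact Or.inl (by simpa using this)
      have hA' := fun u (hu : u ∈ Metric.ball (x : ℂ) (min r ‖(x : ℂ)‖)) =>
        (hA u (Metric.ball_subset_ball (min_le_right _ _) hu)).1
      refine ⟨hA', fun u hu => hasDerivAt_nlog_one_sub (hs u hu), fun u hu => ?_⟩
      have h0 : u ≠ 0 := fun h => by
        have := Metric.ball_subset_ball (min_le_right _ _) hu
        rw [h, Metric.mem_ball, dist_zero_left] at this
        exact lt_irrefl _ this
      refine (((hA' u hu).mul (hasDerivAt_nlog_one_sub (hs u hu))).sub
        (hΨ u (hrs (Metric.ball_subset_ball (min_le_left _ _) hu)) h0)).congr_deriv ?_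
      ring
    · intro y hy
      obtain ⟨n, hn⟩ := (hA y (Metric.ball_subset_ball (min_le_right _ _) hy)).2
      have hy1 : (y : ℂ).re < 1 := hrs (Metric.ball_subset_ball (min_le_left _ _) hy)
      refine ⟨⟨n, ?_⟩, ⟨0, ?_⟩, ⟨0, ?_⟩⟩
      · simp [gauge, ← hn]; ring
      · simp [gauge]
      · simp only [gauge, Unip.mul_g, Unip.inv_g, Unip.inv_b, dilog, he _ hy1]
        push_cast
        ring
  · obtain ⟨A, hA⟩ := exists_branch (sub_ne_zero.2 x.2.2.symm)
    obtain ⟨r, hr, hrs⟩ := Metric.isOpen_iff.1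
      (isOpen_lt continuous_const Complex.continuous_re) (x : ℂ)
      (lt_of_lt_of_le zero_lt_one (not_lt.1 hx))
    have hb : ∀ u ∈ Metric.ball (x : ℂ) (min r ‖1 - (x : ℂ)‖),
        1 - u ∈ Metric.ball (1 - (x : ℂ)) ‖1 - (x : ℂ)‖ := fun u hu => by
      rw [Metric.mem_ball, dist_sub_left]
      exact lt_of_lt_of_le hu (min_le_right _ _)
    refine ⟨min r ‖1 - (x : ℂ)‖, lt_min hr hx1, fun u => ⟨nlog u, A (1 - u), dilog u, 0, 0⟩, ?_, ?_⟩
    · have hs : ∀ u ∈ Metric.ball (x : ℂ) (min r ‖1 - (x : ℂ)‖), 0 < u.re := fun u hu =>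
        hrs (Metric.ball_subset_ball (min_le_left _ _) hu)
      refine ⟨fun u hu => hasDerivAt_nlog (Or.inl (hs u hu)), fun u hu => ?_, fun u hu => ?_⟩
      · exact ((hA _ (hb u hu)).1.comp u ((hasDerivAt_id u).const_sub 1)).congr_deriv (by ring)
      · refine hΛ u (hs u hu) fun h => ?_
        have := hb u hu
        rw [h, sub_self, Metric.mem_ball, dist_zero_left] at this
        exact lt_irrefl _ this
    · intro y hy
      obtain ⟨n, hn⟩ := (hA (1 - y) (hb y hy)).2
      refine ⟨⟨0, ?_⟩, ⟨n, ?_⟩, ⟨0, ?_⟩⟩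
      · simp [gauge]
      · simp [gauge, ← hn]; ring
      · simp only [gauge, Unip.mul_g, Unip.inv_g, Unip.inv_b]
        push_cast
        ring

theorem exists_hol_eq {γ : I → TwicePunctured} (hγ : Continuous γ) (h : γ 0 = γ 1) :
    ∃ n ∈ Unip.intSubgroup, hol cocycle γ = (gauge (γ 0))⁻¹ * n * gauge (γ 0) := by
  have hg := hol_gauge (c' := fun y z => gauge y * cocycle y z * (gauge z)⁻¹)
    isLocalCocycle_cocycle hγ gauge fun x => ⟨Set.univ, Filter.univ_mem, fun _ _ _ _ => rfl⟩
  have hc : IsLocalCocycle fun y z => gauge y * cocycle y z * (gauge z)⁻¹ := fun x => by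
    obtain ⟨U, hU, hUc⟩ := isLocalCocycle_cocycle x
    refine ⟨U, hU, fun y hy z hz w hw => ?_⟩
    dsimp only
    rw [← hUc y hy z hz w hw]
    group
  refine ⟨_, hol_mem hc hγ Unip.intSubgroup fun x => ?_, ?_⟩
  · obtain ⟨r, hr, f, hf, hf'⟩ := exists_isSol_gauge x
    set ρ := min r (rad x / 3) with hρ
    have hρ0 : 0 < ρ := lt_min hr (by have := rad_pos x; positivity)
    refine ⟨Subtype.val ⁻¹' Metric.ball (x : ℂ) ρ, continuous_subtype_val.continuousAt
      (Metric.ball_mem_nhds _ hρ0), fun y hy z hz => ?_⟩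
    have hs1 : Metric.ball (x : ℂ) ρ ⊆ Metric.ball (x : ℂ) r :=
      Metric.ball_subset_ball (min_le_left _ _)
    have hs2 : Metric.ball (x : ℂ) ρ ⊆ Metric.ball (x : ℂ) (rad x / 3) :=
      Metric.ball_subset_ball (min_le_right _ _)
    obtain ⟨e1, e2, e3⟩ := ((((isFullSol_sol y).toIsSol.mono (ball_subset_ball (hs2 hy))).mono
      hs2).mul (f y)).eqOn (hf.mono hs1) Metric.isOpen_ball (convex_ball _ _).isPreconnected
      (u₀ := y) hy (by rw [sol_self, mul_one]) (by rw [sol_self, mul_one])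
      (by rw [sol_self, mul_one]) z hz
    have hm : f y * cocycle y z * (f z)⁻¹ ∈ Unip.intSubgroup := by
      refine ⟨⟨0, ?_⟩, ⟨0, ?_⟩, ⟨0, ?_⟩⟩
      · rw [Unip.mul_a, cocycle, e1]; simp
      · rw [Unip.mul_b, cocycle, e2]; simp
      · rw [Unip.mul_g, cocycle, e3, e1]; simp
    have := mul_mem (mul_mem (hf' y (hs1 hy)) hm) (inv_mem (hf' z (hs1 hz)))
    convert this using 1
    group
  · rw [hg, ← h]
    group

/-- The central coordinate of the holonomy of a loop, modulo integers. -/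
theorem exp_hol_g {γ : I → TwicePunctured} (hγ : Continuous γ) (h : γ 0 = γ 1) :
    ∃ m n : ℤ, (hol cocycle γ).a = m ∧ (hol cocycle γ).b = n ∧
      Complex.exp (2 * Real.pi * Complex.I * (hol cocycle γ).g) =
        (1 - (γ 0 : ℂ)) ^ m * (γ 0 : ℂ) ^ (-n) := by
  obtain ⟨N, ⟨⟨m, hm⟩, ⟨n, hn⟩, ⟨k, hk⟩⟩, he⟩ := exists_hol_eq hγ h
  refine ⟨m, n, by simp [he, hm], by simp [he, hn], ?_⟩
  have e : (hol cocycle γ).g = k + m * nlog (1 - γ 0) + (-n : ℤ) * nlog (γ 0) := by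
    rw [he]
    simp only [Unip.mul_g, Unip.mul_a, Unip.inv_g, Unip.inv_a, gauge, hm, hn, hk]
    push_cast
    ring
  rw [e, mul_add, mul_add, Complex.exp_add, Complex.exp_add, mul_comm _ (k : ℂ),
    Complex.exp_int_mul_two_pi_mul_I, one_mul, mul_left_comm, Complex.exp_int_mul,
    exp_nlog (sub_ne_zero.2 (γ 0).2.2.symm), mul_left_comm, Complex.exp_int_mul,
    exp_nlog (γ 0).2.1]

end TwicePunctured

section SegmentCocycle

variable {E : Type*} [NormedAddCommGroup E] [NormedSpace ℝ E]

/-- A function of two variables satisfying the cocycle rule on all triangles contained in `X`. -/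
def IsSegCocycle (c : E → E → ℂ) (X : Set E) : Prop :=
  ∀ x y z, convexHull ℝ {x, y, z} ⊆ X → c x y + c y z = c x z

/-- `F` is a local primitive of `c` at all points of `U`. -/
def IsPrim (c : E → E → ℂ) (U : Set E) (F : E → ℂ) : Prop :=
  ∀ x ∈ U, ∀ᶠ y in 𝓝 x, c x y = F y - F x

def ExactOn (c : E → E → ℂ) (U : Set E) : Prop := ∃ F, IsPrim c U F

variable {c c' : E → E → ℂ} {X U V C : Set E} {F F' : E → ℂ}

theorem IsSegCocycle.mono (h : IsSegCocycle c X) (hU : U ⊆ X) : IsSegCocycle c U :=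
  fun x y z hx => h x y z (hx.trans hU)

theorem IsSegCocycle.add_of_convex (h : IsSegCocycle c X) (hC : Convex ℝ C) (hCX : C ⊆ X)
    {x y z : E} (hx : x ∈ C) (hy : y ∈ C) (hz : z ∈ C) : c x y + c y z = c x z := by
  refine h x y z ((convexHull_min ?_ hC).trans hCX)
  rintro _ (rfl | rfl | rfl) <;> assumption

theorem IsPrim.mono (h : IsPrim c U F) (hV : V ⊆ U) : IsPrim c V F := fun x hx => h x (hV hx)

theorem ExactOn.mono (h : ExactOn c U) (hV : V ⊆ U) : ExactOn c V :=
  ⟨h.choose, h.choose_spec.mono hV⟩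

theorem IsSegCocycle.exact_of_convex (h : IsSegCocycle c X) (hC : Convex ℝ C) (hCX : C ⊆ X)
    (hCo : IsOpen C) : ExactOn c C := by
  rcases C.eq_empty_or_nonempty with rfl | ⟨x₀, h₀⟩
  · exact ⟨0, fun x hx => hx.elim⟩
  · refine ⟨c x₀, fun x hx => ?_⟩
    filter_upwards [hCo.mem_nhds hx] with y hy
    rw [← h.add_of_convex hC hCX h₀ hx hy]
    ring

theorem IsPrim.comb (h : IsPrim c U F) (h' : IsPrim c' U F') (k : ℂ) :
    IsPrim (fun x y => c x y - k * c' x y) U fun x => F x - k * F' x := fun x hx => by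
  filter_upwards [h x hx, h' x hx] with y hy hy'
  rw [hy, hy']; ring

theorem ExactOn.comb (h : ExactOn c U) (h' : ExactOn c' U) (k : ℂ) :
    ExactOn (fun x y => c x y - k * c' x y) U :=
  let ⟨_, hF⟩ := h
  let ⟨_, hF'⟩ := h'
  ⟨_, hF.comb hF' k⟩

theorem IsPrim.eq_add_const (h : IsPrim c U F) (h' : IsPrim c U F') (hU : IsPreconnected U) :
    ∃ k, ∀ x ∈ U, F x = F' x + k := by
  rcases U.eq_empty_or_nonempty with rfl | ⟨x₀, h₀⟩
  · exact ⟨0, fun x hx => hx.elim⟩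
  · have := isPreconnected_iff_preconnectedSpace.1 hU
    have hl : IsLocallyConstant fun x : U => F x - F' x := by
      refine (IsLocallyConstant.iff_eventually_eq _).2 fun x => ?_
      have : Filter.Tendsto (Subtype.val : U → E) (𝓝 x) (𝓝 x) :=
        continuous_subtype_val.continuousAt
      filter_upwards [this.eventually (h x x.2), this.eventually (h' x x.2)] with y hy hy'
      linear_combination hy' - hy
    refine ⟨F x₀ - F' x₀, fun x hx => ?_⟩
    have := hl.apply_eq_of_preconnectedSpace ⟨x, hx⟩ ⟨x₀, h₀⟩
    linear_combination this

theorem IsPrim.add_const (h : IsPrim c U F) (k : ℂ) : IsPrim c U fun x => F x + k :=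
  fun x hx => (h x hx).mono fun y hy => by rw [hy]; ring

open Classical in
theorem IsPrim.glue (h : IsPrim c U F) (h' : IsPrim c V F') (hU : IsOpen U) (hV : IsOpen V)
    (he : ∀ x ∈ U ∩ V, F x = F' x) : IsPrim c (U ∪ V) fun x => if x ∈ U then F x else F' x := by
  intro x hx
  by_cases hxU : x ∈ U
  · filter_upwards [h x hxU, hU.mem_nhds hxU] with y hy hyU
    simp only [if_pos hxU, if_pos hyU, hy]
  · have hxV : x ∈ V := hx.resolve_left hxU
    filter_upwards [h' x hxV, hV.mem_nhds hxV] with y hy hyV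
    by_cases hyU : y ∈ U
    · simp only [if_neg hxU, if_pos hyU, hy, he y ⟨hyU, hyV⟩]
    · simp only [if_neg hxU, if_neg hyU, hy]

theorem ExactOn.glue (h : ExactOn c U) (h' : ExactOn c V) (hU : IsOpen U) (hV : IsOpen V)
    (hc : IsPreconnected (U ∩ V)) : ExactOn c (U ∪ V) := by
  classical
  obtain ⟨F, hF⟩ := h
  obtain ⟨F', hF'⟩ := h'
  obtain ⟨k, hk⟩ := (hF.mono Set.inter_subset_left).eq_add_const
    (hF'.mono Set.inter_subset_right) hc
  exact ⟨_, hF.glue (hF'.add_const k) hU hV hk⟩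

theorem ExactOn.congr (h : ExactOn c U) (he : ∀ x y, c x y = c' x y) : ExactOn c' U := by
  have : c = c' := funext fun x => funext fun y => he x y
  exact this ▸ h

/-- The winding cocycle of a complex-valued function. -/
noncomputable def wind (ℓ : E → ℂ) (x y : E) : ℂ :=
  Complex.log (ℓ y / ℓ x) / (2 * Real.pi * Complex.I)

theorem Complex.log_div_of_re_pos {z w : ℂ} (hz : 0 < z.re) (hw : 0 < w.re) :
    Complex.log (w / z) = Complex.log w - Complex.log z := by
  have hz0 : z ≠ 0 := fun h => by simp [h] at hz
  have hw0 : w ≠ 0 := fun h => by simp [h] at hw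
  have az := abs_lt.1 (Complex.abs_arg_lt_pi_div_two_iff.2 (Or.inl hz))
  have aw := abs_lt.1 (Complex.abs_arg_lt_pi_div_two_iff.2 (Or.inl hw))
  have e : z⁻¹.arg = -z.arg := by
    rw [Complex.arg_inv, if_neg]
    intro h; linarith [Real.pi_pos]
  rw [div_eq_mul_inv, Complex.log_mul hw0 (inv_ne_zero hz0), Complex.log_inv, sub_eq_add_neg]
  · intro h; linarith [Real.pi_pos]
  · rw [e]; constructor <;> linarith [Real.pi_pos]

theorem wind_eq_of_re_pos {ℓ : E → ℂ} {ω : ℂ} {x y : E} (hx : 0 < (ω * ℓ x).re)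
    (hy : 0 < (ω * ℓ y).re) :
    wind ℓ x y = Complex.log (ω * ℓ y) / (2 * Real.pi * Complex.I)
      - Complex.log (ω * ℓ x) / (2 * Real.pi * Complex.I) := by
  have hω : ω ≠ 0 := fun h => by simp [h] at hx
  rw [← sub_div, ← Complex.log_div_of_re_pos hx hy, mul_div_mul_left _ _ hω, wind]

theorem exists_re_pos_of_convex {ℓ : E →ᵃ[ℝ] ℂ} {S : Set E} (hS : Convex ℝ S) (hc : IsCompact S)
    (hℓ : Continuous ℓ) (h0 : ∀ x ∈ S, ℓ x ≠ 0) : ∃ ω : ℂ, ∀ x ∈ S, 0 < (ω * ℓ x).re := by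
  obtain ⟨f, u, h, h'⟩ := RCLike.geometric_hahn_banach_point_closed (𝕜 := ℂ) (E := ℂ)
    (hS.affine_image ℓ) (hc.image hℓ).isClosed (x := 0)
    (by rintro ⟨x, hx, h⟩; exact h0 x hx h)
  refine ⟨f 1, fun x hx => ?_⟩
  have e : f 1 * ℓ x = f (ℓ x) := by
    rw [mul_comm, ← smul_eq_mul, ← map_smul, smul_eq_mul, mul_one]
  rw [e]
  have := h' _ ⟨x, hx, rfl⟩
  simp at h this
  linarith

theorem isSegCocycle_wind {ℓ : E →ᵃ[ℝ] ℂ} (hℓ : Continuous ℓ) :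
    IsSegCocycle (wind ℓ) {x | ℓ x ≠ 0} := by
  intro x y z h
  obtain ⟨ω, hω⟩ := exists_re_pos_of_convex (convex_convexHull ℝ _)
    ((Set.toFinite {x, y, z}).isCompact_convexHull ℝ) hℓ h
  have hs := subset_convexHull ℝ {x, y, z}
  have hx := hω x (hs (by simp))
  have hy := hω y (hs (by simp))
  have hz := hω z (hs (by simp))
  rw [wind_eq_of_re_pos hx hy, wind_eq_of_re_pos hy hz, wind_eq_of_re_pos hx hz]
  ring

end SegmentCocycle

section SegmentCocycle

variable {E : Type*} [NormedAddCommGroup E] [NormedSpace ℝ E]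
variable {c c' : E → E → ℂ} {X U V C : Set E} {F F' : E → ℂ} {ℓ : E →ᵃ[ℝ] ℂ}

theorem isPrim_wind (hℓ : Continuous ℓ) (ω : ℂ) :
    IsPrim (wind ℓ) {x | ω * ℓ x ∈ Complex.slitPlane}
      fun x => Complex.log (ω * ℓ x) / (2 * Real.pi * Complex.I) := by
  intro x hx
  have hx : ω * ℓ x ∈ Complex.slitPlane := hx
  have hx0 := Complex.slitPlane_ne_zero hx
  have hω : ω ≠ 0 := left_ne_zero_of_mul hx0
  have hℓx : ℓ x ≠ 0 := right_ne_zero_of_mul hx0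
  have h1 : ContinuousAt (fun y => (ℓ y / ℓ x).arg) x := by
    refine ContinuousAt.comp (g := Complex.arg) ?_ (hℓ.div_const _).continuousAt
    rw [div_self hℓx]
    exact Complex.continuousAt_arg Complex.one_mem_slitPlane
  have h2 := (h1.add_const (ω * ℓ x).arg)
  have h3 : (fun y => (ℓ y / ℓ x).arg + (ω * ℓ x).arg) x ∈ Set.Ioo (-Real.pi) Real.pi := by
    simp only [div_self hℓx, Complex.arg_one, zero_add]
    exact ⟨Complex.neg_pi_lt_arg _, lt_of_le_of_ne (Complex.arg_le_pi _)
      (Complex.mem_slitPlane_iff_arg.1 hx).1⟩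
  filter_upwards [h2.eventually (isOpen_Ioo.mem_nhds h3), hℓ.continuousAt.eventually_ne hℓx]
    with y hy hy0
  have e : ω * ℓ y = ℓ y / ℓ x * (ω * ℓ x) := by field_simp
  rw [e, Complex.log_mul (div_ne_zero hy0 hℓx) hx0 ⟨hy.1, hy.2.le⟩, wind]
  ring

/-- The part of `C` where `ω * ℓ` has positive real part. -/
def halfSet (C : Set E) (ℓ : E →ᵃ[ℝ] ℂ) (ω : ℂ) : Set E := C ∩ {x | 0 < (ω * ℓ x).re}

theorem isOpen_halfSet (hC : IsOpen C) (hℓ : Continuous ℓ) (ω : ℂ) : IsOpen (halfSet C ℓ ω) :=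
  hC.inter (isOpen_lt continuous_const (Complex.continuous_re.comp (continuous_const.mul hℓ)))

theorem convex_halfSet (hC : Convex ℝ C) (ω : ℂ) : Convex ℝ (halfSet C ℓ ω) := by
  refine hC.inter ?_
  intro x hx y hy a b ha hb hab
  have e : ℓ (a • x + b • y) = a * ℓ x + b * ℓ y := by
    have := Convex.combo_affine_apply (f := ℓ) (x := x) (y := y) hab
    simpa using this
  have hx : 0 < (ω * ℓ x).re := hx
  have hy : 0 < (ω * ℓ y).re := hy
  show 0 < (ω * ℓ (a • x + b • y)).re
  have e' : (ω * ℓ (a • x + b • y)).re = a * (ω * ℓ x).re + b * (ω * ℓ y).re := by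
    rw [e]; simp; ring
  rw [e']
  rcases ha.eq_or_lt with rfl | ha
  · have : b = 1 := by linarith
    subst this; simpa using hy
  · positivity

theorem halfSet_subset (ω : ℂ) : halfSet C ℓ ω ⊆ C ∩ {x | ℓ x ≠ 0} := fun x hx =>
  ⟨hx.1, fun h => by simpa [h] using hx.2⟩

theorem exactOn_three_halfSets (hC : Convex ℝ C) (hCo : IsOpen C) (hℓ : Continuous ℓ)
    (hc : IsSegCocycle c (C ∩ {x | ℓ x ≠ 0})) :
    ExactOn c (halfSet C ℓ 1 ∪ halfSet C ℓ (-Complex.I) ∪ halfSet C ℓ (-1)) := by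
  have ex : ∀ ω, ExactOn c (halfSet C ℓ ω) := fun ω =>
    hc.exact_of_convex (convex_halfSet hC ω) (halfSet_subset ω) (isOpen_halfSet hCo hℓ ω)
  have op := isOpen_halfSet hCo hℓ
  have cv : ∀ ω, Convex ℝ (halfSet C ℓ ω) := convex_halfSet hC
  refine ((ex 1).glue (ex (-Complex.I)) (op _) (op _) ((cv _).inter (cv _)).isPreconnected).glue
    (ex (-1)) ((op _).union (op _)) (op _) ?_
  have : (halfSet C ℓ 1 ∪ halfSet C ℓ (-Complex.I)) ∩ halfSet C ℓ (-1)
      = halfSet C ℓ (-Complex.I) ∩ halfSet C ℓ (-1) := by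
    ext x
    simp only [halfSet, Set.mem_inter_iff, Set.mem_union, Set.mem_ofPred_eq]
    constructor
    · rintro ⟨⟨-, h⟩ | h, h'⟩
      · have := h'.2
        simp at h this
        linarith
      · exact ⟨h, h'⟩
    · exact fun ⟨h, h'⟩ => ⟨Or.inr h, h'⟩
  rw [this]
  exact ((cv _).inter (cv _)).isPreconnected

theorem log_neg_I_of_re_pos {z : ℂ} (hz : 0 < z.re) :
    Complex.log (-Complex.I * z) / (2 * Real.pi * Complex.I)
      = Complex.log (Complex.I * z) / (2 * Real.pi * Complex.I) - 1 / 2 := by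
  have := Complex.arg_neg_eq_arg_sub_pi_of_im_pos (x := Complex.I * z) (by simpa using hz)
  rw [neg_mul, Complex.log, this, norm_neg, Complex.log]
  have := Real.pi_ne_zero
  have := Complex.I_ne_zero
  field_simp
  push_cast
  ring

theorem log_neg_I_of_re_neg {z : ℂ} (hz : z.re < 0) :
    Complex.log (-Complex.I * z) / (2 * Real.pi * Complex.I)
      = Complex.log (Complex.I * z) / (2 * Real.pi * Complex.I) + 1 / 2 := by
  have := Complex.arg_neg_eq_arg_add_pi_of_im_neg (x := Complex.I * z) (by simpa using hz)
  rw [neg_mul, Complex.log, this, norm_neg, Complex.log]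
  have := Real.pi_ne_zero
  have := Complex.I_ne_zero
  field_simp
  push_cast
  ring

theorem three_halfSets_subset_slit : halfSet C ℓ 1 ∪ halfSet C ℓ (-Complex.I) ∪ halfSet C ℓ (-1)
    ⊆ {x | -Complex.I * ℓ x ∈ Complex.slitPlane} := by
  rintro x ((h | h) | h) <;>
  · have := h.2
    simp [Complex.mem_slitPlane_iff] at this ⊢
    first | exact Or.inl this | exact Or.inr (by linarith)

theorem halfSet_I_subset_slit : halfSet C ℓ Complex.I
    ⊆ {x | Complex.I * ℓ x ∈ Complex.slitPlane} := fun _ h => Or.inl h.2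

/-- Up to a multiple of the winding cocycle, every cocycle on the complement of a complex affine
hyperplane in a convex open set is exact. -/
theorem IsSegCocycle.exists_exactOn_sub_wind (hC : Convex ℝ C) (hCo : IsOpen C)
    (hℓ : Continuous ℓ) (hc : IsSegCocycle c (C ∩ {x | ℓ x ≠ 0})) :
    ∃ k, ExactOn (fun x y => c x y - k * wind ℓ x y) (C ∩ {x | ℓ x ≠ 0}) := by
  classical
  obtain ⟨F, hF⟩ := exactOn_three_halfSets hC hCo hℓ hc
  have op := isOpen_halfSet hCo hℓ
  have cv : ∀ ω, Convex ℝ (halfSet C ℓ ω) := convex_halfSet hC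
  obtain ⟨F', hF'⟩ := hc.exact_of_convex (cv Complex.I) (halfSet_subset _) (op _)
  have hW := (isPrim_wind hℓ (-Complex.I)).mono (three_halfSets_subset_slit (C := C))
  have hW' := (isPrim_wind hℓ Complex.I).mono (halfSet_I_subset_slit (C := C))
  obtain ⟨d, hd⟩ := (hF.mono (V := halfSet C ℓ 1 ∩ halfSet C ℓ Complex.I)
    (fun x hx => Or.inl (Or.inl hx.1))).eq_add_const (hF'.mono Set.inter_subset_right)
    ((cv _).inter (cv _)).isPreconnected
  obtain ⟨e, he⟩ := (hF.mono (V := halfSet C ℓ (-1) ∩ halfSet C ℓ Complex.I)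
    (fun x hx => Or.inr hx.1)).eq_add_const (hF'.mono Set.inter_subset_right)
    ((cv _).inter (cv _)).isPreconnected
  have hg := (hF.comb hW (e - d)).glue ((hF'.comb hW' (e - d)).add_const ((d + e) / 2))
    (((op _).union (op _)).union (op _)) (op _) (by
      rintro x ⟨hx, hx'⟩
      by_cases h1 : x ∈ halfSet C ℓ 1
      · have := h1.2
        simp only [hd x ⟨h1, hx'⟩]
        rw [log_neg_I_of_re_pos (by simpa using this)]
        ring
      by_cases h2 : x ∈ halfSet C ℓ (-1)
      · have := h2.2
        simp only [he x ⟨h2, hx'⟩]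
        rw [log_neg_I_of_re_neg (by simpa using this)]
        ring
      · have h3 := ((hx.resolve_right h2).resolve_left h1).2
        have h4 := hx'.2
        simp at h3 h4
        linarith)
  refine ⟨e - d, _, hg.mono ?_⟩
  rintro x ⟨hx, hx0⟩
  by_contra hn
  simp only [halfSet, Set.mem_union, Set.mem_inter_iff, hx, true_and, Set.mem_ofPred_eq] at hn
  simp at hn
  exact hx0 (Complex.ext (by simp; linarith) (by simp; linarith))

/-- The winding cocycle around a hyperplane meeting the open convex set is not exact. -/
theorem eq_zero_of_exactOn_mul_wind (hC : Convex ℝ C) (hℓ : Continuous ℓ) {k : ℂ}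
    (h : ExactOn (fun x y => k * wind ℓ x y) (C ∩ {x | ℓ x ≠ 0})) {t : ℝ} (ht : 0 < t)
    (hs : ∀ s : ℂ, ‖s‖ ≤ 2 * t → ∃ x ∈ C, ℓ x = s) : k = 0 := by
  obtain ⟨F, hF⟩ := h
  have cv : ∀ ω, Convex ℝ (halfSet C ℓ ω) := convex_halfSet hC
  have hz : IsPrim (fun _ _ : E => (0 : ℂ)) Set.univ fun _ => 0 := fun x _ => by simp
  have hW := (isPrim_wind hℓ (-Complex.I)).mono (three_halfSets_subset_slit (C := C))
  have hW' := (isPrim_wind hℓ Complex.I).mono (halfSet_I_subset_slit (C := C))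
  have hkW := (hz.mono (Set.subset_univ _)).comb hW (-k)
  have hkW' := (hz.mono (Set.subset_univ _)).comb hW' (-k)
  simp only [zero_sub, neg_mul, neg_neg] at hkW hkW'
  have pt : ∀ a b : ℝ, |a| = t → |b| = t → ∃ x ∈ C, (ℓ x).re = a ∧ (ℓ x).im = b := by
    intro a b ha hb
    obtain ⟨x, hx, he⟩ := hs ⟨a, b⟩ (by
      refine (Complex.norm_le_abs_re_add_abs_im _).trans ?_
      simp only [ha, hb]; linarith)
    exact ⟨x, hx, by rw [he], by rw [he]⟩
  have at' : |t| = t := abs_of_pos ht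
  have ant : |-t| = t := by rw [abs_neg, at']
  have p1 : IsPreconnected (halfSet C ℓ 1 ∪ halfSet C ℓ (-Complex.I)) := by
    obtain ⟨x, hx, h1, h2⟩ := pt t t at' at'
    exact (cv _).isPreconnected.union x ⟨hx, by simpa [h1]⟩ ⟨hx, by simpa [h2]⟩
      (cv _).isPreconnected
  have p2 : IsPreconnected (halfSet C ℓ 1 ∪ halfSet C ℓ (-Complex.I) ∪ halfSet C ℓ (-1)) := by
    obtain ⟨x, hx, h1, h2⟩ := pt (-t) t ant at'
    exact p1.union x (Or.inr ⟨hx, by simpa [h2]⟩) ⟨hx, by simpa [h1]⟩ (cv _).isPreconnected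
  obtain ⟨d, hd⟩ := (hF.mono (Set.union_subset (Set.union_subset (halfSet_subset _)
    (halfSet_subset _)) (halfSet_subset _))).eq_add_const hkW p2
  obtain ⟨e, he⟩ := (hF.mono (halfSet_subset _)).eq_add_const hkW' (cv _).isPreconnected
  obtain ⟨x, hx, h1, h2⟩ := pt t (-t) at' ant
  obtain ⟨y, hy, h1', h2'⟩ := pt (-t) (-t) ant ant
  have a1 := hd x (Or.inl (Or.inl ⟨hx, by simpa [h1]⟩))
  have a2 := he x ⟨hx, by simpa [h2]⟩
  have b1 := hd y (Or.inr ⟨hy, by simpa [h1']⟩)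
  have b2 := he y ⟨hy, by simpa [h2']⟩
  rw [← neg_mul, log_neg_I_of_re_pos (by rw [h1]; exact ht)] at a1
  rw [← neg_mul, log_neg_I_of_re_neg (by rw [h1']; linarith)] at b1
  linear_combination a1 - a2 - b1 + b2

end SegmentCocycle

section SegmentCocycle

variable {E : Type*} [NormedAddCommGroup E] [NormedSpace ℝ E]
variable {c c' : E → E → ℂ} {X U V C : Set E} {ι : Type*}

theorem ExactOn.sub_sum {w : ι → E → E → ℂ} (s : Finset ι) (k : ι → ℂ) (h : ExactOn c U)
    (hw : ∀ i ∈ s, ExactOn (w i) U) : ExactOn (fun x y => c x y - ∑ i ∈ s, k i * w i x y) U := by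
  classical
  induction s using Finset.induction_on with
  | empty => simpa using h
  | insert a s ha ih =>
    refine ((ih fun i hi => hw i (Finset.mem_insert_of_mem hi)).comb
      (hw a (Finset.mem_insert_self a s)) (k a)).congr fun x y => ?_
    rw [Finset.sum_insert ha]; ring

theorem IsSegCocycle.sub_sum {w : ι → E → E → ℂ} (s : Finset ι) (k : ι → ℂ)
    (h : IsSegCocycle c X) (hw : ∀ i ∈ s, IsSegCocycle (w i) X) :
    IsSegCocycle (fun x y => c x y - ∑ i ∈ s, k i * w i x y) X := fun x y z hx => by
  have : ∀ i ∈ s, k i * w i x z = k i * w i x y + k i * w i y z := fun i hi => by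
    rw [← hw i hi x y z hx, mul_add]
  dsimp only
  rw [Finset.sum_congr rfl this, Finset.sum_add_distrib, ← h x y z hx]
  ring

/-- Hyperplanes which are separated by a real-valued function contribute independently to the
obstruction to exactness. -/
theorem IsSegCocycle.exists_exactOn_sub_sum_wind {ℓ : ι → E →ᵃ[ℝ] ℂ} (hℓ : ∀ i, Continuous (ℓ i))
    (u : E →L[ℝ] ℝ) (ρ : ι → ℝ) {η : ℝ} (hη : 0 < η) (S : Finset ι)
    (hρ : ∀ i ∈ S, ∀ j ∈ S, i ≠ j → 4 * η ≤ |ρ i - ρ j|) (C : Set E) (hC : Convex ℝ C)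
    (hCo : IsOpen C) (hu : ∀ i ∈ S, ∀ x ∈ C, ℓ i x = 0 → |u x - ρ i| < η)
    (hc : IsSegCocycle c (C ∩ {x | ∀ i ∈ S, ℓ i x ≠ 0})) :
    ∃ k : ι → ℂ, ExactOn (fun x y => c x y - ∑ i ∈ S, k i * wind (ℓ i) x y)
      (C ∩ {x | ∀ i ∈ S, ℓ i x ≠ 0}) := by
  classical
  induction S using Finset.induction_on_max_value ρ generalizing C with
  | empty =>
    refine ⟨0, ?_⟩
    have := hc.exact_of_convex (C := C) hC (by simp) hCo
    simpa using this
  | insert a s ha hmax ih =>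
    have hCU : Convex ℝ (C ∩ {x | u x < ρ a - η}) :=
      hC.inter (convex_halfSpace_lt u.toLinearMap.isLinear _)
    have hCV : Convex ℝ (C ∩ {x | ρ a - 3 * η < u x}) :=
      hC.inter (convex_halfSpace_gt u.toLinearMap.isLinear _)
    have hUo : IsOpen (C ∩ {x | u x < ρ a - η}) :=
      hCo.inter (isOpen_lt u.continuous continuous_const)
    have hVo : IsOpen (C ∩ {x | ρ a - 3 * η < u x}) :=
      hCo.inter (isOpen_lt continuous_const u.continuous)
    have hUa : ∀ x ∈ C ∩ {x | u x < ρ a - η}, ℓ a x ≠ 0 := fun x hx h0 => by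
      have h1 := abs_lt.1 (hu a (Finset.mem_insert_self a s) x hx.1 h0)
      have h2 : u x < ρ a - η := hx.2
      linarith
    have hVs : ∀ x ∈ C ∩ {x | ρ a - 3 * η < u x}, ∀ i ∈ s, ℓ i x ≠ 0 := fun x hx i hi h0 => by
      have h1 := abs_lt.1 (hu i (Finset.mem_insert_of_mem hi) x hx.1 h0)
      have h2 : ρ a - 3 * η < u x := hx.2
      have h3 := hρ a (Finset.mem_insert_self a s) i (Finset.mem_insert_of_mem hi)
        (fun e => ha (e ▸ hi))
      rw [abs_of_nonneg (sub_nonneg.2 (hmax i hi))] at h3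
      linarith
    have hUsub : C ∩ {x | u x < ρ a - η} ∩ {x | ∀ i ∈ s, ℓ i x ≠ 0} ⊆
        C ∩ {x | ∀ i ∈ insert a s, ℓ i x ≠ 0} := fun x hx =>
      ⟨hx.1.1, fun i hi => by
        rcases Finset.mem_insert.1 hi with rfl | hi
        · exact hUa x hx.1
        · exact hx.2 i hi⟩
    have hVsub : C ∩ {x | ρ a - 3 * η < u x} ∩ {x | ℓ a x ≠ 0} ⊆
        C ∩ {x | ∀ i ∈ insert a s, ℓ i x ≠ 0} := fun x hx =>
      ⟨hx.1.1, fun i hi => by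
        rcases Finset.mem_insert.1 hi with rfl | hi
        · exact hx.2
        · exact hVs x hx.1 i hi⟩
    obtain ⟨k, hk⟩ := ih (fun i hi j hj => hρ i (Finset.mem_insert_of_mem hi) j
      (Finset.mem_insert_of_mem hj)) _ hCU hUo
      (fun i hi x hx => hu i (Finset.mem_insert_of_mem hi) x hx.1) (hc.mono hUsub)
    obtain ⟨m, hm⟩ := IsSegCocycle.exists_exactOn_sub_wind hCV hVo (hℓ a) (hc.mono hVsub)
    have hwa : ExactOn (wind (ℓ a)) (C ∩ {x | u x < ρ a - η}) :=
      (isSegCocycle_wind (hℓ a)).exact_of_convex hCU hUa hUo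
    have hws : ∀ i ∈ s, ExactOn (wind (ℓ i)) (C ∩ {x | ρ a - 3 * η < u x}) := fun i hi =>
      (isSegCocycle_wind (hℓ i)).exact_of_convex hCV (fun x hx => hVs x hx i hi) hVo
    have hsum : ∀ x y, ∑ i ∈ insert a s, Function.update k a m i * wind (ℓ i) x y
        = m * wind (ℓ a) x y + ∑ i ∈ s, k i * wind (ℓ i) x y := fun x y => by
      rw [Finset.sum_insert ha, Function.update_self]
      congr 1
      refine Finset.sum_congr rfl fun i hi => ?_
      rw [Function.update_of_ne (show i ≠ a from fun e => ha (e ▸ hi))]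
    refine ⟨Function.update k a m, ?_⟩
    have h1 : ExactOn (fun x y => c x y - ∑ i ∈ insert a s, Function.update k a m i *
        wind (ℓ i) x y) (C ∩ {x | u x < ρ a - η} ∩ {x | ∀ i ∈ s, ℓ i x ≠ 0}) :=
      (hk.comb (hwa.mono Set.inter_subset_left) m).congr fun x y => by rw [hsum]; ring
    have h2 : ExactOn (fun x y => c x y - ∑ i ∈ insert a s, Function.update k a m i *
        wind (ℓ i) x y) (C ∩ {x | ρ a - 3 * η < u x} ∩ {x | ℓ a x ≠ 0}) :=
      (hm.sub_sum s k fun i hi => (hws i hi).mono Set.inter_subset_left).congr fun x y => by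
        rw [hsum]; ring
    have o1 : IsOpen (C ∩ {x | u x < ρ a - η} ∩ {x | ∀ i ∈ s, ℓ i x ≠ 0}) := by
      refine hUo.inter ?_
      have : {x | ∀ i ∈ s, ℓ i x ≠ 0} = ⋂ i ∈ s, {x | ℓ i x ≠ 0} := by ext; simp
      rw [this]
      exact isOpen_biInter_finset fun i _ => isOpen_ne_fun (hℓ i) continuous_const
    have o2 : IsOpen (C ∩ {x | ρ a - 3 * η < u x} ∩ {x | ℓ a x ≠ 0}) :=
      hVo.inter (isOpen_ne_fun (hℓ a) continuous_const)
    have hinter : C ∩ {x | u x < ρ a - η} ∩ {x | ∀ i ∈ s, ℓ i x ≠ 0} ∩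
        (C ∩ {x | ρ a - 3 * η < u x} ∩ {x | ℓ a x ≠ 0}) =
        (C ∩ {x | u x < ρ a - η}) ∩ (C ∩ {x | ρ a - 3 * η < u x}) := by
      ext x
      exact ⟨fun h => ⟨h.1.1, h.2.1⟩, fun h => ⟨⟨h.1, hVs x h.2⟩, ⟨h.2, hUa x h.1⟩⟩⟩
    refine (h1.glue h2 o1 o2 (hinter ▸ (hCU.inter hCV).isPreconnected)).mono ?_
    rintro x ⟨hx, hx'⟩
    by_cases h : u x < ρ a - η
    · exact Or.inl ⟨⟨hx, h⟩, fun i hi => hx' i (Finset.mem_insert_of_mem hi)⟩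
    · exact Or.inr ⟨⟨hx, show ρ a - 3 * η < u x by linarith⟩, hx' a (Finset.mem_insert_self a s)⟩

end SegmentCocycle

section FiberedLines

variable {ι : Type*} [Fintype ι] {a b : ι → ℂ} {c : ℂ × ℂ → ℂ × ℂ → ℂ}

/-- The affine form `(z, t) ↦ z - (a t + b)`. -/
noncomputable def fibForm (a b : ℂ) : ℂ × ℂ →ᵃ[ℝ] ℂ :=
  (LinearMap.fst ℝ ℂ ℂ - (a • LinearMap.snd ℝ ℂ ℂ)).toAffineMap - AffineMap.const ℝ (ℂ × ℂ) b

theorem fibForm_apply (a b : ℂ) (p : ℂ × ℂ) : fibForm a b p = p.1 - (a * p.2 + b) := by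
  simp [fibForm]; ring

theorem continuous_fibForm (a b : ℂ) : Continuous (fibForm a b) := by
  have : ⇑(fibForm a b) = fun p : ℂ × ℂ => p.1 - (a * p.2 + b) := funext (fibForm_apply a b)
  rw [this]; fun_prop

/-- The complement of the lines `z = a i * t + b i`. -/
def fibCompl (a b : ι → ℂ) : Set (ℂ × ℂ) := {x | ∀ i, fibForm (a i) (b i) x ≠ 0}

theorem isOpen_fibCompl : IsOpen (fibCompl a b) := by
  have : fibCompl a b = ⋂ i, {x | fibForm (a i) (b i) x ≠ 0} := by ext; simp [fibCompl]
  rw [this]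
  exact isOpen_iInter_of_finite fun i => isOpen_ne_fun (continuous_fibForm _ _) continuous_const

theorem exists_re_mul_ne_zero (s : Finset ℂ) (hs : ∀ z ∈ s, z ≠ 0) :
    ∃ ω : ℂ, ∀ z ∈ s, (ω * z).re ≠ 0 := by
  obtain ⟨t, ht⟩ := Infinite.exists_notMem_finset (s.image fun z => z.re / z.im)
  refine ⟨1 + t * Complex.I, fun z hz h => ?_⟩
  have e : z.re = t * z.im := by
    simp [Complex.add_re, Complex.mul_re] at h
    linarith
  by_cases hi : z.im = 0
  · rw [hi, mul_zero] at e
    exact hs z hz (Complex.ext e hi)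
  · exact ht (Finset.mem_image.2 ⟨z, hz, by field_simp; linarith⟩)

/-- The part of the complement lying over a disc. -/
def fibTube (a b : ι → ℂ) (t : ℂ) (δ : ℝ) : Set (ℂ × ℂ) :=
  Prod.snd ⁻¹' Metric.ball t δ ∩ fibCompl a b

theorem exists_exactOn_fibTube (hc : IsSegCocycle c (fibCompl a b)) {t : ℂ}
    (ht : Function.Injective fun i => a i * t + b i) : ∃ δ > 0, ∃ k : ι → ℂ,
    ExactOn (fun x y => c x y - ∑ i, k i * wind (fibForm (a i) (b i)) x y) (fibTube a b t δ) := by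
  classical
  obtain ⟨ω, hω⟩ := exists_re_mul_ne_zero
    (((Finset.univ : Finset (ι × ι)).image fun p => (a p.1 * t + b p.1) - (a p.2 * t + b p.2)).erase
      0) (fun z hz => (Finset.mem_erase.1 hz).1)
  set ρ : ι → ℝ := fun i => (ω * (a i * t + b i)).re with hρ
  have hρ' : ∀ i j, i ≠ j → ρ i - ρ j ≠ 0 := fun i j hij => by
    have := hω ((a i * t + b i) - (a j * t + b j)) (Finset.mem_erase.2
      ⟨sub_ne_zero.2 (ht.ne hij), Finset.mem_image.2 ⟨(i, j), Finset.mem_univ _, rfl⟩⟩)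
    rwa [mul_sub, Complex.sub_re] at this
  obtain ⟨η, hη, hη0⟩ : ∃ η : ℝ, (∀ i j, i ≠ j → 4 * η ≤ |ρ i - ρ j|) ∧ 0 < η := by
    have : ∀ᶠ η in 𝓝[>] (0 : ℝ), ∀ i j, i ≠ j → 4 * η ≤ |ρ i - ρ j| := by
      refine Filter.eventually_all.2 fun i => Filter.eventually_all.2 fun j => ?_
      by_cases hij : i = j
      · exact Filter.Eventually.of_forall fun _ h => absurd hij h
      · have h0 : (0 : ℝ) < |ρ i - ρ j| / 4 := by have := abs_pos.2 (hρ' i j hij); positivity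
        filter_upwards [Ioo_mem_nhdsGT h0] with η h _
        linarith [h.2]
    exact (this.and self_mem_nhdsWithin).exists
  obtain ⟨δ, hδ0, hδ⟩ : ∃ δ > 0, ∀ s ∈ Metric.ball t δ, ∀ i,
      |(ω * (a i * s + b i)).re - ρ i| < η := by
    refine Metric.eventually_nhds_iff_ball.1 (Filter.eventually_all.2 fun i => ?_)
    have h : Continuous fun s => |(ω * (a i * s + b i)).re - ρ i| := by
      have := Complex.continuous_re
      fun_prop
    refine h.continuousAt.eventually (gt_mem_nhds ?_)
    simpa [hρ] using hη0
  have key := IsSegCocycle.exists_exactOn_sub_sum_wind (c := c)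
    (fun i => continuous_fibForm (a i) (b i))
    (Complex.reCLM.comp (((ContinuousLinearMap.mul ℝ ℂ ω)).comp (ContinuousLinearMap.fst ℝ ℂ ℂ))) ρ
    hη0 Finset.univ (fun i _ j _ => hη i j) (Prod.snd ⁻¹' Metric.ball t δ)
    ((convex_ball t δ).linear_preimage (LinearMap.snd ℝ ℂ ℂ))
    (Metric.isOpen_ball.preimage continuous_snd) (fun i _ x hx h0 => by
      rw [fibForm_apply, sub_eq_zero] at h0
      simpa [h0] using hδ x.2 hx i) (hc.mono fun x hx i => hx.2 i (Finset.mem_univ i))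
  obtain ⟨k, hk⟩ := key
  exact ⟨δ, hδ0, k, hk.mono fun x hx => ⟨hx.1, fun i _ => hx.2 i⟩⟩

theorem eq_of_exactOn_fibTube {t : ℂ} {δ : ℝ} (hδ : 0 < δ)
    (ht : Function.Injective fun i => a i * t + b i) {k k' : ι → ℂ}
    (h : ExactOn (fun x y => c x y - ∑ i, k i * wind (fibForm (a i) (b i)) x y) (fibTube a b t δ))
    (h' : ExactOn (fun x y => c x y - ∑ i, k' i * wind (fibForm (a i) (b i)) x y)
      (fibTube a b t δ)) : k = k' := by
  classical
  funext i
  set p : ℂ × ℂ := (a i * t + b i, t) with hp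
  have hO : IsOpen (Prod.snd ⁻¹' Metric.ball t δ ∩
      {x | ∀ j, j ≠ i → fibForm (a j) (b j) x ≠ 0}) := by
    refine (Metric.isOpen_ball.preimage continuous_snd).inter ?_
    have : {x | ∀ j, j ≠ i → fibForm (a j) (b j) x ≠ 0} =
      ⋂ j, ⋂ _ : j ≠ i, {x | fibForm (a j) (b j) x ≠ 0} := by ext; simp
    rw [this]
    exact isOpen_iInter_of_finite fun j => isOpen_iInter_of_finite fun _ =>
      isOpen_ne_fun (continuous_fibForm _ _) continuous_const
  have hpO : p ∈ Prod.snd ⁻¹' Metric.ball t δ ∩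
      {x | ∀ j, j ≠ i → fibForm (a j) (b j) x ≠ 0} := by
    refine ⟨Metric.mem_ball_self hδ, fun j hj h0 => hj (ht ?_)⟩
    rw [fibForm_apply, sub_eq_zero] at h0
    exact h0.symm
  obtain ⟨r, hr, hball⟩ := Metric.isOpen_iff.1 hO p hpO
  have hsub : Metric.ball p r ∩ {x | fibForm (a i) (b i) x ≠ 0} ⊆ fibTube a b t δ :=
    fun x hx => ⟨(hball hx.1).1, fun j => by
      by_cases hj : j = i
      · exact hj ▸ hx.2
      · exact (hball hx.1).2 j hj⟩
  have hw : ∀ j ∈ Finset.univ.erase i, ExactOn (wind (fibForm (a j) (b j)))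
      (Metric.ball p r ∩ {x | fibForm (a i) (b i) x ≠ 0}) := fun j hj =>
    ((isSegCocycle_wind (continuous_fibForm _ _)).exact_of_convex (convex_ball p r)
      (fun x hx => (hball hx).2 j (Finset.ne_of_mem_erase hj)) Metric.isOpen_ball).mono
      Set.inter_subset_left
  have := (((h'.mono hsub).comb (h.mono hsub) 1).sub_sum (Finset.univ.erase i) (k - k') hw).congr
    (c' := fun x y => (k i - k' i) * wind (fibForm (a i) (b i)) x y) (fun x y => by
      have e : ∀ f : ι → ℂ, ∑ j, f j = f i + ∑ j ∈ Finset.univ.erase i, f j := fun f =>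
        (Finset.add_sum_erase _ f (Finset.mem_univ i)).symm
      rw [e, e]
      simp only [Pi.sub_apply, sub_mul, Finset.sum_sub_distrib]
      ring)
  refine sub_eq_zero.1 (eq_zero_of_exactOn_mul_wind (convex_ball p r) (continuous_fibForm _ _) this
    (t := r / 4) (by positivity) fun s hs => ⟨(p.1 + s, p.2), ?_, ?_⟩)
  · rw [Metric.mem_ball, Prod.dist_eq]
    simp only [dist_self_add_left, dist_self]
    exact max_lt (by linarith) hr
  · rw [fibForm_apply]; simp [hp]

end FiberedLines

theorem IsPrim.comp {E E' : Type*} [NormedAddCommGroup E] [NormedAddCommGroup E']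
    {c : E → E → ℂ} {U : Set E} {F : E → ℂ} (h : IsPrim c U F) {g : E' → E} (hg : Continuous g) :
    IsPrim (fun x y => c (g x) (g y)) (g ⁻¹' U) (F ∘ g) := fun _ hx =>
  hg.continuousAt.eventually (h _ hx)

theorem isPreconnected_inter_ne_zero {E : Type*} [NormedAddCommGroup E] [NormedSpace ℝ E]
    {C : Set E} {ℓ : E →ᵃ[ℝ] ℂ} (hC : Convex ℝ C) {t : ℝ} (ht : 0 < t)
    (hs : ∀ s : ℂ, ‖s‖ ≤ 2 * t → ∃ x ∈ C, ℓ x = s) : IsPreconnected (C ∩ {x | ℓ x ≠ 0}) := by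
  have cv : ∀ ω, IsPreconnected (halfSet C ℓ ω) := fun ω => (convex_halfSet hC ω).isPreconnected
  have pt : ∀ a b : ℝ, |a| = t → |b| = t → ∃ x ∈ C, (ℓ x).re = a ∧ (ℓ x).im = b := by
    intro a b ha hb
    obtain ⟨x, hx, he⟩ := hs ⟨a, b⟩ (by
      refine (Complex.norm_le_abs_re_add_abs_im _).trans ?_
      simp only [ha, hb]; linarith)
    exact ⟨x, hx, by rw [he], by rw [he]⟩
  have at' : |t| = t := abs_of_pos ht
  have ant : |-t| = t := by rw [abs_neg, at']
  have p3 : IsPreconnected (halfSet C ℓ 1 ∪ halfSet C ℓ (-Complex.I) ∪ halfSet C ℓ (-1) ∪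
      halfSet C ℓ Complex.I) := by
    obtain ⟨x, hx, h1, h2⟩ := pt t t at' at'
    obtain ⟨y, hy, h1', h2'⟩ := pt (-t) t ant at'
    obtain ⟨z, hz, h1'', h2''⟩ := pt t (-t) at' ant
    have p1 : IsPreconnected (halfSet C ℓ 1 ∪ halfSet C ℓ (-Complex.I)) :=
      IsPreconnected.union x ⟨hx, by simpa [h1]⟩ ⟨hx, by simpa [h2]⟩ (cv _) (cv _)
    have p2 : IsPreconnected (halfSet C ℓ 1 ∪ halfSet C ℓ (-Complex.I) ∪ halfSet C ℓ (-1)) :=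
      IsPreconnected.union y (Or.inr ⟨hy, by simpa [h2']⟩) ⟨hy, by simpa [h1']⟩ p1 (cv _)
    exact IsPreconnected.union z (Or.inl (Or.inl ⟨hz, by simpa [h1'']⟩)) ⟨hz, by simpa [h2'']⟩
      p2 (cv _)
  convert p3 using 1
  refine Set.Subset.antisymm ?_ (Set.union_subset (Set.union_subset (Set.union_subset
    (halfSet_subset _) (halfSet_subset _)) (halfSet_subset _)) (halfSet_subset _))
  rintro x ⟨hx, hx0⟩
  by_contra hn
  simp only [halfSet, Set.mem_union, Set.mem_inter_iff, hx, true_and, Set.mem_ofPred_eq] at hn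
  simp at hn
  exact hx0 (Complex.ext (by simp; linarith) (by simp; linarith))

/-- A primitive defined off a finite set of vertical lines extends across them. -/
theorem IsSegCocycle.exactOn_of_finite {c : ℂ × ℂ → ℂ × ℂ → ℂ} {X : Set (ℂ × ℂ)} (hX : IsOpen X)
    (hc : IsSegCocycle c X) {B : Set ℂ} (hB : B.Finite) {F : ℂ × ℂ → ℂ}
    (hF : IsPrim c (X ∩ {x | x.2 ∉ B}) F) : ExactOn c X := by
  have key : ∀ x ∈ X, ∃ r > 0, Metric.ball x r ⊆ X ∧ ∃ K, ∀ y ∈ Metric.ball x r, y.2 ≠ x.2 →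
      F y = c x y + K := by
    intro x hx
    obtain ⟨r, hr, hrX⟩ := Metric.isOpen_iff.1 hX x hx
    obtain ⟨s, hs, hsB⟩ := Metric.isOpen_iff.1
      (hB.subset (Set.sdiff_subset (t := {x.2}))).isClosed.isOpen_compl
      x.2 (by simp)
    have hsub : Metric.ball x (min r s) ⊆ X := (Metric.ball_subset_ball (min_le_left _ _)).trans hrX
    refine ⟨min r s, lt_min hr hs, hsub, ?_⟩
    have hm : 0 < min r s := lt_min hr hs
    have hp := isPreconnected_inter_ne_zero (C := Metric.ball x (min r s))
      (ℓ := (LinearMap.snd ℝ ℂ ℂ).toAffineMap - AffineMap.const ℝ (ℂ × ℂ) x.2) (convex_ball _ _)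
      (t := min r s / 4) (by positivity) (fun z hz => ⟨(x.1, x.2 + z), by
        rw [Metric.mem_ball, Prod.dist_eq]
        simp only [dist_self_add_left, dist_self]
        exact max_lt hm (by linarith), by simp⟩)
    have hcx : IsPrim c (Metric.ball x (min r s)) (c x) := fun y hy => by
      filter_upwards [Metric.isOpen_ball.mem_nhds hy] with z hz
      rw [← hc.add_of_convex (convex_ball _ _) hsub (Metric.mem_ball_self hm) hy hz]
      ring
    obtain ⟨K, hK⟩ := (hF.mono (fun y hy => ⟨hsub hy.1, fun hyB => by
      have h1 : y.2 ∈ Metric.ball x.2 s := lt_of_le_of_lt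
        ((le_max_right _ _).trans_eq (Prod.dist_eq).symm) (hy.1.trans_le (min_le_right _ _))
      have h2 : y.2 ≠ x.2 := fun e => hy.2 (by simp [e])
      exact hsB h1 ⟨hyB, h2⟩⟩)).eq_add_const (hcx.mono Set.inter_subset_left) hp
    refine ⟨K, fun y hy hyx => hK y ⟨hy, ?_⟩⟩
    simpa [sub_eq_zero] using hyx
  choose! r hr hrX K hK using key
  refine ⟨K, fun x hx => ?_⟩
  filter_upwards [Metric.ball_mem_nhds x (hr x hx)] with y hy
  have hyX := hrX x hx hy
  have hcont : Filter.Tendsto (fun s : ℂ => ((y.1, s) : ℂ × ℂ)) (𝓝[≠] y.2) (𝓝 y) := by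
    have : Continuous fun s : ℂ => ((y.1, s) : ℂ × ℂ) := by fun_prop
    exact this.continuousAt.tendsto.mono_left nhdsWithin_le_nhds
  have h1 := hcont.eventually (Metric.isOpen_ball.mem_nhds hy)
  have h2 := hcont.eventually (Metric.ball_mem_nhds y (hr y hyX))
  have h3 : ∀ᶠ s in 𝓝[≠] y.2, s ≠ y.2 := self_mem_nhdsWithin
  have h4 : ∀ᶠ s in 𝓝[≠] y.2, s ≠ x.2 := by
    by_cases h : y.2 = x.2
    · exact h ▸ h3
    · exact nhdsWithin_le_nhds (isOpen_ne.mem_nhds h)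
  obtain ⟨s, h1, h2, h3, h4⟩ := (h1.and (h2.and (h3.and h4))).exists
  have e1 := hK x hx _ h1 h4
  have e2 := hK y hyX _ h2 h3
  have e3 := hc.add_of_convex (convex_ball _ _) (hrX x hx) (Metric.mem_ball_self (hr x hx)) hy h1
  linear_combination e2 - e1 + e3

section FiberedLines

variable {ι : Type*} [Fintype ι] {a b : ι → ℂ} {c : ℂ × ℂ → ℂ × ℂ → ℂ}

theorem finite_not_injective (hab : ∀ i j, i ≠ j → a i = a j → b i ≠ b j) :
    {t : ℂ | ¬ Function.Injective fun i => a i * t + b i}.Finite := by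
  have : {t : ℂ | ¬ Function.Injective fun i => a i * t + b i} ⊆
      ⋃ i, ⋃ j, {t : ℂ | i ≠ j ∧ a i * t + b i = a j * t + b j} := by
    intro t ht
    simp only [Set.mem_ofPred_eq, Function.Injective, not_forall] at ht
    obtain ⟨i, j, h, hij⟩ := ht
    exact Set.mem_iUnion.2 ⟨i, Set.mem_iUnion.2 ⟨j, hij, h⟩⟩
  refine (Set.finite_iUnion fun i => Set.finite_iUnion fun j => ?_).subset this
  refine Set.Subsingleton.finite ?_
  rintro s ⟨hij, hs⟩ t ⟨-, ht⟩
  by_cases h : a i = a j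
  · rw [h] at hs
    exact absurd (add_left_cancel hs) (hab i j hij h)
  · have : (a i - a j) * (s - t) = 0 := by linear_combination hs - ht
    exact sub_eq_zero.1 ((mul_eq_zero.1 this).resolve_left (sub_ne_zero.2 h))

theorem IsSegCocycle.exists_exactOn_fibCompl (hc : IsSegCocycle c (fibCompl a b))
    (hab : ∀ i j, i ≠ j → a i = a j → b i ≠ b j) : ∃ k : ι → ℂ,
    ExactOn (fun x y => c x y - ∑ i, k i * wind (fibForm (a i) (b i)) x y) (fibCompl a b) := by
  classical
  set B := {t : ℂ | ¬ Function.Injective fun i => a i * t + b i} with hB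
  have hBf : B.Finite := finite_not_injective hab
  have hgen : ∀ {t}, t ∈ Bᶜ → Function.Injective fun i => a i * t + b i :=
    fun {t} ht => not_not.1 ht
  have hconn : IsConnected Bᶜ := hBf.countable.isConnected_compl_of_one_lt_rank (by simp)
  have h1 : ∀ t : ℂ, t ∈ Bᶜ → ∃ δ > 0, ∃ k : ι → ℂ,
      ExactOn (fun x y => c x y - ∑ i, k i * wind (fibForm (a i) (b i)) x y)
      (fibTube a b t δ) := fun t ht => exists_exactOn_fibTube hc (hgen ht)
  choose! δ hδ K hK using h1
  obtain ⟨k, hk⟩ : ∃ k, ∀ t ∈ Bᶜ, K t = k := by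
    have := isPreconnected_iff_preconnectedSpace.1 hconn.isPreconnected
    have hl : IsLocallyConstant fun t : (Bᶜ : Set ℂ) => K t := by
      refine (IsLocallyConstant.iff_eventually_eq _).2 fun t => ?_
      have : Filter.Tendsto (Subtype.val : (Bᶜ : Set ℂ) → ℂ) (𝓝 t) (𝓝 t) :=
        continuous_subtype_val.continuousAt
      filter_upwards [this.eventually (Metric.ball_mem_nhds _ (hδ t t.2))] with s hs
      have hs : dist (s : ℂ) t < δ t := hs
      have hpos : 0 < min (δ s) (δ t - dist (s : ℂ) t) := lt_min (hδ s s.2) (by linarith)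
      refine eq_of_exactOn_fibTube hpos (hgen s.2) ((hK s s.2).mono ?_) ((hK t t.2).mono ?_)
      · exact Set.inter_subset_inter_left _ (Set.preimage_mono
          (Metric.ball_subset_ball (min_le_left _ _)))
      · refine Set.inter_subset_inter_left _ (Set.preimage_mono (Metric.ball_subset_ball' ?_))
        linarith [min_le_right (δ s) (δ t - dist (s : ℂ) t)]
    obtain ⟨t₀, h₀⟩ := hconn.nonempty
    exact ⟨K t₀, fun t ht => hl.apply_eq_of_preconnectedSpace ⟨t, ht⟩ ⟨t₀, h₀⟩⟩
  refine ⟨k, ?_⟩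
  set d : ℂ × ℂ → ℂ × ℂ → ℂ := fun x y => c x y - ∑ i, k i * wind (fibForm (a i) (b i)) x y with hd
  have hdc : IsSegCocycle d (fibCompl a b) := hc.sub_sum _ k fun i _ =>
    (isSegCocycle_wind (continuous_fibForm _ _)).mono fun x hx => hx i
  have hdt : ∀ t ∈ Bᶜ, ExactOn d (fibTube a b t (δ t)) := fun t ht => by
    have := hK t ht
    rwa [hk t ht] at this
  set P : Set (ℂ × ℂ) := ⋂ i, halfSet Set.univ (fibForm (a i) (b i)) 1 with hP
  have hPc : Convex ℝ P := convex_iInter fun i => convex_halfSet convex_univ _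
  have hPo : IsOpen P := isOpen_iInter_of_finite fun i =>
    isOpen_halfSet isOpen_univ (continuous_fibForm _ _) _
  have hPX : P ⊆ fibCompl a b := fun x hx i => (halfSet_subset _ (Set.mem_iInter.1 hx i)).2
  obtain ⟨G, hG⟩ := hdc.exact_of_convex hPc hPX hPo
  have h2 : ∀ t ∈ Bᶜ, ∃ F, IsPrim d (fibTube a b t (δ t)) F ∧
      ∀ x ∈ fibTube a b t (δ t) ∩ P, F x = G x := by
    intro t ht
    obtain ⟨F, hF⟩ := hdt t ht
    have hi : fibTube a b t (δ t) ∩ P = Prod.snd ⁻¹' Metric.ball t (δ t) ∩ P := by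
      ext x; exact ⟨fun h => ⟨h.1.1, h.2⟩, fun h => ⟨⟨h.1, hPX h.2⟩, h.2⟩⟩
    have hcv : IsPreconnected (fibTube a b t (δ t) ∩ P) := by
      rw [hi]
      exact (((convex_ball t (δ t)).linear_preimage (LinearMap.snd ℝ ℂ ℂ)).inter hPc).isPreconnected
    obtain ⟨m, hm⟩ := (hF.mono Set.inter_subset_left).eq_add_const (hG.mono Set.inter_subset_right)
      hcv
    exact ⟨_, hF.add_const (-m), fun x hx => by rw [hm x hx]; ring⟩
  choose! F hF hFG using h2
  have hsame : ∀ s ∈ Bᶜ, ∀ t ∈ Bᶜ, s ∈ Metric.ball t (δ t) → ∀ z, (z, s) ∈ fibCompl a b →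
      F s (z, s) = F t (z, s) := by
    intro s hs t ht hst z hz
    set g : ℂ → ℂ × ℂ := fun z => (z, s) with hg
    have hgc : Continuous g := by fun_prop
    have hfin : (g ⁻¹' fibCompl a b) = (Set.range fun i => a i * s + b i)ᶜ := by
      ext w
      simp [g, fibCompl, fibForm_apply, sub_eq_zero, eq_comm]
    have hcon : IsPreconnected (g ⁻¹' fibCompl a b) := by
      rw [hfin]
      exact ((Set.finite_range _).countable.isConnected_compl_of_one_lt_rank
        (by simp)).isPreconnected
    have ms : ∀ w ∈ g ⁻¹' fibCompl a b, g w ∈ fibTube a b s (δ s) := fun w hw =>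
      ⟨Metric.mem_ball_self (hδ s hs), hw⟩
    have mt : ∀ w ∈ g ⁻¹' fibCompl a b, g w ∈ fibTube a b t (δ t) := fun w hw => ⟨hst, hw⟩
    obtain ⟨m, hm⟩ := (((hF s hs).comp hgc).mono ms).eq_add_const (((hF t ht).comp hgc).mono mt)
      hcon
    set R : ℂ := ((1 + ∑ i, ‖a i * s + b i‖ : ℝ) : ℂ) with hR
    have hRP : g R ∈ P := by
      refine Set.mem_iInter.2 fun i => ⟨trivial, ?_⟩
      show 0 < (1 * fibForm (a i) (b i) (g R)).re
      rw [one_mul, fibForm_apply, Complex.sub_re, Complex.ofReal_re]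
      have h1 := Complex.re_le_norm (a i * s + b i)
      have h2 := Finset.single_le_sum (f := fun i => ‖a i * s + b i‖)
        (fun i _ => norm_nonneg _) (Finset.mem_univ i)
      have h3 : (a i * (g R).2 + b i) = a i * s + b i := rfl
      rw [h3]
      linarith
    have hRX := hPX hRP
    have e1 := hm R hRX
    simp only [Function.comp, hFG s hs _ ⟨ms R hRX, hRP⟩, hFG t ht _ ⟨mt R hRX, hRP⟩] at e1
    have e2 := hm z hz
    simp only [Function.comp] at e2
    linear_combination e2 - e1
  refine hdc.exactOn_of_finite isOpen_fibCompl hBf (F := fun x => F x.2 x) ?_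
  rintro x ⟨hx, hxB⟩
  have hmem : x ∈ fibTube a b x.2 (δ x.2) := ⟨Metric.mem_ball_self (hδ _ hxB), hx⟩
  have ho : IsOpen (fibTube a b x.2 (δ x.2)) :=
    (Metric.isOpen_ball.preimage continuous_snd).inter isOpen_fibCompl
  filter_upwards [hF x.2 hxB x hmem, ho.mem_nhds hmem,
    (hBf.isClosed.isOpen_compl.preimage continuous_snd).mem_nhds hxB] with y hy hyt hyB
  rw [hy, hsame y.2 hyB x.2 hxB hyt.1 y.1 hyt.2]

end FiberedLines

section PathCocycle

variable {E : Type*} [NormedAddCommGroup E] [NormedSpace ℝ E] {X : Set E}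

theorem Path.homotopic_of_convex {C : Set E} (hC : Convex ℝ C) (hCX : C ⊆ X) {x y : X}
    {p q : Path x y} (hp : ∀ t, (p t : E) ∈ C) (hq : ∀ t, (q t : E) ∈ C) : p.Homotopic q := by
  refine ⟨{ toFun := fun s => ⟨AffineMap.lineMap (p s.2 : E) (q s.2 : E) (s.1 : ℝ),
              hCX (hC.lineMap_mem (hp _) (hq _) s.1.2)⟩,
            continuous_toFun := ?_, map_zero_left := ?_, map_one_left := ?_, prop' := ?_ }⟩
  · refine Continuous.subtype_mk ?_ _
    simp only [AffineMap.lineMap_apply_module]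
    fun_prop
  · intro t; ext; simp
  · intro t; ext; simp
  · rintro s t (rfl | rfl) <;> (ext; simp)

/-- The straight path between two points of `X`. -/
noncomputable def segPath {y z : X} (h : segment ℝ (y : E) z ⊆ X) : Path y z where
  toFun t := ⟨AffineMap.lineMap (y : E) z (t : ℝ), h (by
    rw [segment_eq_image_lineMap]; exact ⟨t, t.2, rfl⟩)⟩
  continuous_toFun := by
    refine Continuous.subtype_mk ?_ _
    simp only [AffineMap.lineMap_apply_module]
    fun_prop
  source' := by ext; simp
  target' := by ext; simp

theorem segPath_mem {y z : X} (h : segment ℝ (y : E) z ⊆ X) {C : Set E} (hC : Convex ℝ C)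
    (hy : (y : E) ∈ C) (hz : (z : E) ∈ C) (t : I) : (segPath h t : E) ∈ C :=
  hC.lineMap_mem hy hz t.2

/-- Additive functions on homotopy classes of paths. -/
def IsPathAdditive (v : ∀ y z : X, Path.Homotopic.Quotient y z → ℂ) : Prop :=
  ∀ y z w (p : Path.Homotopic.Quotient y z) (q : Path.Homotopic.Quotient z w),
    v y w (p.trans q) = v y z p + v z w q

open Classical in
/-- The cocycle of the values of a function on straight paths. -/
noncomputable def segCocycle (v : ∀ y z : X, Path.Homotopic.Quotient y z → ℂ) (y z : E) : ℂ :=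
  if h : segment ℝ y z ⊆ X then
    v ⟨y, h (left_mem_segment ℝ y z)⟩ ⟨z, h (right_mem_segment ℝ y z)⟩
      (Path.Homotopic.Quotient.mk (segPath h))
  else 0

variable {v : ∀ y z : X, Path.Homotopic.Quotient y z → ℂ}

theorem segCocycle_eq {C : Set E} (hC : Convex ℝ C) (hCX : C ⊆ X) {y z : X} (p : Path y z)
    (hp : ∀ t, (p t : E) ∈ C) : segCocycle v y z = v y z (Path.Homotopic.Quotient.mk p) := by
  have hy : (y : E) ∈ C := by simpa using hp 0
  have hz : (z : E) ∈ C := by simpa using hp 1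
  have h : segment ℝ (y : E) z ⊆ X := (hC.segment_subset hy hz).trans hCX
  rw [segCocycle, dif_pos h]
  congr 1
  exact Path.Homotopic.Quotient.eq.2
    (Path.homotopic_of_convex hC hCX (fun t => segPath_mem h hC hy hz t) hp)

theorem IsPathAdditive.add_of_convex (hv : IsPathAdditive v) {C : Set E} (hC : Convex ℝ C)
    (hCX : C ⊆ X) {x y z : E} (hx : x ∈ C) (hy : y ∈ C) (hz : z ∈ C) :
    segCocycle v x y + segCocycle v y z = segCocycle v x z := by
  have h1 : segment ℝ x y ⊆ X := (hC.segment_subset hx hy).trans hCX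
  have h2 : segment ℝ y z ⊆ X := (hC.segment_subset hy hz).trans hCX
  let x' : X := ⟨x, hCX hx⟩
  let y' : X := ⟨y, hCX hy⟩
  let z' : X := ⟨z, hCX hz⟩
  let p : Path x' y' := segPath h1
  let q : Path y' z' := segPath h2
  have hp : ∀ t, (p t : E) ∈ C := fun t => segPath_mem (y := x') h1 hC hx hy t
  have hq : ∀ t, (q t : E) ∈ C := fun t => segPath_mem (y := y') h2 hC hy hz t
  have e1 := segCocycle_eq (v := v) hC hCX p hp
  have e2 := segCocycle_eq (v := v) hC hCX q hq
  have e3 := segCocycle_eq (v := v) hC hCX (p.trans q) (fun t => by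
    rw [Path.trans_apply]; split_ifs <;> [apply hp; apply hq])
  rw [show segCocycle v x y = _ from e1, show segCocycle v y z = _ from e2,
    show segCocycle v x z = _ from e3, Path.Homotopic.Quotient.mk_trans, hv]

theorem IsPathAdditive.isSegCocycle (hv : IsPathAdditive v) : IsSegCocycle (segCocycle v) X := by
  intro x y z h
  have hs := subset_convexHull ℝ {x, y, z}
  exact hv.add_of_convex (convex_convexHull ℝ _) h (hs (by simp)) (hs (by simp)) (hs (by simp))

theorem IsSegCocycle.isLocalCocycle (hX : IsOpen X) {c : E → E → ℂ} (hc : IsSegCocycle c X) :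
    IsLocalCocycle fun y z : X => Multiplicative.ofAdd (c y z) := by
  intro x
  obtain ⟨r, hr, hsub⟩ := Metric.isOpen_iff.1 hX x x.2
  refine ⟨Subtype.val ⁻¹' Metric.ball (x : E) r,
    continuous_subtype_val.continuousAt (Metric.ball_mem_nhds _ hr), fun y hy z hz w hw => ?_⟩
  rw [← ofAdd_add, hc.add_of_convex (convex_ball _ _) hsub hy hz hw]

theorem IsPathAdditive.hol_eq (hX : IsOpen X) (hv : IsPathAdditive v) {x y : X} (γ : Path x y) :
    hol (fun y z : X => Multiplicative.ofAdd (segCocycle v y z)) γ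
      = Multiplicative.ofAdd (v x y (Path.Homotopic.Quotient.mk γ)) := by
  have hl : IsLift (fun y z : X => Multiplicative.ofAdd (segCocycle v y z)) γ
      fun t => Multiplicative.ofAdd (v _ _ (Path.Homotopic.Quotient.mk (γ.subpath 0 t))) := by
    intro t
    obtain ⟨r, hr, hsub⟩ := Metric.isOpen_iff.1 hX (γ t) (γ t).2
    have hn : (fun s => (γ s : E)) ⁻¹' Metric.ball (γ t : E) r ∈ 𝓝 t :=
      (continuous_subtype_val.comp γ.continuous).continuousAt (Metric.ball_mem_nhds _ hr)
    obtain ⟨ε, hε, huV⟩ := Metric.mem_nhds_iff.1 hn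
    have hu' : (Metric.ball t ε).OrdConnected :=
      (convex_ball (t : ℝ) ε).ordConnected.preimage_mono (Subtype.mono_coe _)
    refine ⟨_, Metric.ball_mem_nhds t hε, fun s hs s' hs' => ?_⟩
    rw [← ofAdd_add, segCocycle_eq (convex_ball _ _) hsub (γ.subpath s s'), ← hv,
      ← Path.Homotopic.Quotient.mk_trans]
    · exact congrArg (fun p => Multiplicative.ofAdd (v _ _ p))
        (Path.Homotopic.Quotient.eq.2 ⟨Path.Homotopy.subpathTransSubpath γ 0 s s'⟩).symm
    · intro w
      have : γ.subpath s s' w ∈ Set.range (γ.subpath s s') := ⟨w, rfl⟩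
      rw [Path.range_subpath] at this
      obtain ⟨w', hw', e⟩ := this
      rw [← e]
      exact huV (hu'.uIcc_subset hs hs' hw')
  rw [hl.hol_eq, ← ofAdd_neg, ← ofAdd_add]
  congr 1
  have h0 : v _ _ (Path.Homotopic.Quotient.mk (γ.subpath 0 0)) = 0 := by
    have := hv _ _ _ (Path.Homotopic.Quotient.refl (γ 0)) (Path.Homotopic.Quotient.refl (γ 0))
    rw [Path.Homotopic.Quotient.refl_trans, left_eq_add] at this
    rwa [Path.subpath_self]
  rw [h0, neg_zero, zero_add, Path.subpath_zero_one]
  have : ∀ (a b : X) (ha : a = x) (hb : b = y),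
      v a b (Path.Homotopic.Quotient.mk (γ.cast ha hb)) = v x y (.mk γ) := by
    rintro _ _ rfl rfl; rfl
  exact this _ _ _ _

end PathCocycle

section Generation

theorem exists_isPathAdditive {E : Type*} [NormedAddCommGroup E] {X : Set E}
    [PathConnectedSpace X] {x : X} (h : FundamentalGroup X x →* Multiplicative ℂ) :
    ∃ v : ∀ y z : X, Path.Homotopic.Quotient y z → ℂ, IsPathAdditive v ∧
      ∀ p : Path.Homotopic.Quotient x x, v x x p = (h (FundamentalGroup.fromPath p)).toAdd := by
  let π (y : X) : Path.Homotopic.Quotient x y := .mk (PathConnectedSpace.somePath x y)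
  refine ⟨fun y z p =>
    (h (FundamentalGroup.fromPath (((π y).trans p).trans (π z).symm))).toAdd, ?_, ?_⟩
  · intro y z w p q
    dsimp only
    rw [← toAdd_mul, mul_comm, ← map_mul h]
    change _ = (h (FundamentalGroup.fromPath
      ((((π y).trans p).trans (π z).symm).trans (((π z).trans q).trans (π w).symm)))).toAdd
    congr 3
    simp only [Path.Homotopic.Quotient.trans_assoc]
    rw [← Path.Homotopic.Quotient.trans_assoc (π z).symm (π z),
      Path.Homotopic.Quotient.symm_trans, Path.Homotopic.Quotient.refl_trans]
  · intro p
    have : FundamentalGroup.fromPath (((π x).trans p).trans (π x).symm)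
        = (FundamentalGroup.fromPath (π x))⁻¹ *
          (FundamentalGroup.fromPath p * FundamentalGroup.fromPath (π x)) := rfl
    dsimp only
    rw [this, map_mul h, map_mul h, map_inv h,
      mul_comm (h (FundamentalGroup.fromPath p)), inv_mul_cancel_left]

variable {ι : Type*} [Fintype ι] {a b : ι → ℂ}

/-- The cocycle measuring the winding around one of the lines. -/
noncomputable def fibWind (a b : ι → ℂ) (i : ι) (y z : fibCompl a b) : Multiplicative ℂ :=
  Multiplicative.ofAdd (wind (fibForm (a i) (b i)) y z)

theorem isLocalCocycle_fibWind (i : ι) : IsLocalCocycle (fibWind a b i) :=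
  ((isSegCocycle_wind (continuous_fibForm (a i) (b i))).mono
    (fun _ (hx : _ ∈ fibCompl a b) => hx i)).isLocalCocycle isOpen_fibCompl

theorem isPathConnected_fibCompl : IsPathConnected (fibCompl a b) := by
  have hne : ∀ t : ℂ, ∃ z, (z, t) ∈ fibCompl a b := by
    intro t
    obtain ⟨z, hz⟩ := Infinite.exists_notMem_finset
      (Finset.univ.image fun i => a i * t + b i)
    refine ⟨z, fun i h => hz (Finset.mem_image.2 ⟨i, Finset.mem_univ _, ?_⟩)⟩
    rw [fibForm_apply, sub_eq_zero] at h
    exact h.symm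
  obtain ⟨z₀, hz₀⟩ := hne 0
  refine ⟨(z₀, 0), hz₀, fun {y} hy => ?_⟩
  let L : ℂ → ℂ × ℂ := fun s => (z₀ + s * (y.1 - z₀), s * y.2)
  have hL : Continuous L := by fun_prop
  have hfin : {s : ℂ | L s ∉ fibCompl a b}.Countable := by
    have : {s : ℂ | L s ∉ fibCompl a b} ⊆ ⋃ i, {s | fibForm (a i) (b i) (L s) = 0} := by
      intro s hs
      simpa [fibCompl] using hs
    refine (Set.countable_iUnion fun i => Set.Finite.countable ?_).mono this
    refine Set.Subsingleton.finite fun s hs s' hs' => ?_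
    have h0 := hz₀ i
    have hs : fibForm (a i) (b i) (L s) = 0 := hs
    have hs' : fibForm (a i) (b i) (L s') = 0 := hs'
    rw [fibForm_apply] at hs hs' h0
    simp only [L] at hs hs'
    have h1 : (y.1 - z₀ - a i * y.2) ≠ 0 := fun h => h0 (by linear_combination hs - s * h)
    have : (s - s') * (y.1 - z₀ - a i * y.2) = 0 := by linear_combination hs - hs'
    exact sub_eq_zero.1 ((mul_eq_zero.1 this).resolve_right h1)
  have hpc := hfin.isPathConnected_compl_of_one_lt_rank
    (by rw [Complex.rank_real_complex]; norm_num)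
  have hj := hpc.joinedIn 0 (by simpa [L] using hz₀) 1 (by simpa [L] using hy)
  obtain ⟨γ, hγ⟩ := hj
  refine ⟨(γ.map hL).cast (by simp [L]) (by simp [L]), fun t => ?_⟩
  simpa using hγ t

/-- Every homomorphism to `ℂ` is a linear combination of winding numbers. -/
theorem exists_eq_sum_fibWind (hab : ∀ i j, i ≠ j → a i = a j → b i ≠ b j) {x : fibCompl a b}
    (h : FundamentalGroup (fibCompl a b) x →* Multiplicative ℂ) :
    ∃ k : ι → ℂ, ∀ p : Path.Homotopic.Quotient x x, (h (FundamentalGroup.fromPath p)).toAdd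
      = ∑ i, k i * (holQ (isLocalCocycle_fibWind i) p).toAdd := by
  have : PathConnectedSpace (fibCompl a b) :=
    isPathConnected_iff_pathConnectedSpace.1 isPathConnected_fibCompl
  obtain ⟨v, hv, hvh⟩ := exists_isPathAdditive h
  obtain ⟨k, F, hF⟩ := hv.isSegCocycle.exists_exactOn_fibCompl hab
  refine ⟨k, fun p => ?_⟩
  induction p using Quotient.ind with | _ γ
  change (h (FundamentalGroup.fromPath (.mk γ))).toAdd = ∑ i, k i * (hol (fibWind a b i) γ).toAdd
  have hc := hv.isSegCocycle.isLocalCocycle isOpen_fibCompl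
  choose G hG0 hG using fun i => (isLocalCocycle_fibWind (a := a) (b := b) i).exists_isLift
    γ.continuous
  have hl : IsLift (fun y z : fibCompl a b => Multiplicative.ofAdd (segCocycle v y z)) γ
      fun t => Multiplicative.ofAdd (∑ i, k i * (G i t).toAdd + F (γ t)) := by
    intro t
    choose V hV hVG using fun i => hG i t
    obtain ⟨U, hU, hUc⟩ := hc (γ t)
    choose U' hU' hUc' using fun i => isLocalCocycle_fibWind (a := a) (b := b) i (γ t)
    have hF' : ∀ᶠ s in 𝓝 t, segCocycle v (γ t) (γ s) - ∑ i, k i * wind (fibForm (a i) (b i))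
        (γ t) (γ s) = F (γ s) - F (γ t) :=
      (continuous_subtype_val.comp γ.continuous).continuousAt.eventually (hF _ (γ t).2)
    have e1 : ∀ᶠ s in 𝓝 t, ∀ i, s ∈ V i := Filter.eventually_all.2 hV
    have e2 : ∀ᶠ s in 𝓝 t, ∀ i, γ s ∈ U' i := Filter.eventually_all.2 fun i =>
      γ.continuous.continuousAt.eventually (hU' i)
    refine ⟨_, hF'.and (e1.and (e2.and (γ.continuous.continuousAt hU))), ?_⟩
    rintro s ⟨s1, s2, s3, s4⟩ s' ⟨s1', s2', s3', s4'⟩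
    have q1 := congrArg Multiplicative.toAdd (hUc _ (mem_of_mem_nhds hU) _ s4 _ s4')
    have q2 := fun i => congrArg Multiplicative.toAdd
      (hUc' i _ (mem_of_mem_nhds (hU' i)) _ (s3 i) _ (s3' i))
    simp only [fibWind, toAdd_mul, toAdd_ofAdd] at q1 q2
    have q3 : ∀ i, (G i s').toAdd = (G i s).toAdd + wind (fibForm (a i) (b i)) (γ s) (γ s') :=
      fun i => congrArg Multiplicative.toAdd (hVG i s (s2 i) s' (s2' i))
    rw [← ofAdd_add]
    refine congrArg Multiplicative.ofAdd ?_
    have q4 : ∑ i, k i * wind (fibForm (a i) (b i)) (γ t) (γ s')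
      = ∑ i, k i * wind (fibForm (a i) (b i)) (γ t) (γ s)
        + ∑ i, k i * wind (fibForm (a i) (b i)) (γ s) (γ s') := by
      rw [← Finset.sum_add_distrib]
      exact Finset.sum_congr rfl fun i _ => by rw [← q2 i]; ring
    simp only [q3, mul_add, Finset.sum_add_distrib]
    linear_combination s1 - s1' - q1 - q4
  have e := hv.hol_eq isOpen_fibCompl γ
  rw [hl.hol_eq] at e
  have e := congrArg Multiplicative.toAdd e
  simp only [toAdd_mul, toAdd_inv, toAdd_ofAdd, γ.source, γ.target] at e
  rw [← hvh]
  change v x x (.mk γ) = _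
  rw [← e]
  have : ∀ i, (hol (fibWind a b i) γ).toAdd = (G i 1).toAdd := fun i => by
    rw [(hG i).hol_eq, hG0, inv_one, one_mul]
  simp only [this, hG0, toAdd_one, mul_zero, Finset.sum_const_zero]
  ring

end Generation

section Winding

/-- `g` is a nonvanishing function on the interval whose logarithm increases by `2 π i n`. -/
def WindsBy (g : I → ℂ) (n : ℤ) : Prop :=
  ∃ f : I → ℂ, Continuous f ∧ f 1 = f 0 + n ∧
    ∃ K ≠ 0, ∀ t, g t = K * Complex.exp (2 * Real.pi * Complex.I * f t)

theorem WindsBy.mul {g g' : I → ℂ} {n n' : ℤ} (h : WindsBy g n) (h' : WindsBy g' n') :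
    WindsBy (fun t => g t * g' t) (n + n') := by
  obtain ⟨f, hf, h1, K, hK, h⟩ := h
  obtain ⟨f', hf', h1', K', hK', h'⟩ := h'
  refine ⟨fun t => f t + f' t, hf.add hf', by push_cast; rw [h1, h1']; ring, K * K',
    mul_ne_zero hK hK', fun t => ?_⟩
  dsimp only
  rw [h, h', mul_add, Complex.exp_add]; ring

theorem WindsBy.div {g g' : I → ℂ} {n n' : ℤ} (h : WindsBy g n) (h' : WindsBy g' n') :
    WindsBy (fun t => g t / g' t) (n - n') := by
  obtain ⟨f, hf, h1, K, hK, h⟩ := h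
  obtain ⟨f', hf', h1', K', hK', h'⟩ := h'
  refine ⟨fun t => f t - f' t, hf.sub hf', by push_cast; rw [h1, h1']; ring, K / K',
    div_ne_zero hK hK', fun t => ?_⟩
  dsimp only
  rw [h, h', mul_sub, Complex.exp_sub, mul_div_mul_comm]

theorem windsBy_of_close {g : I → ℂ} (hg : Continuous g) (h01 : g 0 = g 1) {K : ℂ}
    (h : ∀ t, ‖g t - K‖ < ‖K‖) : WindsBy g 0 := by
  have hK : K ≠ 0 := norm_pos_iff.1 ((norm_nonneg _).trans_lt (h 0))
  have hs : ∀ t, g t / K ∈ Complex.slitPlane := fun t => by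
    have : g t / K = 1 + (g t - K) / K := by field_simp; ring
    rw [this]
    exact Complex.mem_slitPlane_of_norm_lt_one
      (by rw [norm_div, div_lt_one (norm_pos_iff.2 hK)]; exact h t)
  refine ⟨fun t => Complex.log (g t / K) / (2 * Real.pi * Complex.I),
    (Continuous.clog (by fun_prop) hs).div_const _, by simp [h01], K, hK, fun t => ?_⟩
  rw [mul_div_cancel₀ _ Complex.two_pi_I_ne_zero,
    Complex.exp_log (Complex.slitPlane_ne_zero (hs t)), mul_div_cancel₀ _ hK]

theorem windsBy_const {K : ℂ} (hK : K ≠ 0) : WindsBy (fun _ => K) 0 :=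
  ⟨fun _ => 0, continuous_const, by simp, K, hK, by simp⟩

theorem windsBy_exp :
    WindsBy (fun t => Complex.exp (2 * Real.pi * Complex.I * ((t : ℝ) : ℂ))) 1 :=
  ⟨fun t => ((t : ℝ) : ℂ), by fun_prop, by simp, 1, one_ne_zero, by simp⟩

theorem hol_wind_of_windsBy {X : Type*} [TopologicalSpace X] {ℓ : X → ℂ} {γ : I → X} {n : ℤ}
    (h : WindsBy (fun t => ℓ (γ t)) n) {c : X → X → Multiplicative ℂ}
    (hc : ∀ x y, c x y = Multiplicative.ofAdd
      (Complex.log (ℓ y / ℓ x) / (2 * Real.pi * Complex.I))) :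
    (hol c γ).toAdd = n := by
  obtain ⟨f, hf, h1, K, hK, h⟩ := h
  have hl : IsLift c γ fun t => Multiplicative.ofAdd (f t) := by
    intro t
    refine ⟨f ⁻¹' Metric.ball (f t) (1 / 8), hf.continuousAt (Metric.ball_mem_nhds _ (by norm_num)),
      fun s hs s' hs' => ?_⟩
    have hd : ‖f s' - f s‖ < 1 / 4 := by
      have h1 : dist (f s) (f t) < 1 / 8 := hs
      have h2 : dist (f s') (f t) < 1 / 8 := hs'
      rw [← dist_eq_norm]
      linarith [dist_triangle_right (f s') (f s) (f t)]
    have h' : ∀ t, ℓ (γ t) = _ := h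
    rw [hc, ← ofAdd_add, h', h', mul_div_mul_left _ _ hK, ← Complex.exp_sub, ← mul_sub]
    have him : (2 * Real.pi * Complex.I * (f s' - f s)).im = 2 * Real.pi * (f s' - f s).re := by
      simp [Complex.mul_im, Complex.mul_re]
    have hb := abs_lt.1 ((Complex.abs_re_le_norm (f s' - f s)).trans_lt hd)
    rw [Complex.log_exp (by rw [him]; nlinarith [Real.pi_pos])
      (by rw [him]; nlinarith [Real.pi_pos]),
      mul_div_cancel_left₀ _ Complex.two_pi_I_ne_zero]
    rw [add_sub_cancel]
  rw [hl.hol_eq]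
  simp [h1]

theorem exp_hol_wind {X : Type*} [TopologicalSpace X] {ℓ : X → ℂ} (hℓ : ∀ x, ℓ x ≠ 0) {γ : I → X}
    (hγ : Continuous γ) {c : X → X → Multiplicative ℂ} (hcc : IsLocalCocycle c)
    (hc : ∀ x y, c x y = Multiplicative.ofAdd
      (Complex.log (ℓ y / ℓ x) / (2 * Real.pi * Complex.I))) :
    Complex.exp (2 * Real.pi * Complex.I * (hol c γ).toAdd) = ℓ (γ 1) / ℓ (γ 0) := by
  let ψ : Multiplicative ℂ →* ℂˣ :=
    { toFun := fun z => Units.mk0 (Complex.exp (2 * Real.pi * Complex.I * z.toAdd))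
        (Complex.exp_ne_zero _)
      map_one' := by ext; simp
      map_mul' := fun x y => by ext; simp [mul_add, Complex.exp_add] }
  have hl : IsLift (fun x y => ψ (c x y)) γ fun t => Units.mk0 (ℓ (γ t)) (hℓ _) := fun t => by
    refine ⟨Set.univ, Filter.univ_mem, fun s _ s' _ => ?_⟩
    ext
    simp only [Units.val_mk0, Units.val_mul, hc, ψ, MonoidHom.coe_mk, OneHom.coe_mk, toAdd_ofAdd]
    rw [mul_div_cancel₀ _ Complex.two_pi_I_ne_zero, Complex.exp_log (div_ne_zero (hℓ _) (hℓ _)),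
      mul_div_cancel₀ _ (hℓ _)]
  have e := (hol_map hcc hγ ψ).symm.trans hl.hol_eq
  have e := congrArg Units.val e
  simp only [ψ, MonoidHom.coe_mk, OneHom.coe_mk, Units.val_mk0, Units.val_mul,
    Units.val_inv_eq_inv_val] at e
  rw [e, div_eq_inv_mul]

theorem exists_int_hol_wind {X : Type*} [TopologicalSpace X] {ℓ : X → ℂ} (hℓ : ∀ x, ℓ x ≠ 0)
    {γ : I → X} (hγ : Continuous γ) (h01 : γ 0 = γ 1) {c : X → X → Multiplicative ℂ}
    (hcc : IsLocalCocycle c) (hc : ∀ x y, c x y = Multiplicative.ofAdd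
      (Complex.log (ℓ y / ℓ x) / (2 * Real.pi * Complex.I))) :
    ∃ n : ℤ, (hol c γ).toAdd = n := by
  have e := exp_hol_wind hℓ hγ hcc hc
  rw [h01, div_self (hℓ _), Complex.exp_eq_one_iff] at e
  obtain ⟨n, hn⟩ := e
  exact ⟨n, mul_left_cancel₀ Complex.two_pi_I_ne_zero (by rw [hn]; ring)⟩

/-- The two loops spanned by a torus commute, also after transport to another base point. -/
theorem exists_commute_of_torus {X : Type*} [TopologicalSpace X] [PathConnectedSpace X] (x : X)
    {T : I × I → X} (hT : Continuous T) (h1 : ∀ t, T (0, t) = T (1, t))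
    (h2 : ∀ s, T (s, 0) = T (s, 1)) :
    ∃ p q : FundamentalGroup X x, Commute p q ∧
      ∀ c : X → X → Multiplicative ℂ, ∀ hc : IsLocalCocycle c,
        holQ hc (FundamentalGroup.toPath p) = hol c (fun t => T (0, t)) ∧
        holQ hc (FundamentalGroup.toPath q) = hol c (fun s => T (s, 0)) := by
  let ev : Path ((0, 0) : I × I) (0, 1) := ⟨⟨fun t => (0, t), by fun_prop⟩, rfl, rfl⟩
  let ev' : Path ((1, 0) : I × I) (1, 1) := ⟨⟨fun t => (1, t), by fun_prop⟩, rfl, rfl⟩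
  let eh : Path ((0, 0) : I × I) (1, 0) := ⟨⟨fun t => (t, 0), by fun_prop⟩, rfl, rfl⟩
  let eh' : Path ((0, 1) : I × I) (1, 1) := ⟨⟨fun t => (t, 1), by fun_prop⟩, rfl, rfl⟩
  have : ContractibleSpace I := (convex_Icc (0 : ℝ) 1).contractibleSpace ⟨0, by simp⟩
  have hom : (ev.trans eh').Homotopic (eh.trans ev') :=
    SimplyConnectedSpace.paths_homotopic _ _
  let P : Path (T (0, 0)) (T (0, 0)) := (ev.map hT).cast rfl (h2 0)
  let Q : Path (T (0, 0)) (T (0, 0)) := (eh.map hT).cast rfl (h1 0)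
  have e1 : ∀ t, T ((ev.trans eh') t) = (P.trans Q) t := fun t => by
    simp only [Path.trans_apply]
    split_ifs
    · rfl
    · exact (h2 _).symm
  have e2 : ∀ t, T ((eh.trans ev') t) = (Q.trans P) t := fun t => by
    simp only [Path.trans_apply]
    split_ifs
    · rfl
    · exact (h1 _).symm
  obtain ⟨K⟩ := hom
  have hPQ : (Path.Homotopic.Quotient.mk P).trans (.mk Q)
      = (Path.Homotopic.Quotient.mk Q).trans (.mk P) := by
    rw [← Path.Homotopic.Quotient.mk_trans, ← Path.Homotopic.Quotient.mk_trans]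
    refine Path.Homotopic.Quotient.eq.2 ⟨⟨⟨⟨fun z => T (K z), hT.comp K.continuous⟩, ?_, ?_⟩, ?_⟩⟩
    · intro t; exact (congrArg T (K.apply_zero t)).trans (e1 t)
    · intro t; exact (congrArg T (K.apply_one t)).trans (e2 t)
    · rintro s t (rfl | rfl)
      · exact (congrArg T (K.source s)).trans (P.trans Q).source.symm
      · refine (congrArg T (K.target s)).trans (Eq.trans ?_ (P.trans Q).target.symm)
        exact (h1 1).symm.trans (h2 0).symm
  let π := Path.Homotopic.Quotient.mk (PathConnectedSpace.somePath x (T (0, 0)))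
  have conj : ∀ p q : Path.Homotopic.Quotient (T (0, 0)) (T (0, 0)),
      ((π.trans p).trans π.symm).trans ((π.trans q).trans π.symm)
        = (π.trans (p.trans q)).trans π.symm := fun p q => by
    simp only [Path.Homotopic.Quotient.trans_assoc]
    rw [← Path.Homotopic.Quotient.trans_assoc π.symm π, Path.Homotopic.Quotient.symm_trans,
      Path.Homotopic.Quotient.refl_trans]
  have val : ∀ c : X → X → Multiplicative ℂ, ∀ hc : IsLocalCocycle c,
      ∀ p : Path.Homotopic.Quotient (T (0, 0)) (T (0, 0)),
        holQ hc ((π.trans p).trans π.symm) = holQ hc p := fun c hc p => by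
    have h1 : holQ hc π * holQ hc π.symm = 1 := by
      rw [← holQ_trans, Path.Homotopic.Quotient.trans_symm]
      have := holQ_trans hc (.refl x) (.refl x)
      rwa [Path.Homotopic.Quotient.refl_trans, left_eq_mul] at this
    rw [holQ_trans, holQ_trans, mul_right_comm, h1, one_mul]
  refine ⟨FundamentalGroup.fromPath ((π.trans (.mk P)).trans π.symm),
    FundamentalGroup.fromPath ((π.trans (.mk Q)).trans π.symm), ?_, fun c hc => ⟨?_, ?_⟩⟩
  · exact congrArg FundamentalGroup.fromPath
      ((conj _ _).trans ((congrArg (fun p => (π.trans p).trans π.symm) hPQ.symm).trans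
        (conj _ _).symm))
  · exact val c hc (.mk P)
  · exact val c hc (.mk Q)

end Winding

section Cyclotomic

/-- Integer coordinates `(a, b, c, d)` of the number `a + b ζ + c ζ² + d ζ³`. -/
abbrev Cyc : Type := ℤ × ℤ × ℤ × ℤ

namespace Cyc

/-- The product in the ring `ℤ[ζ]`. -/
def mul (x y : Cyc) : Cyc :=
  let k := x.2.1 * y.2.2.2 + x.2.2.1 * y.2.2.1 + x.2.2.2 * y.2.1
  (x.1 * y.1 + (x.2.2.1 * y.2.2.2 + x.2.2.2 * y.2.2.1) - k,
   x.1 * y.2.1 + x.2.1 * y.1 + x.2.2.2 * y.2.2.2 - k,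
   x.1 * y.2.2.1 + x.2.1 * y.2.1 + x.2.2.1 * y.1 - k,
   x.1 * y.2.2.2 + x.2.1 * y.2.2.1 + x.2.2.1 * y.2.1 + x.2.2.2 * y.1 - k)

/-- The Galois conjugate `ζ ↦ ζ²`. -/
def conj (x : Cyc) : Cyc := (x.1 - x.2.2.1, x.2.2.2 - x.2.2.1, x.2.1 - x.2.2.1, -x.2.2.1)

/-- The norm. -/
def norm (x : Cyc) : Cyc := mul (mul x (conj (conj x))) (mul (conj x) (conj (conj (conj x))))

/-- A decidable criterion for nonvanishing. -/
def NeZero (x : Cyc) : Prop := (norm x).1 ≠ 0 ∧ (norm x).2 = 0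

instance (x : Cyc) : Decidable (NeZero x) := inferInstanceAs (Decidable (_ ∧ _))

/-- The complex number with given coordinates. -/
noncomputable def ev (ζ : ℂ) (x : Cyc) : ℂ := x.1 + x.2.1 * ζ + x.2.2.1 * ζ ^ 2 + x.2.2.2 * ζ ^ 3

variable {ζ : ℂ}

theorem ev_add (x y : Cyc) : ev ζ (x + y) = ev ζ x + ev ζ y := by
  simp only [ev, Prod.fst_add, Prod.snd_add]; push_cast; ring

theorem ev_sub (x y : Cyc) : ev ζ (x - y) = ev ζ x - ev ζ y := by
  simp only [ev, Prod.fst_sub, Prod.snd_sub]; push_cast; ring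

theorem ev_zero : ev ζ 0 = 0 := by simp [ev]

theorem ev_mul (hζ : 1 + ζ + ζ ^ 2 + ζ ^ 3 + ζ ^ 4 = 0) (x y : Cyc) :
    ev ζ (mul x y) = ev ζ x * ev ζ y := by
  have h5 : ζ ^ 5 = 1 := by linear_combination (ζ - 1) * hζ
  simp only [ev, mul]
  push_cast
  linear_combination (-(x.2.1 * y.2.2.2 + x.2.2.1 * y.2.2.1 + x.2.2.2 * y.2.1 : ℂ)) * hζ
    - ((x.2.2.1 * y.2.2.2 + x.2.2.2 * y.2.2.1) + x.2.2.2 * y.2.2.2 * ζ : ℂ) * h5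

theorem ev_ne_zero (hζ : 1 + ζ + ζ ^ 2 + ζ ^ 3 + ζ ^ 4 = 0) {x : Cyc} (hx : NeZero x) :
    ev ζ x ≠ 0 := by
  intro h
  have h1 : ev ζ (norm x) = 0 := by rw [norm, ev_mul hζ, ev_mul hζ, h, zero_mul, zero_mul]
  obtain ⟨h2, h3⟩ := hx
  simp only [ev, h3, Prod.fst_zero, Prod.snd_zero] at h1
  norm_num at h1
  exact h2 h1

/-- The bilinear product of two vectors. -/
def dot (u v : Fin 3 → Cyc) : Cyc := mul (u 0) (v 0) + mul (u 1) (v 1) + mul (u 2) (v 2)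

/-- The cross product of two vectors. -/
def cross (u v : Fin 3 → Cyc) : Fin 3 → Cyc :=
  ![mul (u 1) (v 2) - mul (u 2) (v 1), mul (u 2) (v 0) - mul (u 0) (v 2),
    mul (u 0) (v 1) - mul (u 1) (v 0)]

/-- Integer coordinates of the coefficients of the lines. -/
def line : Fin 12 → Fin 3 → Cyc :=
  ![![(1, 0, 0, 0), (0, 0, 0, 0), (-1, 0, 0, 0)],
    ![(1, 0, 0, 0), (1, 0, 0, 0), (0, 0, 0, 0)],
    ![(1, 0, 0, 0), (0, 0, 0, 0), (1, 0, 0, 0)],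
    ![(1, 0, 0, 0), (-1, 0, 0, 0), (0, 0, 0, 0)],
    ![(0, 0, 0, 0), (1, 0, 0, 0), (-1, 0, 0, 0)],
    ![(0, 0, 0, 0), (1, 0, 0, 0), (1, 0, 0, 0)],
    ![(1, 0, 0, 0), (1, 1, 1, 0), (0, -1, -1, 0)],
    ![(1, 0, 0, 0), (-1, -1, 0, -1), (0, -1, 0, -1)],
    ![(1, 0, 0, 0), (0, 1, 1, 0), (-1, -1, -1, 0)],
    ![(1, 0, 0, 0), (0, -1, 0, -1), (-1, -1, 0, -1)],
    ![(5, 0, 0, 0), (1, 2, 3, -1), (-2, -4, -1, -3)],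
    ![(1, 0, 0, 0), (0, 1, 1, 1), (-1, -1, -1, -1)]]

end Cyc

/-- The linear form defining a line of the arrangement. -/
noncomputable def lin (ζ : ℂ) (i : Fin 12) (v : Fin 3 → ℂ) : ℂ :=
  coeffs ζ i 0 * v 0 + coeffs ζ i 1 * v 1 + coeffs ζ i 2 * v 2

theorem inv_eq_of_cyclotomic {ζ : ℂ} (hζ : 1 + ζ + ζ ^ 2 + ζ ^ 3 + ζ ^ 4 = 0) :
    ζ⁻¹ = -1 - ζ - ζ ^ 2 - ζ ^ 3 := by
  refine inv_eq_of_mul_eq_one_right ?_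
  linear_combination -hζ

theorem inv_sq_eq_of_cyclotomic {ζ : ℂ} (hζ : 1 + ζ + ζ ^ 2 + ζ ^ 3 + ζ ^ 4 = 0) :
    ζ⁻¹ ^ 2 = ζ ^ 3 := by
  rw [inv_eq_of_cyclotomic hζ]
  linear_combination (ζ ^ 2 + ζ + 1) * hζ

theorem coeffs_eq_ev {ζ : ℂ} (hζ : 1 + ζ + ζ ^ 2 + ζ ^ 3 + ζ ^ 4 = 0) (i : Fin 12) (k : Fin 3) :
    coeffs ζ i k = Cyc.ev ζ (Cyc.line i k) := by
  rw [coeffs, inv_sq_eq_of_cyclotomic hζ, inv_eq_of_cyclotomic hζ]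
  fin_cases i <;> fin_cases k <;> simp [Cyc.ev, Cyc.line] <;> ring

theorem lin_ev {ζ : ℂ} (hζ : 1 + ζ + ζ ^ 2 + ζ ^ 3 + ζ ^ 4 = 0) (i : Fin 12) (v : Fin 3 → Cyc) :
    lin ζ i (fun k => Cyc.ev ζ (v k)) = Cyc.ev ζ (Cyc.dot (Cyc.line i) v) := by
  simp only [lin, coeffs_eq_ev hζ, Cyc.dot, Cyc.ev_add, Cyc.ev_mul hζ]

theorem lin_add (ζ : ℂ) (i : Fin 12) (u v : Fin 3 → ℂ) :
    lin ζ i (u + v) = lin ζ i u + lin ζ i v := by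
  simp only [lin, Pi.add_apply]; ring

theorem lin_smul (ζ : ℂ) (i : Fin 12) (r : ℂ) (v : Fin 3 → ℂ) :
    lin ζ i (r • v) = r * lin ζ i v := by
  simp only [lin, Pi.smul_apply, smul_eq_mul]; ring

theorem continuous_lin (ζ : ℂ) (i : Fin 12) : Continuous (lin ζ i) := by
  unfold lin; fun_prop

end Cyclotomic

section Transport

theorem Path.Homotopic.of_map_homeomorph {X Y : Type*} [TopologicalSpace X] [TopologicalSpace Y]
    (e : X ≃ₜ Y) {x : X} {γ δ : Path x x}
    (h : (γ.map e.continuous).Homotopic (δ.map e.continuous)) : γ.Homotopic δ := by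
  have h1 := (h.map ⟨e.symm, e.symm.continuous⟩).pathCast (e.symm_apply_apply x).symm
    (e.symm_apply_apply x).symm
  convert h1 using 1
  · ext t; simp
  · ext t; simp

/-- The isomorphism of fundamental groups induced by a homeomorphism. -/
noncomputable def fundamentalGroupCongr {X Y : Type*} [TopologicalSpace X] [TopologicalSpace Y]
    (e : X ≃ₜ Y) (x : X) : FundamentalGroup X x ≃* FundamentalGroup Y (e x) := by
  refine MulEquiv.ofBijective (FundamentalGroup.map ⟨e, e.continuous⟩ x) ⟨?_, ?_⟩
  · intro p q h
    induction p using Quotient.ind with | _ γ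
    induction q using Quotient.ind with | _ δ
    exact Quotient.sound (Path.Homotopic.of_map_homeomorph e (Quotient.exact h))
  · intro q
    induction q using Quotient.ind with | _ δ
    refine ⟨FundamentalGroup.fromPath
      (.mk ((δ.map e.symm.continuous).cast (by simp) (by simp))), ?_⟩
    refine congrArg Path.Homotopic.Quotient.mk ?_
    ext t
    simp

end Transport

section Chart

/-- The origin and the two coordinate directions of an affine chart in which the last line is the
line at infinity. -/
def Cyc.frame : Fin 3 → Fin 3 → Cyc :=
  ![![(1, 0, 0, 0), (0, 0, 0, 0), (0, 0, 0, 0)],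
    ![(0, -1, -1, -1), (1, 0, 0, 0), (0, 0, 0, 0)],
    ![(1, 1, 1, 1), (0, 0, 0, 0), (1, 0, 0, 0)]]

/-- The vectors with coordinates given by `Cyc.frame`. -/
noncomputable def frame (ζ : ℂ) (k : Fin 3) (j : Fin 3) : ℂ := Cyc.ev ζ (Cyc.frame k j)

/-- The homogeneous coordinates of a point of the chart. -/
noncomputable def chartPt (ζ : ℂ) (p : ℂ × ℂ) : Fin 3 → ℂ :=
  frame ζ 0 + (p.2 • frame ζ 1 + p.1 • frame ζ 2)

/-- The coordinates in the chart of a point given by homogeneous coordinates. -/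
noncomputable def toChart (ζ : ℂ) (v : Fin 3 → ℂ) : ℂ × ℂ := (v 2 / lin ζ 11 v, v 1 / lin ζ 11 v)

/-- The slope of a line in the chart. -/
noncomputable def chartSlope (ζ : ℂ) (i : Fin 11) : ℂ :=
  - lin ζ i.castSucc (frame ζ 1) / lin ζ i.castSucc (frame ζ 2)

/-- The chartIntercept of a line in the chart. -/
noncomputable def chartIntercept (ζ : ℂ) (i : Fin 11) : ℂ :=
  - lin ζ i.castSucc (frame ζ 0) / lin ζ i.castSucc (frame ζ 2)

variable {ζ : ℂ}

theorem lin_frame (hζ : 1 + ζ + ζ ^ 2 + ζ ^ 3 + ζ ^ 4 = 0) (i : Fin 12) (k : Fin 3) :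
    lin ζ i (frame ζ k) = Cyc.ev ζ (Cyc.dot (Cyc.line i) (Cyc.frame k)) := lin_ev hζ i _

theorem lin_frame_two_ne_zero (hζ : 1 + ζ + ζ ^ 2 + ζ ^ 3 + ζ ^ 4 = 0) (i : Fin 11) :
    lin ζ i.castSucc (frame ζ 2) ≠ 0 := by
  rw [lin_frame hζ]
  refine Cyc.ev_ne_zero hζ ?_
  revert i
  decide +kernel

theorem lin_last_chartPt (hζ : 1 + ζ + ζ ^ 2 + ζ ^ 3 + ζ ^ 4 = 0) (p : ℂ × ℂ) :
    lin ζ 11 (chartPt ζ p) = 1 := by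
  have h0 : Cyc.dot (Cyc.line 11) (Cyc.frame 0) = (1, 0, 0, 0) := by decide +kernel
  have h1 : Cyc.dot (Cyc.line 11) (Cyc.frame 1) = 0 := by decide +kernel
  have h2 : Cyc.dot (Cyc.line 11) (Cyc.frame 2) = 0 := by decide +kernel
  rw [chartPt, lin_add, lin_add, lin_smul, lin_smul, lin_frame hζ, lin_frame hζ, lin_frame hζ,
    h0, h1, h2]
  simp [Cyc.ev]

theorem lin_chartPt (hζ : 1 + ζ + ζ ^ 2 + ζ ^ 3 + ζ ^ 4 = 0) (i : Fin 11) (p : ℂ × ℂ) :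
    lin ζ i.castSucc (chartPt ζ p)
      = lin ζ i.castSucc (frame ζ 2) * fibForm (chartSlope ζ i) (chartIntercept ζ i) p := by
  have h := lin_frame_two_ne_zero hζ i
  rw [chartPt, lin_add, lin_add, lin_smul, lin_smul, fibForm_apply, chartSlope, chartIntercept]
  field_simp
  ring

theorem toChart_chartPt (hζ : 1 + ζ + ζ ^ 2 + ζ ^ 3 + ζ ^ 4 = 0) (p : ℂ × ℂ) :
    toChart ζ (chartPt ζ p) = p := by
  rw [toChart, lin_last_chartPt hζ]
  ext <;> simp [chartPt, frame, Cyc.frame, Cyc.ev]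

theorem chartPt_toChart (hζ : 1 + ζ + ζ ^ 2 + ζ ^ 3 + ζ ^ 4 = 0) {v : Fin 3 → ℂ}
    (hv : lin ζ 11 v ≠ 0) : chartPt ζ (toChart ζ v) = (lin ζ 11 v)⁻¹ • v := by
  have h : lin ζ 11 v = v 0 + (ζ + ζ ^ 2 + ζ ^ 3) * v 1 - (1 + ζ + ζ ^ 2 + ζ ^ 3) * v 2 := by
    simp only [lin, coeffs_eq_ev hζ]
    simp [Cyc.ev, Cyc.line]
    ring
  ext k
  fin_cases k
  · simp only [chartPt, toChart, frame, Cyc.frame, Cyc.ev, Pi.add_apply, Pi.smul_apply, smul_eq_mul]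
    simp
    field_simp
    rw [h]
    ring
  · simp [chartPt, toChart, frame, Cyc.frame, Cyc.ev]; ring
  · simp [chartPt, toChart, frame, Cyc.frame, Cyc.ev]; ring

theorem toChart_smul {r : ℂ} (hr : r ≠ 0) (v : Fin 3 → ℂ) :
    toChart ζ (r • v) = toChart ζ v := by
  simp only [toChart, lin_smul, Pi.smul_apply, smul_eq_mul, mul_div_mul_left _ _ hr]

theorem continuous_chartPt : Continuous (chartPt ζ) := by unfold chartPt; fun_prop

/-- The complement of the arrangement in the chart. -/
abbrev ChartCompl (ζ : ℂ) : Set (ℂ × ℂ) := fibCompl (chartSlope ζ) (chartIntercept ζ)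

theorem chartIntercept_ne (hζ : 1 + ζ + ζ ^ 2 + ζ ^ 3 + ζ ^ 4 = 0) (i j : Fin 11) (hij : i ≠ j)
    (h : chartSlope ζ i = chartSlope ζ j) : chartIntercept ζ i ≠ chartIntercept ζ j := by
  intro h'
  have hi := lin_frame_two_ne_zero hζ i
  have hj := lin_frame_two_ne_zero hζ j
  rw [chartSlope, chartSlope, div_eq_div_iff hi hj] at h
  rw [chartIntercept, chartIntercept, div_eq_div_iff hi hj] at h'
  have key : ∀ i j : Fin 11, i ≠ j → ∃ k : Fin 3,
      Cyc.NeZero (Cyc.mul (Cyc.dot (Cyc.line j.castSucc) (Cyc.frame k))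
          (Cyc.dot (Cyc.line i.castSucc) (Cyc.frame 2))
        - Cyc.mul (Cyc.dot (Cyc.line i.castSucc) (Cyc.frame k))
          (Cyc.dot (Cyc.line j.castSucc) (Cyc.frame 2))) ∧ (k = 0 ∨ k = 1) := by
    decide +kernel
  obtain ⟨k, hk, hk'⟩ := key i j hij
  refine Cyc.ev_ne_zero hζ hk ?_
  rw [Cyc.ev_sub, Cyc.ev_mul hζ, Cyc.ev_mul hζ]
  simp only [← lin_frame hζ]
  rcases hk' with rfl | rfl
  · linear_combination h'
  · linear_combination h

theorem mem_chartCompl (hζ : 1 + ζ + ζ ^ 2 + ζ ^ 3 + ζ ^ 4 = 0) {p : ℂ × ℂ} :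
    p ∈ ChartCompl ζ ↔ ∀ i, lin ζ i (chartPt ζ p) ≠ 0 := by
  constructor
  · intro h i
    induction i using Fin.lastCases with
    | last =>
      change lin ζ 11 (chartPt ζ p) ≠ 0
      rw [lin_last_chartPt hζ]
      exact one_ne_zero
    | cast i =>
      rw [lin_chartPt hζ]
      exact mul_ne_zero (lin_frame_two_ne_zero hζ i) (h i)
  · intro h i
    have := h i.castSucc
    rw [lin_chartPt hζ] at this
    exact right_ne_zero_of_mul this

theorem mem_compl_unionA {p : P2} : p ∈ (unionA ζ)ᶜ ↔ ∀ i, lin ζ i p.rep ≠ 0 := by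
  simp only [unionA, Set.mem_compl_iff, Set.mem_iUnion, not_exists]
  rfl

theorem exists_rep_mk {v : Fin 3 → ℂ} (hv : v ≠ 0) :
    ∃ r : ℂ, r ≠ 0 ∧ (Projectivization.mk ℂ v hv).rep = r • v := by
  obtain ⟨a, ha⟩ := Projectivization.exists_smul_eq_mk_rep ℂ v hv
  exact ⟨a, a.ne_zero, ha.symm⟩

theorem mk_mem_compl_unionA {v : Fin 3 → ℂ} (hv : v ≠ 0) :
    Projectivization.mk ℂ v hv ∈ (unionA ζ)ᶜ ↔ ∀ i, lin ζ i v ≠ 0 := by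
  obtain ⟨r, hr, h⟩ := exists_rep_mk hv
  simp only [mem_compl_unionA, h, lin_smul, ne_eq, mul_eq_zero, hr, false_or]

theorem isQuotientMap_mk : Topology.IsQuotientMap
    fun v : {v : Fin 3 → ℂ // v ≠ 0} => (Projectivization.mk ℂ v.1 v.2 : P2) :=
  isQuotientMap_quot_mk

theorem isOpen_compl_unionA : IsOpen (unionA ζ)ᶜ := by
  rw [← isQuotientMap_mk.isOpen_preimage]
  have : (fun v : {v : Fin 3 → ℂ // v ≠ 0} => (Projectivization.mk ℂ v.1 v.2 : P2)) ⁻¹' (unionA ζ)ᶜ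
      = ⋂ i, {v | lin ζ i v.1 ≠ 0} := by
    ext v
    simp only [Set.mem_preimage, mk_mem_compl_unionA, Set.mem_iInter, Set.mem_ofPred_eq]
  rw [this]
  exact isOpen_iInter_of_finite fun i =>
    isOpen_ne_fun ((continuous_lin ζ i).comp continuous_subtype_val) continuous_const

theorem continuousOn_toChart_rep : ContinuousOn (fun p : P2 => toChart ζ p.rep) (unionA ζ)ᶜ := by
  rw [isQuotientMap_mk.continuousOn_isOpen_iff isOpen_compl_unionA]
  have : ((fun p : P2 => toChart ζ p.rep) ∘ fun v : {v : Fin 3 → ℂ // v ≠ 0} =>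
      (Projectivization.mk ℂ v.1 v.2 : P2)) = fun v => toChart ζ v.1 := by
    ext1 v
    obtain ⟨r, hr, h⟩ := exists_rep_mk v.2
    simp only [Function.comp, h, toChart_smul hr]
  rw [this]
  intro v hv
  have h1 := (mk_mem_compl_unionA v.2).1 hv 11
  have h2 : Continuous fun v : {v : Fin 3 → ℂ // v ≠ 0} => lin ζ 11 v.1 :=
    (continuous_lin ζ 11).comp continuous_subtype_val
  have h3 : ∀ k : Fin 3, Continuous fun v : {v : Fin 3 → ℂ // v ≠ 0} => v.1 k := fun k =>
    (continuous_apply k).comp continuous_subtype_val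
  exact ((h3 2).continuousAt.div h2.continuousAt h1).prodMk
    ((h3 1).continuousAt.div h2.continuousAt h1) |>.continuousWithinAt

theorem chartPt_ne_zero (hζ : 1 + ζ + ζ ^ 2 + ζ ^ 3 + ζ ^ 4 = 0) (p : ℂ × ℂ) :
    chartPt ζ p ≠ 0 := by
  intro h
  have h1 := lin_last_chartPt hζ p
  rw [h] at h1
  simp [lin] at h1

theorem toChart_mem (hζ : 1 + ζ + ζ ^ 2 + ζ ^ 3 + ζ ^ 4 = 0) {v : Fin 3 → ℂ}
    (hv : ∀ i, lin ζ i v ≠ 0) : toChart ζ v ∈ ChartCompl ζ := by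
  rw [mem_chartCompl hζ, chartPt_toChart hζ (hv 11)]
  intro i
  rw [lin_smul]
  exact mul_ne_zero (inv_ne_zero (hv 11)) (hv i)

/-- The complement of the arrangement is homeomorphic to its image in the chart. -/
noncomputable def chartHomeomorph (hζ : 1 + ζ + ζ ^ 2 + ζ ^ 3 + ζ ^ 4 = 0) :
    ↥(unionA ζ)ᶜ ≃ₜ ChartCompl ζ where
  toFun p := ⟨toChart ζ p.1.rep, toChart_mem hζ (mem_compl_unionA.1 p.2)⟩
  invFun p := ⟨Projectivization.mk ℂ (chartPt ζ p) (chartPt_ne_zero hζ p),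
    (mk_mem_compl_unionA _).2 ((mem_chartCompl hζ).1 p.2)⟩
  left_inv p := by
    refine Subtype.ext ?_
    have h := mem_compl_unionA.1 p.2 11
    have h1 : Projectivization.mk ℂ (chartPt ζ (toChart ζ p.1.rep)) (chartPt_ne_zero hζ _)
        = Projectivization.mk ℂ p.1.rep p.1.rep_nonzero := by
      rw [Projectivization.mk_eq_mk_iff']
      exact ⟨_, (chartPt_toChart hζ h).symm⟩
    exact h1.trans p.1.mk_rep
  right_inv p := by
    refine Subtype.ext ?_
    obtain ⟨r, hr, h⟩ := exists_rep_mk (chartPt_ne_zero hζ p.1)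
    dsimp only
    rw [h, toChart_smul hr, toChart_chartPt hζ]
  continuous_toFun := (continuousOn_iff_continuous_domRestrict.1
    continuousOn_toChart_rep).subtype_mk _
  continuous_invFun := by
    refine Continuous.subtype_mk (isQuotientMap_mk.continuous.comp
      (Continuous.subtype_mk (continuous_chartPt.comp continuous_subtype_val)
        fun p => chartPt_ne_zero hζ p.1)) _

end Chart

section ChartWinding

variable {ζ : ℂ}

/-- The linear forms of the arrangement in the chart. -/
noncomputable def chartForm (ζ : ℂ) (j : Fin 12) (y : ChartCompl ζ) : ℂ := lin ζ j (chartPt ζ y)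

/-- The cocycle measuring the winding around a line of the arrangement, relative to the last
line. -/
noncomputable def chartWind (ζ : ℂ) (j : Fin 12) (y z : ChartCompl ζ) : Multiplicative ℂ :=
  Multiplicative.ofAdd
    (Complex.log (chartForm ζ j z / chartForm ζ j y) / (2 * Real.pi * Complex.I))

theorem chartForm_ne_zero (hζ : 1 + ζ + ζ ^ 2 + ζ ^ 3 + ζ ^ 4 = 0) (j : Fin 12)
    (y : ChartCompl ζ) : chartForm ζ j y ≠ 0 := (mem_chartCompl hζ).1 y.2 j

theorem continuous_chartForm (j : Fin 12) : Continuous (chartForm ζ j) :=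
  (continuous_lin ζ j).comp (continuous_chartPt.comp continuous_subtype_val)

theorem chartWind_castSucc (hζ : 1 + ζ + ζ ^ 2 + ζ ^ 3 + ζ ^ 4 = 0) (i : Fin 11) :
    chartWind ζ i.castSucc = fibWind (chartSlope ζ) (chartIntercept ζ) i := by
  ext y z
  simp only [chartWind, fibWind, wind, chartForm, lin_chartPt hζ]
  rw [mul_div_mul_left _ _ (lin_frame_two_ne_zero hζ i)]

theorem chartWind_last (hζ : 1 + ζ + ζ ^ 2 + ζ ^ 3 + ζ ^ 4 = 0) (y z : ChartCompl ζ) :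
    chartWind ζ (Fin.last 11) y z = 1 := by
  have h : ∀ p, lin ζ (Fin.last 11) (chartPt ζ p) = 1 := lin_last_chartPt hζ
  simp only [chartWind, chartForm, h]
  simp

theorem isLocalCocycle_chartWind (hζ : 1 + ζ + ζ ^ 2 + ζ ^ 3 + ζ ^ 4 = 0) (j : Fin 12) :
    IsLocalCocycle (chartWind ζ j) := by
  induction j using Fin.lastCases with
  | last => exact fun x => ⟨Set.univ, Filter.univ_mem, fun y _ z _ w _ => by
      simp only [chartWind_last hζ, one_mul]⟩
  | cast i => rw [chartWind_castSucc hζ]; exact isLocalCocycle_fibWind i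

theorem exists_int_chartWind (hζ : 1 + ζ + ζ ^ 2 + ζ ^ 3 + ζ ^ 4 = 0) {x : ChartCompl ζ}
    (j : Fin 12) (p : FundamentalGroup (ChartCompl ζ) x) :
    ∃ n : ℤ, (holQ (isLocalCocycle_chartWind hζ j) (FundamentalGroup.toPath p)).toAdd = n := by
  induction p using Quotient.ind with | _ γ
  exact exists_int_hol_wind (chartForm_ne_zero hζ j) γ.continuous (by simp)
    (isLocalCocycle_chartWind hζ j) fun _ _ => rfl

/-- The winding number of a loop around a line of the arrangement, relative to the last line. -/
noncomputable def windNum (hζ : 1 + ζ + ζ ^ 2 + ζ ^ 3 + ζ ^ 4 = 0) {x : ChartCompl ζ}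
    (j : Fin 12) (p : FundamentalGroup (ChartCompl ζ) x) : ℤ :=
  (exists_int_chartWind hζ j p).choose

theorem windNum_eq (hζ : 1 + ζ + ζ ^ 2 + ζ ^ 3 + ζ ^ 4 = 0) {x : ChartCompl ζ}
    (j : Fin 12) (p : FundamentalGroup (ChartCompl ζ) x) :
    (windNum hζ j p : ℂ) =
      (holQ (isLocalCocycle_chartWind hζ j) (FundamentalGroup.toPath p)).toAdd :=
  (exists_int_chartWind hζ j p).choose_spec.symm

theorem windNum_mul (hζ : 1 + ζ + ζ ^ 2 + ζ ^ 3 + ζ ^ 4 = 0) {x : ChartCompl ζ}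
    (j : Fin 12) (p q : FundamentalGroup (ChartCompl ζ) x) :
    windNum hζ j (p * q) = windNum hζ j p + windNum hζ j q := by
  have : (windNum hζ j (p * q) : ℂ) = windNum hζ j p + windNum hζ j q := by
    rw [windNum_eq, windNum_eq, windNum_eq, ← toAdd_mul, mul_comm]
    exact congrArg Multiplicative.toAdd (holQ_mul (isLocalCocycle_chartWind hζ j) p q)
  exact_mod_cast this

theorem windNum_last (hζ : 1 + ζ + ζ ^ 2 + ζ ^ 3 + ζ ^ 4 = 0) {x : ChartCompl ζ}
    (p : FundamentalGroup (ChartCompl ζ) x) : windNum hζ (Fin.last 11) p = 0 := by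
  have : (windNum hζ (Fin.last 11) p : ℂ) = 0 := by
    rw [windNum_eq]
    induction p using Quotient.ind with | _ γ
    change (hol (chartWind ζ (Fin.last 11)) γ).toAdd = 0
    have := (isLocalCocycle_chartWind hζ (Fin.last 11))
    have h := hol_mem this γ.continuous ⊥ fun x => ⟨Set.univ, Filter.univ_mem, fun y _ z _ => by
      rw [chartWind_last hζ]; exact Subgroup.one_mem _⟩
    rw [Subgroup.mem_bot.1 h]
    rfl
  exact_mod_cast this

theorem exists_eq_sum_windNum (hζ : 1 + ζ + ζ ^ 2 + ζ ^ 3 + ζ ^ 4 = 0) {x : ChartCompl ζ}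
    {h : FundamentalGroup (ChartCompl ζ) x → ℂ} (hh : ∀ p q, h (p * q) = h p + h q) :
    ∃ y : Fin 12 → ℂ, ∑ j, y j = 0 ∧ ∀ p, h p = ∑ j, y j * windNum hζ j p := by
  obtain ⟨k, hk⟩ := exists_eq_sum_fibWind (chartIntercept_ne hζ) (x := x)
    (MonoidHom.mk' (fun p => Multiplicative.ofAdd (h p)) fun p q => by rw [hh, ofAdd_add])
  refine ⟨Fin.snoc k (-∑ i, k i), by
    rw [Fin.sum_univ_castSucc]
    simp only [Fin.snoc_castSucc, Fin.snoc_last, add_neg_cancel], fun p => ?_⟩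
  rw [Fin.sum_univ_castSucc, windNum_last hζ]
  simp only [Fin.snoc_castSucc, Int.cast_zero, mul_zero, add_zero, windNum_eq]
  refine (hk (FundamentalGroup.toPath p)).trans (Finset.sum_congr rfl fun i _ => ?_)
  congr 2
  simp only [chartWind_castSucc hζ]

/-- The circle in the complex plane. -/
noncomputable def circ (t : I) : ℂ := Complex.exp (2 * Real.pi * Complex.I * ((t : ℝ) : ℂ))

theorem norm_circ (t : I) : ‖circ t‖ = 1 := by
  rw [circ, show (2 * Real.pi * Complex.I * ((t : ℝ) : ℂ) : ℂ)
    = ((2 * Real.pi * t : ℝ) : ℂ) * Complex.I by push_cast; ring]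
  exact Complex.norm_exp_ofReal_mul_I _

theorem circ_zero : circ 0 = 1 := by simp [circ]
theorem circ_one : circ 1 = 1 := by simp [circ]

theorem continuous_circ : Continuous circ := by unfold circ; fun_prop

theorem add_ne_zero_of_norm_lt {K z : ℂ} (h : ‖z‖ < ‖K‖) : K + z ≠ 0 := by
  intro h0
  rw [eq_neg_of_add_eq_zero_left h0, norm_neg] at h
  exact lt_irrefl _ h

/-- Two commuting loops on a torus close to a multiple point of the arrangement. -/
theorem exists_commute_windNum (hζ : 1 + ζ + ζ ^ 2 + ζ ^ 3 + ζ ^ 4 = 0) (x : ChartCompl ζ)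
    {P b D : Fin 3 → ℂ} {S : Finset (Fin 12)} {i : Fin 12} (hi : i ∈ S)
    (hP : ∀ j ∈ S, lin ζ j P = 0) (hP' : ∀ j ∉ S, lin ζ j P ≠ 0) (hb : lin ζ i b = 0)
    (hb' : ∀ j, j ≠ i → lin ζ j b ≠ 0) (hD : ∀ j, lin ζ j D ≠ 0) :
    ∃ p q : FundamentalGroup (ChartCompl ζ) x, Commute p q ∧
      (∀ j, windNum hζ j p = (if j = i then 1 else 0) - (if 11 = i then 1 else 0)) ∧
      ∀ j, windNum hζ j q = (if j ∈ S then 1 else 0) - (if 11 ∈ S then 1 else 0) := by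
  obtain ⟨ε, hε0, hε⟩ : ∃ ε : ℝ, 0 < ε ∧ ∀ j, j ≠ i → ε * ‖lin ζ j D‖ < ‖lin ζ j b‖ := by
    have h : ∀ᶠ ε : ℝ in 𝓝[>] 0, ∀ j, j ≠ i → ε * ‖lin ζ j D‖ < ‖lin ζ j b‖ := by
      refine Filter.eventually_all.2 fun j => Filter.eventually_imp_distrib_left.2 fun hj => ?_
      have : Filter.Tendsto (fun ε : ℝ => ε * ‖lin ζ j D‖) (𝓝[>] 0) (𝓝 (0 * ‖lin ζ j D‖)) :=
        ((continuous_id.mul continuous_const).tendsto 0).mono_left nhdsWithin_le_nhds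
      rw [zero_mul] at this
      exact this.eventually_lt_const (norm_pos_iff.2 (hb' j hj))
    obtain ⟨ε, h1, h2⟩ := (h.and self_mem_nhdsWithin).exists
    exact ⟨ε, h2, h1⟩
  obtain ⟨r, hr0, hr⟩ : ∃ r : ℝ, 0 < r ∧ ∀ j, j ∉ S →
      r * (‖lin ζ j b‖ + ε * ‖lin ζ j D‖) < ‖lin ζ j P‖ := by
    have h : ∀ᶠ r : ℝ in 𝓝[>] 0, ∀ j, j ∉ S →
        r * (‖lin ζ j b‖ + ε * ‖lin ζ j D‖) < ‖lin ζ j P‖ := by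
      refine Filter.eventually_all.2 fun j => Filter.eventually_imp_distrib_left.2 fun hj => ?_
      have : Filter.Tendsto (fun r : ℝ => r * (‖lin ζ j b‖ + ε * ‖lin ζ j D‖)) (𝓝[>] 0)
          (𝓝 (0 * (‖lin ζ j b‖ + ε * ‖lin ζ j D‖))) :=
        ((continuous_id.mul continuous_const).tendsto 0).mono_left nhdsWithin_le_nhds
      rw [zero_mul] at this
      exact this.eventually_lt_const (norm_pos_iff.2 (hP' j hj))
    obtain ⟨r, h1, h2⟩ := (h.and self_mem_nhdsWithin).exists
    exact ⟨r, h2, h1⟩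
  let v : I × I → Fin 3 → ℂ := fun s =>
    P + ((r : ℂ) * circ s.1) • (b + ((ε : ℂ) * circ s.2) • D)
  have hv : Continuous v := by
    have := continuous_circ
    fun_prop
  have ev : ∀ j s, lin ζ j (v s) = lin ζ j P
      + r * circ s.1 * (lin ζ j b + ε * circ s.2 * lin ζ j D) := fun j s => by
    simp only [v, lin_add, lin_smul]
  have nε : ∀ j t, ‖(ε : ℂ) * circ t * lin ζ j D‖ = ε * ‖lin ζ j D‖ := fun j t => by
    rw [norm_mul, norm_mul, norm_circ, mul_one, Complex.norm_real, Real.norm_of_nonneg hε0.le]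
  have nr : ∀ t (z : ℂ), ‖(r : ℂ) * circ t * z‖ = r * ‖z‖ := fun t z => by
    rw [norm_mul, norm_mul, norm_circ, mul_one, Complex.norm_real, Real.norm_of_nonneg hr0.le]
  have hc0 : ∀ t, circ t ≠ 0 := fun t => Complex.exp_ne_zero _
  have hε0' : (ε : ℂ) ≠ 0 := by exact_mod_cast hε0.ne'
  have hr0' : (r : ℂ) ≠ 0 := by exact_mod_cast hr0.ne'
  have far : ∀ j ∉ S, ∀ s : I × I, ‖(r : ℂ) * circ s.1 * (lin ζ j b + ε * circ s.2 * lin ζ j D)‖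
      < ‖lin ζ j P‖ := fun j hj s => by
    rw [nr]
    refine lt_of_le_of_lt (mul_le_mul_of_nonneg_left (norm_add_le _ _) hr0.le) ?_
    rw [nε]
    exact hr j hj
  have inner : ∀ j t, lin ζ j b + ε * circ t * lin ζ j D ≠ 0 := fun j t => by
    by_cases hj : j = i
    · subst hj
      rw [hb, zero_add]
      exact mul_ne_zero (mul_ne_zero hε0' (hc0 _)) (hD _)
    · refine add_ne_zero_of_norm_lt ?_
      rw [nε]
      exact hε j hj
  have hne : ∀ s j, lin ζ j (v s) ≠ 0 := fun s j => by
    rw [ev]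
    by_cases hj : j ∈ S
    · rw [hP j hj, zero_add]
      exact mul_ne_zero (mul_ne_zero hr0' (hc0 _)) (inner _ _)
    · exact add_ne_zero_of_norm_lt (far j hj s)
  let T : I × I → ChartCompl ζ := fun s => ⟨toChart ζ (v s), toChart_mem hζ (hne s)⟩
  have hT : Continuous T := by
    have h11 := (continuous_lin ζ 11).comp hv
    refine Continuous.subtype_mk ?_ _
    exact (((continuous_apply 2).comp hv).div h11 fun s => hne s 11).prodMk
      (((continuous_apply 1).comp hv).div h11 fun s => hne s 11)
  have hform : ∀ j s, chartForm ζ j (T s) = lin ζ j (v s) / lin ζ 11 (v s) := fun j s => by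
    simp only [chartForm, T]
    rw [chartPt_toChart hζ (hne s 11), lin_smul, inv_mul_eq_div]
  have : PathConnectedSpace (ChartCompl ζ) :=
    isPathConnected_iff_pathConnectedSpace.1 isPathConnected_fibCompl
  obtain ⟨p, q, hpq, hw⟩ := exists_commute_of_torus x hT
    (fun t => by simp only [T, v, circ_zero, circ_one])
    (fun t => by simp only [T, v, circ_zero, circ_one])
  have wcirc : ∀ {K : ℂ}, K ≠ 0 → WindsBy (fun t => K * circ t) 1 := fun hK => by
    have := (windsBy_const hK).mul windsBy_exp
    rwa [zero_add] at this
  have wt : ∀ j, WindsBy (fun t => lin ζ j (v (0, t))) (if j = i then 1 else 0) := by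
    intro j
    have hcont : Continuous fun t => lin ζ j (v (0, t)) :=
      (continuous_lin ζ j).comp (hv.comp (by fun_prop))
    split_ifs with hj
    · subst hj
      have : (fun t => lin ζ j (v (0, t))) = fun t => ((r : ℂ) * ε * lin ζ j D) * circ t := by
        ext t
        rw [ev, hb, hP j hi, circ_zero]; ring
      rw [this]
      exact wcirc (mul_ne_zero (mul_ne_zero hr0' hε0') (hD j))
    · by_cases hjS : j ∈ S
      · refine windsBy_of_close hcont (by simp only [v, circ_zero, circ_one])
          (K := r * lin ζ j b) fun t => ?_
        have : lin ζ j (v (0, t)) - r * lin ζ j b = r * (ε * circ t * lin ζ j D) := by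
          rw [ev, hP j hjS, circ_zero]; ring
        rw [this, norm_mul (r : ℂ), norm_mul (r : ℂ), nε]
        exact mul_lt_mul_of_pos_left (hε j hj) (norm_pos_iff.2 hr0')
      · refine windsBy_of_close hcont (by simp only [v, circ_zero, circ_one])
          (K := lin ζ j P) fun t => ?_
        rw [ev, add_sub_cancel_left]
        exact far j hjS (0, t)
  have ws : ∀ j, WindsBy (fun s => lin ζ j (v (s, 0))) (if j ∈ S then 1 else 0) := by
    intro j
    have hcont : Continuous fun t => lin ζ j (v (t, 0)) :=
      (continuous_lin ζ j).comp (hv.comp (by fun_prop))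
    split_ifs with hj
    · have : (fun t => lin ζ j (v (t, 0)))
          = fun t => ((r : ℂ) * (lin ζ j b + ε * circ 0 * lin ζ j D)) * circ t := by
        ext t
        rw [ev, hP j hj]; ring
      rw [this]
      exact wcirc (mul_ne_zero hr0' (inner j 0))
    · refine windsBy_of_close hcont (by simp only [v, circ_zero, circ_one])
        (K := lin ζ j P) fun t => ?_
      rw [ev, add_sub_cancel_left]
      exact far j hj (t, 0)
  have fin : ∀ (j : Fin 12) (γ : I → I × I) (n m : ℤ) (p : FundamentalGroup (ChartCompl ζ) x),
      WindsBy (fun t => lin ζ j (v (γ t))) n → WindsBy (fun t => lin ζ 11 (v (γ t))) m →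
      holQ (isLocalCocycle_chartWind hζ j) (FundamentalGroup.toPath p)
        = hol (chartWind ζ j) (fun t => T (γ t)) → windNum hζ j p = n - m := by
    intro j γ n m p hn hm h
    have e : (windNum hζ j p : ℂ) = ((n - m : ℤ) : ℂ) := by
      rw [windNum_eq, h]
      refine hol_wind_of_windsBy (ℓ := chartForm ζ j) ?_ fun _ _ => rfl
      simpa only [hform] using hn.div hm
    exact_mod_cast e
  exact ⟨p, q, hpq, fun j => fin j _ _ _ p (wt j) (wt 11) (hw _ _).1,
    fun j => fin j _ _ _ q (ws j) (ws 11) (hw _ _).2⟩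

/-- The multiple points of the arrangement. -/
def points : Fin 27 → Finset (Fin 12) :=
  ![{0, 3, 4, 8, 11}, {0, 1, 5, 9}, {1, 2, 4, 6}, {1, 7, 10, 11}, {2, 3, 5, 7},
    {0, 6, 10}, {2, 8, 10}, {3, 9, 10}, {4, 7, 9}, {5, 6, 8},
    {0, 2}, {0, 7}, {1, 3}, {1, 8}, {2, 9}, {2, 11}, {3, 6}, {4, 5}, {4, 10}, {5, 10}, {5, 11},
    {6, 7}, {6, 9}, {6, 11}, {7, 8}, {8, 9}, {9, 11}]

/-- Two of the lines through each of the multiple points. -/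
def pointPair : Fin 27 → Fin 12 × Fin 12 :=
  ![(0, 3), (0, 1), (1, 2), (1, 7), (2, 3), (0, 6), (2, 8), (3, 9), (4, 7), (5, 6),
    (0, 2), (0, 7), (1, 3), (1, 8), (2, 9), (2, 11), (3, 6), (4, 5), (4, 10), (5, 10), (5, 11),
    (6, 7), (6, 9), (6, 11), (7, 8), (8, 9), (9, 11)]

theorem exists_commute_of_mem_points (hζ : 1 + ζ + ζ ^ 2 + ζ ^ 3 + ζ ^ 4 = 0) (x : ChartCompl ζ)
    (k : Fin 27) (i : Fin 12) (hi : i ∈ points k) :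
    ∃ p q : FundamentalGroup (ChartCompl ζ) x, Commute p q ∧
      (∀ j, windNum hζ j p = (if j = i then 1 else 0) - (if 11 = i then 1 else 0)) ∧
      ∀ j, windNum hζ j q = (if j ∈ points k then 1 else 0)
        - (if 11 ∈ points k then 1 else 0) := by
  have h1 : ∀ k : Fin 27, ∀ j, (j ∈ points k ∧ Cyc.dot (Cyc.line j)
      (Cyc.cross (Cyc.line (pointPair k).1) (Cyc.line (pointPair k).2)) = 0) ∨
      (j ∉ points k ∧ Cyc.NeZero (Cyc.dot (Cyc.line j)
      (Cyc.cross (Cyc.line (pointPair k).1) (Cyc.line (pointPair k).2)))) := by decide +kernel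
  have h2 : ∀ i j : Fin 12, (j = i ∧ Cyc.dot (Cyc.line j)
      (Cyc.cross (Cyc.line i) ![(1, 0, 0, 0), (1, 0, 0, 0), (1, 0, 0, 0)]) = 0) ∨
      (j ≠ i ∧ Cyc.NeZero (Cyc.dot (Cyc.line j)
      (Cyc.cross (Cyc.line i) ![(1, 0, 0, 0), (1, 0, 0, 0), (1, 0, 0, 0)]))) := by decide +kernel
  have h3 : ∀ j : Fin 12, Cyc.NeZero (Cyc.dot (Cyc.line j)
      ![(2, 0, 0, 0), (1, 0, 0, 0), (0, 0, 0, 0)]) := by decide +kernel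
  refine exists_commute_windNum hζ x hi
    (P := fun l => Cyc.ev ζ (Cyc.cross (Cyc.line (pointPair k).1) (Cyc.line (pointPair k).2) l))
    (b := fun l => Cyc.ev ζ
      (Cyc.cross (Cyc.line i) ![(1, 0, 0, 0), (1, 0, 0, 0), (1, 0, 0, 0)] l))
    (D := fun l => Cyc.ev ζ ((![(2, 0, 0, 0), (1, 0, 0, 0), (0, 0, 0, 0)] : Fin 3 → Cyc) l))
    (fun j hj => ?_) (fun j hj => ?_) ?_ (fun j hj => ?_) (fun j => ?_) <;> rw [lin_ev hζ]
  · rw [((h1 k j).resolve_right fun h => h.1 hj).2, Cyc.ev_zero]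
  · exact Cyc.ev_ne_zero hζ ((h1 k j).resolve_left fun h => hj h.1).2
  · rw [((h2 i i).resolve_right fun h => h.1 rfl).2, Cyc.ev_zero]
  · exact Cyc.ev_ne_zero hζ ((h2 i j).resolve_left fun h => hj h.1).2
  · exact Cyc.ev_ne_zero hζ (h3 j)

end ChartWinding

section Pencils

/-- Pencils of conics in the span of the arrangement: each row `i, i', j, j', m, m'` encodes a
linear relation between the three products `ℓᵢ ℓᵢ'`, `ℓⱼ ℓⱼ'` and `ℓₘ ℓₘ'`. -/
def pencil : Fin 34 → Fin 6 → Fin 12 :=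
  ![![0, 7, 1, 3, 5, 11],
    ![0, 10, 1, 3, 9, 11],
    ![0, 6, 1, 8, 4, 5],
    ![0, 1, 4, 10, 6, 11],
    ![0, 7, 1, 4, 9, 11],
    ![0, 2, 4, 10, 6, 8],
    ![1, 8, 2, 11, 4, 10],
    ![2, 8, 3, 6, 4, 5],
    ![2, 11, 3, 10, 7, 8],
    ![3, 7, 4, 10, 9, 11],
    ![0, 11, 1, 11, 5, 11],
    ![0, 11, 1, 11, 9, 11],
    ![0, 11, 3, 11, 11, 11],
    ![0, 11, 4, 11, 8, 11],
    ![0, 11, 4, 11, 11, 11],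
    ![0, 11, 6, 11, 10, 11],
    ![1, 11, 2, 11, 4, 11],
    ![1, 11, 4, 11, 6, 11],
    ![1, 11, 7, 11, 11, 11],
    ![1, 11, 10, 11, 11, 11],
    ![2, 11, 3, 11, 5, 11],
    ![2, 11, 3, 11, 7, 11],
    ![2, 11, 4, 11, 6, 11],
    ![2, 11, 8, 11, 10, 11],
    ![3, 11, 4, 11, 8, 11],
    ![3, 11, 4, 11, 11, 11],
    ![3, 11, 5, 11, 7, 11],
    ![3, 11, 8, 11, 11, 11],
    ![3, 11, 9, 11, 10, 11],
    ![4, 11, 7, 11, 9, 11],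
    ![4, 11, 8, 11, 11, 11],
    ![5, 11, 6, 11, 8, 11],
    ![7, 11, 10, 11, 11, 11],
    ![0, 11, 5, 11, 9, 11]]

/-- The coefficients `c₀, c₁, c₂` of the relations `c₀ ℓᵢ ℓᵢ' + c₁ ℓⱼ ℓⱼ' = c₂ ℓₘ ℓₘ'`. -/
def pencilCoeff : Fin 34 → Fin 3 → Cyc :=
  ![![(0, 1, 1, 1), (0, -1, -1, -1), (1, 0, 0, 0)],
    ![(2, 1, 1, 1), (-5, -5, -5, -5), (5, 0, 0, 0)],
    ![(1, 0, 1, 0), (-1, 0, -1, 0), (1, 0, 0, 0)],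
    ![(5, 0, 0, 0), (0, 2, 2, 1), (5, 0, 0, 0)],
    ![(1, 0, 0, 0), (1, 1, 1, 1), (1, 0, 0, 0)],
    ![(5, 0, 0, 0), (1, 2, 2, 0), (5, 0, 0, 0)],
    ![(3, 1, -1, 2), (-3, -1, 1, -2), (1, 0, 0, 0)],
    ![(1, 0, 0, 1), (-1, 0, 0, -1), (1, 0, 0, 0)],
    ![(-5, -5, -5, -5), (2, 1, 1, 1), (5, 0, 0, 0)],
    ![(5, 0, 0, 0), (2, 1, 1, 1), (5, 0, 0, 0)],
    ![(-1, 0, 0, 0), (1, 0, 0, 0), (1, 0, 0, 0)],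
    ![(1, 1, 0, 1), (0, -1, 0, -1), (1, 0, 0, 0)],
    ![(1, 1, 1, 1), (0, -1, -1, -1), (1, 0, 0, 0)],
    ![(1, 0, 0, 0), (0, 1, 1, 0), (1, 0, 0, 0)],
    ![(1, 0, 0, 0), (0, 1, 1, 1), (1, 0, 0, 0)],
    ![(3, 1, -1, 2), (2, -1, 1, -2), (1, 0, 0, 0)],
    ![(1, 0, 0, 0), (-1, 0, 0, 0), (1, 0, 0, 0)],
    ![(1, 0, 0, 0), (0, 1, 1, 0), (1, 0, 0, 0)],
    ![(1, 1, 1, 1), (0, -1, -1, -1), (1, 0, 0, 0)],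
    ![(0, 0, 0, 5), (1, 0, 0, -1), (5, 0, 0, 0)],
    ![(1, 0, 0, 0), (-1, 0, 0, 0), (1, 0, 0, 0)],
    ![(0, -1, 0, -1), (1, 1, 0, 1), (1, 0, 0, 0)],
    ![(1, 0, 0, 0), (1, 1, 1, 0), (1, 0, 0, 0)],
    ![(2, -1, 1, -2), (3, 1, -1, 2), (1, 0, 0, 0)],
    ![(1, 0, 0, 0), (1, 1, 1, 0), (1, 0, 0, 0)],
    ![(1, 0, 0, 0), (1, 1, 1, 1), (1, 0, 0, 0)],
    ![(1, 0, 0, 0), (0, -1, 0, -1), (1, 0, 0, 0)],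
    ![(0, -1, 0, -1), (1, 1, 0, 1), (1, 0, 0, 0)],
    ![(1, -3, -2, -1), (4, 3, 2, 1), (1, 0, 0, 0)],
    ![(1, 0, 0, 0), (1, 0, 0, 0), (1, 0, 0, 0)],
    ![(0, 0, 0, 1), (1, 0, 0, 0), (1, 0, 0, 0)],
    ![(-1, 0, 0, 0), (1, 0, 0, 0), (1, 0, 0, 0)],
    ![(-5, -5, -5, -5), (2, 1, 1, 1), (5, 0, 0, 0)],
    ![(1, 0, 0, 0), (0, -1, 0, -1), (1, 0, 0, 0)]]

/-- The divisor of `c₀ ℓᵢ ℓᵢ' / (c₂ ℓₘ ℓₘ')`. -/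
def pencilZero (k : Fin 34) (j : Fin 12) : ℤ :=
  (if j = pencil k 0 then 1 else 0) + (if j = pencil k 1 then 1 else 0)
    - (if j = pencil k 4 then 1 else 0) - (if j = pencil k 5 then 1 else 0)

/-- The divisor of `c₁ ℓⱼ ℓⱼ' / (c₂ ℓₘ ℓₘ')`. -/
def pencilOne (k : Fin 34) (j : Fin 12) : ℤ :=
  (if j = pencil k 2 then 1 else 0) + (if j = pencil k 3 then 1 else 0)
    - (if j = pencil k 4 then 1 else 0) - (if j = pencil k 5 then 1 else 0)

/-- Relations between the pencils, as formal combinations. -/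
def pencilRel : Fin 11 → Fin 5 → Fin 34 × ℤ :=
  ![![(0, 1), (12, -1), (10, -1), (18, 1), (26, -1)],
    ![(1, 1), (12, -1), (11, -1), (19, 1), (28, -1)],
    ![(2, 1), (13, 1), (10, -1), (17, -1), (31, -1)],
    ![(3, 1), (14, -1), (17, -1), (19, -1), (15, 1)],
    ![(4, 1), (14, -1), (11, -1), (18, 1), (29, 1)],
    ![(5, 1), (13, -1), (22, -1), (15, 1), (23, 1)],
    ![(6, 1), (30, -1), (16, -1), (19, 1), (23, 1)],
    ![(7, 1), (24, -1), (22, 1), (20, -1), (31, 1)],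
    ![(8, 1), (27, -1), (32, 1), (21, -1), (23, 1)],
    ![(9, 1), (25, -1), (32, -1), (28, 1), (29, 1)],
    ![(24, 1), (25, -1), (27, 1), (30, -1), (0, 0)]]

theorem pencilRel_eq_zero (R : Fin 11) (i j : Fin 12) :
    ∑ l, (pencilRel R l).2 * (pencilZero (pencilRel R l).1 i * pencilOne (pencilRel R l).1 j
      - pencilZero (pencilRel R l).1 j * pencilOne (pencilRel R l).1 i) = 0 := by
  revert R i j
  decide +kernel

theorem sum_pencilZero (k : Fin 34) : ∑ j, pencilZero k j = 0 := by
  revert k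
  decide +kernel

theorem sum_pencilOne (k : Fin 34) : ∑ j, pencilOne k j = 0 := by
  revert k
  decide +kernel

theorem sum_pencilRel (R : Fin 11) (v w : Fin 12 → ℂ) :
    ∑ l, ((pencilRel R l).2 : ℂ) *
      ((∑ j, (pencilZero (pencilRel R l).1 j : ℂ) * v j)
          * (∑ j, (pencilOne (pencilRel R l).1 j : ℂ) * w j)
        - (∑ j, (pencilZero (pencilRel R l).1 j : ℂ) * w j)
          * (∑ j, (pencilOne (pencilRel R l).1 j : ℂ) * v j)) = 0 := by
  have h : ∀ l, ((pencilRel R l).2 : ℂ) *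
      ((∑ j, (pencilZero (pencilRel R l).1 j : ℂ) * v j)
          * (∑ j, (pencilOne (pencilRel R l).1 j : ℂ) * w j)
        - (∑ j, (pencilZero (pencilRel R l).1 j : ℂ) * w j)
          * (∑ j, (pencilOne (pencilRel R l).1 j : ℂ) * v j))
      = ∑ i, ∑ j, (((pencilRel R l).2 * (pencilZero (pencilRel R l).1 i
        * pencilOne (pencilRel R l).1 j - pencilZero (pencilRel R l).1 j
          * pencilOne (pencilRel R l).1 i) : ℤ) : ℂ) * (v i * w j) := by
    intro l
    rw [Finset.sum_mul_sum, mul_comm (∑ j, (pencilZero (pencilRel R l).1 j : ℂ) * w j),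
      Finset.sum_mul_sum, ← Finset.sum_sub_distrib, Finset.mul_sum]
    refine Finset.sum_congr rfl fun i _ => ?_
    rw [← Finset.sum_sub_distrib, Finset.mul_sum]
    refine Finset.sum_congr rfl fun j _ => ?_
    push_cast
    ring
  rw [Finset.sum_congr rfl fun l _ => h l, Finset.sum_comm]
  refine Finset.sum_eq_zero fun i _ => ?_
  rw [Finset.sum_comm]
  refine Finset.sum_eq_zero fun j _ => ?_
  rw [← Finset.sum_mul, ← Int.cast_sum, pencilRel_eq_zero, Int.cast_zero, zero_mul]

theorem prod_zpow_pencilZero (k : Fin 34) {f : Fin 12 → ℂ} (hf : ∀ j, f j ≠ 0) :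
    ∏ j, f j ^ pencilZero k j
      = f (pencil k 0) * f (pencil k 1) / (f (pencil k 4) * f (pencil k 5)) := by
  have h : ∀ j, f j ^ pencilZero k j = (if j = pencil k 0 then f j else 1)
      * (if j = pencil k 1 then f j else 1) / (if j = pencil k 4 then f j else 1)
      / (if j = pencil k 5 then f j else 1) := fun j => by
    rw [pencilZero, zpow_sub₀ (hf j), zpow_sub₀ (hf j), zpow_add₀ (hf j)]
    congr 2
    on_goal 1 => congr 1
    all_goals split_ifs <;> simp
  simp only [h, Finset.prod_div_distrib, Finset.prod_mul_distrib, Finset.prod_ite_eq',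
    Finset.mem_univ, if_true, div_div]

theorem prod_zpow_pencilOne (k : Fin 34) {f : Fin 12 → ℂ} (hf : ∀ j, f j ≠ 0) :
    ∏ j, f j ^ pencilOne k j
      = f (pencil k 2) * f (pencil k 3) / (f (pencil k 4) * f (pencil k 5)) := by
  have h : ∀ j, f j ^ pencilOne k j = (if j = pencil k 2 then f j else 1)
      * (if j = pencil k 3 then f j else 1) / (if j = pencil k 4 then f j else 1)
      / (if j = pencil k 5 then f j else 1) := fun j => by
    rw [pencilOne, zpow_sub₀ (hf j), zpow_sub₀ (hf j), zpow_add₀ (hf j)]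
    congr 2
    on_goal 1 => congr 1
    all_goals split_ifs <;> simp
  simp only [h, Finset.prod_div_distrib, Finset.prod_mul_distrib, Finset.prod_ite_eq',
    Finset.mem_univ, if_true, div_div]

variable {ζ : ℂ}

theorem pencilCoeff_ne_zero (hζ : 1 + ζ + ζ ^ 2 + ζ ^ 3 + ζ ^ 4 = 0) (k : Fin 34) (r : Fin 3) :
    Cyc.ev ζ (pencilCoeff k r) ≠ 0 := by
  refine Cyc.ev_ne_zero hζ ?_
  revert k r
  decide +kernel

/-- A coefficient of the symmetric bilinear form attached to a product of two lines. -/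
def Cyc.lineMul (i j : Fin 12) (r s : Fin 3) : Cyc :=
  mul (line i r) (line j s) + mul (line i s) (line j r)

theorem lin_mul_lin (hζ : 1 + ζ + ζ ^ 2 + ζ ^ 3 + ζ ^ 4 = 0) (i j : Fin 12) (v : Fin 3 → ℂ) :
    2 * (lin ζ i v * lin ζ j v) = ∑ r, ∑ s, Cyc.ev ζ (Cyc.lineMul i j r s) * (v r * v s) := by
  simp only [lin, Fin.sum_univ_three, coeffs_eq_ev hζ, Cyc.lineMul, Cyc.ev_add, Cyc.ev_mul hζ]
  ring

theorem pencil_relation (hζ : 1 + ζ + ζ ^ 2 + ζ ^ 3 + ζ ^ 4 = 0) (k : Fin 34) (v : Fin 3 → ℂ) :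
    Cyc.ev ζ (pencilCoeff k 0) * (lin ζ (pencil k 0) v * lin ζ (pencil k 1) v)
      + Cyc.ev ζ (pencilCoeff k 1) * (lin ζ (pencil k 2) v * lin ζ (pencil k 3) v)
      = Cyc.ev ζ (pencilCoeff k 2) * (lin ζ (pencil k 4) v * lin ζ (pencil k 5) v) := by
  have h : ∀ k : Fin 34, ∀ r s,
      Cyc.mul (pencilCoeff k 0) (Cyc.lineMul (pencil k 0) (pencil k 1) r s)
        + Cyc.mul (pencilCoeff k 1) (Cyc.lineMul (pencil k 2) (pencil k 3) r s)
        - Cyc.mul (pencilCoeff k 2) (Cyc.lineMul (pencil k 4) (pencil k 5) r s) = 0 := by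
    decide +kernel
  refine mul_left_cancel₀ two_ne_zero (sub_eq_zero.1 ?_)
  rw [mul_add, mul_left_comm, mul_left_comm 2 (Cyc.ev ζ (pencilCoeff k 1)),
    mul_left_comm 2 (Cyc.ev ζ (pencilCoeff k 2)), lin_mul_lin hζ, lin_mul_lin hζ, lin_mul_lin hζ]
  simp only [Finset.mul_sum, ← Finset.sum_add_distrib, ← Finset.sum_sub_distrib]
  refine Finset.sum_eq_zero fun r _ => Finset.sum_eq_zero fun s _ => ?_
  have h1 := congrArg (Cyc.ev ζ) (h k r s)
  rw [Cyc.ev_sub, Cyc.ev_add, Cyc.ev_mul hζ, Cyc.ev_mul hζ, Cyc.ev_mul hζ, Cyc.ev_zero] at h1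
  linear_combination (v r * v s) * h1

/-- The pencil as a function of the homogeneous coordinates. -/
noncomputable def pencilFun (ζ : ℂ) (k : Fin 34) (v : Fin 3 → ℂ) : ℂ :=
  Cyc.ev ζ (pencilCoeff k 0) / Cyc.ev ζ (pencilCoeff k 2) * ∏ j, lin ζ j v ^ pencilZero k j

theorem one_sub_pencilFun (hζ : 1 + ζ + ζ ^ 2 + ζ ^ 3 + ζ ^ 4 = 0) (k : Fin 34) {v : Fin 3 → ℂ}
    (hv : ∀ j, lin ζ j v ≠ 0) :
    1 - pencilFun ζ k v = Cyc.ev ζ (pencilCoeff k 1) / Cyc.ev ζ (pencilCoeff k 2)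
      * ∏ j, lin ζ j v ^ pencilOne k j := by
  rw [pencilFun, prod_zpow_pencilZero k hv, prod_zpow_pencilOne k hv]
  have h := pencil_relation hζ k v
  have h2 := pencilCoeff_ne_zero hζ k 2
  have h4 := hv (pencil k 4)
  have h5 := hv (pencil k 5)
  field_simp
  linear_combination -h

theorem pencilFun_ne_zero (hζ : 1 + ζ + ζ ^ 2 + ζ ^ 3 + ζ ^ 4 = 0) (k : Fin 34) {v : Fin 3 → ℂ}
    (hv : ∀ j, lin ζ j v ≠ 0) : pencilFun ζ k v ≠ 0 :=
  mul_ne_zero (div_ne_zero (pencilCoeff_ne_zero hζ k 0) (pencilCoeff_ne_zero hζ k 2))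
    (Finset.prod_ne_zero_iff.2 fun j _ => zpow_ne_zero _ (hv j))

theorem one_sub_pencilFun_ne_zero (hζ : 1 + ζ + ζ ^ 2 + ζ ^ 3 + ζ ^ 4 = 0) (k : Fin 34)
    {v : Fin 3 → ℂ} (hv : ∀ j, lin ζ j v ≠ 0) : 1 - pencilFun ζ k v ≠ 0 := by
  rw [one_sub_pencilFun hζ k hv]
  exact mul_ne_zero (div_ne_zero (pencilCoeff_ne_zero hζ k 1) (pencilCoeff_ne_zero hζ k 2))
    (Finset.prod_ne_zero_iff.2 fun j _ => zpow_ne_zero _ (hv j))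

/-- The map to the twice punctured plane defined by a pencil. -/
noncomputable def pencilMap (hζ : 1 + ζ + ζ ^ 2 + ζ ^ 3 + ζ ^ 4 = 0) (k : Fin 34)
    (y : ChartCompl ζ) : TwicePunctured :=
  ⟨pencilFun ζ k (chartPt ζ y), pencilFun_ne_zero hζ k (chartForm_ne_zero hζ · y),
    fun h => one_sub_pencilFun_ne_zero hζ k (chartForm_ne_zero hζ · y) (by rw [h, sub_self])⟩

theorem continuous_pencilMap (hζ : 1 + ζ + ζ ^ 2 + ζ ^ 3 + ζ ^ 4 = 0) (k : Fin 34) :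
    Continuous (pencilMap hζ k) := by
  refine Continuous.subtype_mk (continuous_const.mul (continuous_finsetProd _ fun j _ => ?_)) _
  exact (continuous_chartForm j).zpow₀ _ fun y => .inl (chartForm_ne_zero hζ j y)

end Pencils

section Linked

theorem hasDerivAt_prod_zpow {ι : Type*} (s : Finset ι) {f : ι → ℂ → ℂ} {f' : ι → ℂ} (n : ι → ℤ)
    {t : ℂ} (hf : ∀ j, HasDerivAt (f j) (f' j) t) (h0 : ∀ j, f j t ≠ 0) :
    HasDerivAt (fun t => ∏ j ∈ s, f j t ^ n j)
      ((∏ j ∈ s, f j t ^ n j) * ∑ j ∈ s, (n j : ℂ) * (f' j / f j t)) t := by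
  classical
  induction s using Finset.induction_on with
  | empty => simpa using hasDerivAt_const t (1 : ℂ)
  | insert j s hj ih =>
    simp only [Finset.prod_insert hj, Finset.sum_insert hj]
    have h1 := ((hasDerivAt_zpow (n j) (f j t) (.inl (h0 j))).comp t (hf j)).mul ih
    refine h1.congr_deriv ?_
    have h2 := h0 j
    rw [zpow_sub_one₀ h2]
    simp only [Function.comp]
    field_simp

theorem IsLocalCocycle.pi {X ι : Type*} [TopologicalSpace X] [Finite ι] {Γ : ι → Type*}
    [∀ i, Group (Γ i)] {c : ∀ i, X → X → Γ i} (hc : ∀ i, IsLocalCocycle (c i)) :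
    IsLocalCocycle fun x y i => c i x y := fun x => by
  choose U hU h using fun i => hc i x
  exact ⟨⋂ i, U i, Filter.iInter_mem.2 hU, fun y hy z hz w hw => funext fun i =>
    h i y (Set.mem_iInter.1 hy i) z (Set.mem_iInter.1 hz i) w (Set.mem_iInter.1 hw i)⟩

theorem IsLocalCocycle.prodMk {X Γ Δ : Type*} [TopologicalSpace X] [Group Γ] [Group Δ]
    {c : X → X → Γ} {d : X → X → Δ} (hc : IsLocalCocycle c) (hd : IsLocalCocycle d) :
    IsLocalCocycle fun x y => (c x y, d x y) := fun x => by
  obtain ⟨U, hU, h⟩ := hc x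
  obtain ⟨V, hV, h'⟩ := hd x
  exact ⟨U ∩ V, Filter.inter_mem hU hV, fun y hy z hz w hw =>
    Prod.ext (h y hy.1 z hz.1 w hw.1) (h' y hy.2 z hz.2 w hw.2)⟩

/-- The group of holonomies compatible with the pencils and their relations. -/
def linked : Subgroup ((Fin 34 → Unip) × (Fin 12 → Multiplicative ℂ)) where
  carrier := {x | (∀ k, (x.1 k).a = ∑ j, (pencilZero k j : ℂ) * (x.2 j).toAdd) ∧
    (∀ k, (x.1 k).b = ∑ j, (pencilOne k j : ℂ) * (x.2 j).toAdd) ∧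
    ∀ R, ∑ l, ((pencilRel R l).2 : ℂ) * (x.1 (pencilRel R l).1).s = 0}
  one_mem' := by simp [Unip.s]
  mul_mem' := by
    rintro x y ⟨hxa, hxb, hx⟩ ⟨hya, hyb, hy⟩
    refine ⟨fun k => ?_, fun k => ?_, fun R => ?_⟩
    · simp [hxa, hya, mul_add, Finset.sum_add_distrib]
    · simp [hxb, hyb, mul_add, Finset.sum_add_distrib]
    · have h := sum_pencilRel R (fun j => (x.2 j).toAdd) fun j => (y.2 j).toAdd
      simp only [← hxa, ← hxb, ← hya, ← hyb] at h
      simp only [Prod.fst_mul, Pi.mul_apply, Unip.s_mul, mul_add, Finset.sum_add_distrib, hx, hy,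
        zero_add]
      rw [← zero_div 2, ← h, Finset.sum_div]
      refine Finset.sum_congr rfl fun l _ => by ring
  inv_mem' := by
    rintro x ⟨hxa, hxb, hx⟩
    refine ⟨fun k => ?_, fun k => ?_, fun R => ?_⟩
    · simp [hxa]
    · simp [hxb]
    · have h : ∀ k, ((x⁻¹).1 k).s = - (x.1 k).s := fun k => by
        simp [Unip.s]; ring
      simp only [h, mul_neg, Finset.sum_neg_distrib, hx, neg_zero]

theorem mem_linked_of_hasDerivAt {U : Set ℂ} (hU : IsOpen U) (hc : IsPreconnected U)
    (h0 : 0 ∈ U) {W W' : Fin 12 → ℂ → ℂ} {X : Fin 34 → ℂ → Unip}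
    (hW : ∀ j, ∀ t ∈ U, HasDerivAt (W j) (W' j t) t) (hW0 : ∀ j, W j 0 = 0)
    (ha : ∀ k, ∀ t ∈ U, HasDerivAt (fun t => (X k t).a) (∑ j, (pencilZero k j : ℂ) * W' j t) t)
    (hb : ∀ k, ∀ t ∈ U, HasDerivAt (fun t => (X k t).b) (∑ j, (pencilOne k j : ℂ) * W' j t) t)
    (hg : ∀ k, ∀ t ∈ U, HasDerivAt (fun t => (X k t).g)
      ((X k t).a * ∑ j, (pencilOne k j : ℂ) * W' j t) t)
    (hX0 : ∀ k, X k 0 = 1) {t : ℂ} (ht : t ∈ U) :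
    (((fun k => X k t), fun j => Multiplicative.ofAdd (W j t)) :
      (Fin 34 → Unip) × (Fin 12 → Multiplicative ℂ)) ∈ linked := by
  have ea : ∀ k, ∀ t ∈ U, (X k t).a = ∑ j, (pencilZero k j : ℂ) * W j t := fun k =>
    eqOn_of_hasDerivAt hU hc (ha k) (fun t ht => HasDerivAt.fun_sum fun j _ =>
      (hW j t ht).const_mul _) h0 (by simp [hX0, hW0])
  have eb : ∀ k, ∀ t ∈ U, (X k t).b = ∑ j, (pencilOne k j : ℂ) * W j t := fun k =>
    eqOn_of_hasDerivAt hU hc (hb k) (fun t ht => HasDerivAt.fun_sum fun j _ =>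
      (hW j t ht).const_mul _) h0 (by simp [hX0, hW0])
  refine ⟨fun k => ea k t ht, fun k => eb k t ht, fun R => ?_⟩
  refine eqOn_of_hasDerivAt (F := fun t => ∑ l, ((pencilRel R l).2 : ℂ) *
    (X (pencilRel R l).1 t).s) (G := fun _ => 0) (F' := fun _ => 0) hU hc (fun t ht => ?_)
    (fun t _ => hasDerivAt_const t 0) h0 (by simp [hX0, Unip.s]) ht
  have h1 : ∀ k, HasDerivAt (fun t => (X k t).s) (((X k t).a * (∑ j, (pencilOne k j : ℂ) * W' j t)
      - (∑ j, (pencilZero k j : ℂ) * W' j t) * (X k t).b) / 2) t := fun k => by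
    refine ((hg k t ht).sub (((ha k t ht).mul (hb k t ht)).div_const 2)).congr_deriv ?_
    ring
  refine (HasDerivAt.fun_sum fun l _ => (h1 (pencilRel R l).1).const_mul
    ((pencilRel R l).2 : ℂ)).congr_deriv ?_
  have h2 := sum_pencilRel R (fun j => W j t) (fun j => W' j t)
  simp only [← ea _ t ht, ← eb _ t ht] at h2
  rw [← zero_div 2, ← h2, Finset.sum_div]
  exact Finset.sum_congr rfl fun l _ => by ring

variable {ζ : ℂ}

/-- The cocycle of all pencils and all windings. -/
noncomputable def totalCocycle (hζ : 1 + ζ + ζ ^ 2 + ζ ^ 3 + ζ ^ 4 = 0) (y z : ChartCompl ζ) :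
    (Fin 34 → Unip) × (Fin 12 → Multiplicative ℂ) :=
  (fun k => TwicePunctured.cocycle (pencilMap hζ k y) (pencilMap hζ k z),
    fun j => chartWind ζ j y z)

theorem isLocalCocycle_totalCocycle (hζ : 1 + ζ + ζ ^ 2 + ζ ^ 3 + ζ ^ 4 = 0) :
    IsLocalCocycle (totalCocycle hζ) :=
  .prodMk (.pi fun k => TwicePunctured.isLocalCocycle_cocycle.comp (continuous_pencilMap hζ k))
    (.pi fun j => isLocalCocycle_chartWind hζ j)

theorem hasDerivAt_lin_chartPt (j : Fin 12) (y v : ℂ × ℂ) (t : ℂ) :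
    HasDerivAt (fun t : ℂ => lin ζ j (chartPt ζ (y + t • v)))
      (v.2 * lin ζ j (frame ζ 1) + v.1 * lin ζ j (frame ζ 2)) t := by
  simp only [chartPt, lin_add, lin_smul, Prod.fst_add, Prod.snd_add, Prod.smul_fst, Prod.smul_snd,
    smul_eq_mul]
  have h := fun a : ℂ => (((hasDerivAt_id t).mul_const a))
  refine (((((h v.2).const_add y.2).mul_const _).add
    (((h v.1).const_add y.1).mul_const _)).const_add _).congr_deriv ?_
  ring

theorem totalCocycle_mem_linked (hζ : 1 + ζ + ζ ^ 2 + ζ ^ 3 + ζ ^ 4 = 0) (x : ChartCompl ζ) :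
    ∃ U ∈ 𝓝 x, ∀ y ∈ U, ∀ z ∈ U, totalCocycle hζ y z ∈ linked := by
  have hk : ∀ k, ∀ᶠ y in 𝓝 x, (pencilMap hζ k y : ℂ) ∈ Metric.ball (pencilMap hζ k x : ℂ)
      (TwicePunctured.rad (pencilMap hζ k x) / 3) := fun k =>
    (continuous_subtype_val.comp (continuous_pencilMap hζ k)).continuousAt.eventually_mem
      (Metric.ball_mem_nhds _ (by have := TwicePunctured.rad_pos (pencilMap hζ k x); positivity))
  have hj : ∀ j, ∀ᶠ p in 𝓝 (x, x), chartForm ζ j p.2 / chartForm ζ j p.1 ∈ Complex.slitPlane :=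
    fun j => by
    refine ContinuousAt.eventually_mem (f := fun p : ChartCompl ζ × ChartCompl ζ =>
      chartForm ζ j p.2 / chartForm ζ j p.1) ?_ (Complex.isOpen_slitPlane.mem_nhds ?_)
    · exact (((continuous_chartForm j).comp continuous_snd).div
        ((continuous_chartForm j).comp continuous_fst)
        fun p => chartForm_ne_zero hζ j p.1).continuousAt
    · rw [div_self (chartForm_ne_zero hζ j x)]
      exact Complex.one_mem_slitPlane
  have hj' := Filter.eventually_all.2 hj
  rw [nhds_prod_eq, Filter.eventually_prod_self_iff (r := fun y z => ∀ j,
    chartForm ζ j z / chartForm ζ j y ∈ Complex.slitPlane)] at hj'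
  obtain ⟨V, hV, hV'⟩ := hj'
  obtain ⟨N, hN, hNV⟩ := mem_nhds_subtype _ _ _ |>.1
    (Filter.inter_mem hV (Filter.eventually_all.2 hk))
  obtain ⟨r, hr, hrN⟩ := Metric.mem_nhds_iff.1
    (Filter.inter_mem hN (isOpen_fibCompl.mem_nhds x.2))
  have hB : ∀ p (hp : p ∈ Metric.ball (x : ℂ × ℂ) r), p ∈ ChartCompl ζ := fun p hp => (hrN hp).2
  have hBN : ∀ y : ChartCompl ζ, (y : ℂ × ℂ) ∈ Metric.ball (x : ℂ × ℂ) r → y ∈ V ∧ ∀ k, _ :=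
    fun y hy => hNV (hrN hy).1
  refine ⟨Subtype.val ⁻¹' Metric.ball (x : ℂ × ℂ) r,
    continuous_subtype_val.continuousAt (Metric.ball_mem_nhds _ hr), fun y hy z hz => ?_⟩
  have hline : Continuous fun t : ℂ => (y : ℂ × ℂ) + t • ((z : ℂ × ℂ) - y) := by fun_prop
  set U : Set ℂ := (fun t : ℂ => (y : ℂ × ℂ) + t • ((z : ℂ × ℂ) - y)) ⁻¹'
    Metric.ball (x : ℂ × ℂ) r
  have hU : IsOpen U := Metric.isOpen_ball.preimage hline
  have hconv : Convex ℝ U := by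
    intro a ha b hb c d hc hd hcd
    have h := convex_ball (x : ℂ × ℂ) r ha hb hc hd hcd
    change (y : ℂ × ℂ) + (c • a + d • b) • ((z : ℂ × ℂ) - y) ∈ Metric.ball (x : ℂ × ℂ) r
    convert h using 1
    obtain rfl : d = 1 - c := by linarith
    ext <;> simp <;> ring
  have h0 : (0 : ℂ) ∈ U := by
    change (y : ℂ × ℂ) + (0 : ℂ) • ((z : ℂ × ℂ) - y) ∈ Metric.ball (x : ℂ × ℂ) r
    rwa [zero_smul, add_zero]
  have h1 : (1 : ℂ) ∈ U := by
    change (y : ℂ × ℂ) + (1 : ℂ) • ((z : ℂ × ℂ) - y) ∈ Metric.ball (x : ℂ × ℂ) r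
    rwa [one_smul, add_sub_cancel]
  have hne : ∀ j, ∀ t ∈ U, lin ζ j (chartPt ζ ((y : ℂ × ℂ) + t • ((z : ℂ × ℂ) - y))) ≠ 0 :=
    fun j t ht => (mem_chartCompl hζ).1 (hB _ ht) j
  set D : Fin 12 → ℂ := fun j => ((z : ℂ × ℂ) - y).2 * lin ζ j (frame ζ 1)
    + ((z : ℂ × ℂ) - y).1 * lin ζ j (frame ζ 2)
  have hD : ∀ j t, HasDerivAt (fun t : ℂ => lin ζ j (chartPt ζ ((y : ℂ × ℂ)
    + t • ((z : ℂ × ℂ) - y)))) (D j) t := fun j t => hasDerivAt_lin_chartPt j _ _ t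
  set u : Fin 34 → ℂ → ℂ := fun k t => pencilFun ζ k (chartPt ζ ((y : ℂ × ℂ)
    + t • ((z : ℂ × ℂ) - y)))
  have hu : ∀ k, ∀ t ∈ U, HasDerivAt (u k) (u k t * ∑ j, (pencilZero k j : ℂ) *
      (D j / lin ζ j (chartPt ζ ((y : ℂ × ℂ) + t • ((z : ℂ × ℂ) - y))))) t := fun k t ht => by
    refine ((hasDerivAt_prod_zpow Finset.univ (pencilZero k) (fun j => hD j t)
      fun j => hne j t ht).const_mul _).congr_deriv ?_
    simp only [u, pencilFun]
    ring
  have hu' : ∀ k, ∀ t ∈ U, HasDerivAt (u k) (-((1 - u k t) * ∑ j, (pencilOne k j : ℂ) *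
      (D j / lin ζ j (chartPt ζ ((y : ℂ × ℂ) + t • ((z : ℂ × ℂ) - y)))))) t := fun k t ht => by
    have h := ((hasDerivAt_prod_zpow Finset.univ (pencilOne k) (fun j => hD j t)
      fun j => hne j t ht).const_mul (Cyc.ev ζ (pencilCoeff k 1) / Cyc.ev ζ (pencilCoeff k 2)))
    refine ((h.const_sub 1).congr_deriv ?_).congr_of_eventuallyEq ?_
    · simp only [u]
      rw [one_sub_pencilFun hζ k fun j => hne j t ht]
      ring
    · filter_upwards [hU.mem_nhds ht] with s hs
      rw [← one_sub_pencilFun hζ k fun j => hne j s hs]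
      ring
  have hball : ∀ k, ∀ t ∈ U, u k t ∈ Metric.ball (pencilMap hζ k y : ℂ)
      (TwicePunctured.rad (pencilMap hζ k y)) := fun k t ht =>
    TwicePunctured.ball_subset_ball ((hBN y hy).2 k) ((hBN ⟨_, hB _ ht⟩ ht).2 k)
  have hsol := fun k => TwicePunctured.isFullSol_sol (pencilMap hζ k y)
  have hune : ∀ k, ∀ t ∈ U, u k t ≠ 0 := fun k t ht =>
    pencilFun_ne_zero hζ k fun j => hne j t ht
  have hune' : ∀ k, ∀ t ∈ U, 1 - u k t ≠ 0 := fun k t ht =>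
    one_sub_pencilFun_ne_zero hζ k fun j => hne j t ht
  have key := mem_linked_of_hasDerivAt hU hconv.isPreconnected h0
    (W := fun j t => Complex.log (lin ζ j (chartPt ζ ((y : ℂ × ℂ) + t • ((z : ℂ × ℂ) - y)))
      / chartForm ζ j y) / (2 * Real.pi * Complex.I))
    (W' := fun j t => D j / lin ζ j (chartPt ζ ((y : ℂ × ℂ) + t • ((z : ℂ × ℂ) - y)))
      / (2 * Real.pi * Complex.I))
    (X := fun k t => TwicePunctured.sol (pencilMap hζ k y) (u k t))
    (fun j t ht => ?_) (fun j => ?_) (fun k t ht => ?_) (fun k t ht => ?_) (fun k t ht => ?_)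
    (fun k => ?_) h1
  · convert key using 1
    refine Prod.ext (funext fun k => ?_) (funext fun j => ?_)
    · simp [totalCocycle, TwicePunctured.cocycle, u, pencilMap]
    · simp [totalCocycle, chartWind, chartForm]
  · have hs := hV' y (hBN y hy).1 ⟨_, hB _ ht⟩ (hBN ⟨_, hB _ ht⟩ ht).1 j
    refine ((((hD j t).div_const (chartForm ζ j y)).clog hs).div_const _).congr_deriv ?_
    have e1 := hne j t ht
    have e2 := chartForm_ne_zero hζ j y
    simp only [chartForm] at e2 ⊢
    field_simp
  · have e2 := chartForm_ne_zero hζ j y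
    simp only [chartForm] at e2 ⊢
    simp [div_self e2]
  · refine (((hsol k).a _ (hball k t ht)).comp t (hu k t ht)).congr_deriv ?_
    have e := hune k t ht
    simp only [mul_div_assoc', ← Finset.sum_div]
    field_simp
  · refine (((hsol k).b _ (hball k t ht)).comp t (hu' k t ht)).congr_deriv ?_
    have e := hune' k t ht
    simp only [mul_div_assoc', ← Finset.sum_div]
    field_simp
  · refine (((hsol k).g _ (hball k t ht)).comp t (hu' k t ht)).congr_deriv ?_
    have e := hune' k t ht
    simp only [mul_div_assoc', ← Finset.sum_div]
    field_simp
  · have : u k 0 = pencilMap hζ k y := by simp [u, pencilMap]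
    rw [this, TwicePunctured.sol_self]

end Linked

section PencilModel

/-- The algebraic data on the fundamental group of the complement used to distinguish the
arrangements: winding numbers around the lines, and iterated integrals along the pencils. -/
structure PencilModel (G : Type*) [Group G] (ζ : ℂ) where
  w : Fin 12 → G → ℤ
  w_mul (j : Fin 12) (p q : G) : w j (p * q) = w j p + w j q
  exists_eq_sum (h : G → ℂ) (hh : ∀ p q, h (p * q) = h p + h q) :
    ∃ y : Fin 12 → ℂ, ∑ j, y j = 0 ∧ ∀ p, h p = ∑ j, y j * w j p
  exists_commute (k : Fin 27) (i : Fin 12) (hi : i ∈ points k) : ∃ p q : G, Commute p q ∧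
    (∀ j, w j p = (if j = i then 1 else 0) - (if 11 = i then 1 else 0)) ∧
    ∀ j, w j q = (if j ∈ points k then 1 else 0) - (if 11 ∈ points k then 1 else 0)
  a : Fin 34 → G → ℤ
  a_eq (k : Fin 34) (p : G) : a k p = ∑ j, pencilZero k j * w j p
  b : Fin 34 → G → ℤ
  b_eq (k : Fin 34) (p : G) : b k p = ∑ j, pencilOne k j * w j p
  g : Fin 34 → G → ℂ
  g_mul (k : Fin 34) (p q : G) :
    g k (p * q) = g k p + g k q - (a k p * b k q - b k p * a k q) / 2
  commute_ab (k : Fin 34) {p q : G} (h : Commute p q) : (a k p : ℂ) * b k q = a k q * b k p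
  commute_ag (k : Fin 34) {p q : G} (h : Commute p q) : (a k p : ℂ) * g k q = a k q * g k p
  commute_bg (k : Fin 34) {p q : G} (h : Commute p q) : (b k p : ℂ) * g k q = b k q * g k p
  sum_g (R : Fin 11) (p : G) : ∑ l, ((pencilRel R l).2 : ℂ) * g (pencilRel R l).1 p = 0
  v : Fin 3 → ℂ
  lin_ne_zero (j : Fin 12) : lin ζ j v ≠ 0
  exp_g (k : Fin 34) (p : G) :
    Complex.exp (2 * Real.pi * Complex.I * (g k p + a k p * b k p / 2))
      = (1 - pencilFun ζ k v) ^ a k p * pencilFun ζ k v ^ (-b k p)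

variable {ζ : ℂ}

/-- The total holonomy of a loop. -/
noncomputable def totalHol (hζ : 1 + ζ + ζ ^ 2 + ζ ^ 3 + ζ ^ 4 = 0) {x : ChartCompl ζ}
    (p : FundamentalGroup (ChartCompl ζ) x) : (Fin 34 → Unip) × (Fin 12 → Multiplicative ℂ) :=
  holQ (isLocalCocycle_totalCocycle hζ) (FundamentalGroup.toPath p)

theorem totalHol_mul (hζ : 1 + ζ + ζ ^ 2 + ζ ^ 3 + ζ ^ 4 = 0) {x : ChartCompl ζ}
    (p q : FundamentalGroup (ChartCompl ζ) x) :
    totalHol hζ (p * q) = totalHol hζ q * totalHol hζ p :=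
  holQ_mul (isLocalCocycle_totalCocycle hζ) p q

theorem totalHol_commute (hζ : 1 + ζ + ζ ^ 2 + ζ ^ 3 + ζ ^ 4 = 0) {x : ChartCompl ζ}
    {p q : FundamentalGroup (ChartCompl ζ) x} (h : Commute p q) (k : Fin 34) :
    Commute ((totalHol hζ p).1 k) ((totalHol hζ q).1 k) := by
  have h1 : totalHol hζ p * totalHol hζ q = totalHol hζ q * totalHol hζ p := by
    rw [← totalHol_mul, ← totalHol_mul, h.eq]
  exact congrFun (congrArg Prod.fst h1) k

theorem totalHol_mem_linked (hζ : 1 + ζ + ζ ^ 2 + ζ ^ 3 + ζ ^ 4 = 0) {x : ChartCompl ζ}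
    (p : FundamentalGroup (ChartCompl ζ) x) : totalHol hζ p ∈ linked := by
  induction p using Quotient.ind with | _ γ
  exact hol_mem (isLocalCocycle_totalCocycle hζ) γ.continuous linked (totalCocycle_mem_linked hζ)

theorem totalHol_snd (hζ : 1 + ζ + ζ ^ 2 + ζ ^ 3 + ζ ^ 4 = 0) {x : ChartCompl ζ}
    (p : FundamentalGroup (ChartCompl ζ) x) (j : Fin 12) :
    ((totalHol hζ p).2 j).toAdd = windNum hζ j p := by
  rw [windNum_eq]
  induction p using Quotient.ind with | _ γ
  exact congrArg Multiplicative.toAdd (hol_map (isLocalCocycle_totalCocycle hζ) γ.continuous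
    ((Pi.evalMonoidHom (fun _ : Fin 12 => Multiplicative ℂ) j).comp (MonoidHom.snd _ _))).symm

theorem exp_totalHol (hζ : 1 + ζ + ζ ^ 2 + ζ ^ 3 + ζ ^ 4 = 0) {x : ChartCompl ζ}
    (p : FundamentalGroup (ChartCompl ζ) x) (k : Fin 34) :
    ∃ m n : ℤ, ((totalHol hζ p).1 k).a = m ∧ ((totalHol hζ p).1 k).b = n ∧
      Complex.exp (2 * Real.pi * Complex.I * ((totalHol hζ p).1 k).g)
        = (1 - pencilFun ζ k (chartPt ζ x)) ^ m * pencilFun ζ k (chartPt ζ x) ^ (-n) := by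
  induction p using Quotient.ind with | _ γ
  have h := hol_map (isLocalCocycle_totalCocycle hζ) γ.continuous
    ((Pi.evalMonoidHom (fun _ : Fin 34 => Unip) k).comp (MonoidHom.fst _ _))
  have h1 := TwicePunctured.exp_hol_g (γ := fun t => pencilMap hζ k (γ t))
    ((continuous_pencilMap hζ k).comp γ.continuous) (by simp)
  have h2 : hol TwicePunctured.cocycle (fun t => pencilMap hζ k (γ t))
      = (totalHol hζ (Quotient.mk _ γ)).1 k := h
  rw [h2, γ.source] at h1
  exact h1

/-- The data attached to the complement of the arrangement in a chart. -/
noncomputable def pencilModel (hζ : 1 + ζ + ζ ^ 2 + ζ ^ 3 + ζ ^ 4 = 0) (x : ChartCompl ζ) :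
    PencilModel (FundamentalGroup (ChartCompl ζ) x) ζ :=
  have ha : ∀ k (p : FundamentalGroup (ChartCompl ζ) x), ((totalHol hζ p).1 k).a
      = ((∑ j, pencilZero k j * windNum hζ j p : ℤ) : ℂ) := fun k p => by
    rw [(totalHol_mem_linked hζ p).1 k]
    simp only [totalHol_snd, Int.cast_sum, Int.cast_mul]
  have hb : ∀ k (p : FundamentalGroup (ChartCompl ζ) x), ((totalHol hζ p).1 k).b
      = ((∑ j, pencilOne k j * windNum hζ j p : ℤ) : ℂ) := fun k p => by
    rw [(totalHol_mem_linked hζ p).2.1 k]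
    simp only [totalHol_snd, Int.cast_sum, Int.cast_mul]
  { w := fun j p => windNum hζ j p
    w_mul := windNum_mul hζ
    exists_eq_sum := fun h hh => exists_eq_sum_windNum hζ hh
    exists_commute := exists_commute_of_mem_points hζ x
    a := fun k p => ∑ j, pencilZero k j * windNum hζ j p
    a_eq := fun _ _ => rfl
    b := fun k p => ∑ j, pencilOne k j * windNum hζ j p
    b_eq := fun _ _ => rfl
    g := fun k p => ((totalHol hζ p).1 k).s
    g_mul := fun k p q => by
      rw [← ha, ← hb, ← ha, ← hb, totalHol_mul, Prod.fst_mul, Pi.mul_apply, Unip.s_mul]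
      ring
    commute_ab := fun k p q h => by
      rw [← ha, ← hb, ← ha, ← hb, Unip.commute_ab (totalHol_commute hζ h k)]
    commute_ag := fun k p q h => by
      rw [← ha, ← ha, Unip.commute_as (totalHol_commute hζ h k)]
    commute_bg := fun k p q h => by
      rw [← hb, ← hb, Unip.commute_bs (totalHol_commute hζ h k)]
    sum_g := fun R p => (totalHol_mem_linked hζ p).2.2 R
    v := chartPt ζ x
    lin_ne_zero := fun j => chartForm_ne_zero hζ j x
    exp_g := fun k p => by
      obtain ⟨m, n, hm, hn, h⟩ := exp_totalHol hζ p k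
      have em : m = ∑ j, pencilZero k j * windNum hζ j p := by
        have := ha k p
        rw [hm] at this
        exact_mod_cast this
      have en : n = ∑ j, pencilOne k j * windNum hζ j p := by
        have := hb k p
        rw [hn] at this
        exact_mod_cast this
      rw [← em, ← en, ← hm, ← hn, ← h, Unip.s]
      congr 1
      ring }

end PencilModel

section Classification

/-- Two vectors of `ℂ³` are proportional. -/
def Par (u w : Fin 3 → ℂ) : Prop := ∀ a b, u a * w b = u b * w a

namespace Par

variable {u w x : Fin 3 → ℂ}

theorem symm (h : Par u w) : Par w u := fun a b => by
  rw [mul_comm, h b a, mul_comm]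

theorem refl (u : Fin 3 → ℂ) : Par u u := fun _ _ => mul_comm _ _

theorem trans (h : Par u w) (h' : Par w x) (hw : w ≠ 0) : Par u x := fun a b => by
  obtain ⟨c, hc⟩ := Function.ne_iff.1 hw
  refine mul_right_cancel₀ (mul_ne_zero hc hc) ?_
  dsimp only [Pi.zero_apply] at hc
  linear_combination w c * x b * h a c + u c * w a * h' c b - w c * x a * h b c
    - u c * w b * h' c a

theorem neg_left (h : Par u w) : Par (-u) w := fun a b => by
  simp only [Pi.neg_apply, neg_mul, h a b]

theorem sum_left {ι : Type*} {s : Finset ι} {f : ι → Fin 3 → ℂ} (h : ∀ i ∈ s, Par (f i) w) :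
    Par (∑ i ∈ s, f i) w := fun a b => by
  rw [Finset.sum_apply, Finset.sum_apply, Finset.sum_mul, Finset.sum_mul]
  exact Finset.sum_congr rfl fun i hi => h i hi a b

theorem zero_left (w : Fin 3 → ℂ) : Par 0 w := fun a b => by simp

theorem dotProduct_eq_zero (h : Par u w) (hw : w ≠ 0) {n : Fin 3 → ℂ} (hn : n ⬝ᵥ w = 0) :
    n ⬝ᵥ u = 0 := by
  obtain ⟨c, hc⟩ := Function.ne_iff.1 hw
  refine mul_right_cancel₀ hc ?_
  rw [zero_mul, dotProduct, Finset.sum_mul, ← mul_zero (u c), ← hn, dotProduct, Finset.mul_sum]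
  refine Finset.sum_congr rfl fun i _ => ?_
  linear_combination n i * h i c

end Par

theorem exists_ne_zero_perp_pair (u w : Fin 3 → ℂ) :
    ∃ n : Fin 3 → ℂ, n ≠ 0 ∧ n ⬝ᵥ u = 0 ∧ n ⬝ᵥ w = 0 := by
  have h : (Matrix.of ![u, w, 0]).det = 0 := by simp [Matrix.det_fin_three]
  obtain ⟨n, hn, h⟩ := Matrix.exists_mulVec_eq_zero_iff.2 h
  refine ⟨n, hn, ?_, ?_⟩
  · rw [dotProduct_comm]
    exact congrFun h 0
  · rw [dotProduct_comm]
    exact congrFun h 1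

/-- Sets of lines are encoded as bit masks; `splitMask m` separates the masks disjoint from `m`
from the others. -/
def splitMask (m : ℕ) : List ℕ → List ℕ × List ℕ
  | [] => ([], [])
  | c :: cs => match splitMask m cs with
    | (r, t) => bif Nat.beq (Nat.land c m) 0 then (c :: r, t) else (r, c :: t)

/-- Whether a mask has exactly one bit. -/
def isSingle (x : ℕ) : Bool := Nat.beq x (2 ^ Nat.log2 x)

/-- Proportionality classes are merged at a point meeting exactly two of them, one of them in a
single line. -/
def mergeAt (cs : List ℕ) (m : ℕ) : List ℕ :=
  match splitMask m cs with
  | (r, [c, d]) =>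
    bif isSingle (Nat.land c m) || isSingle (Nat.land d m) then Nat.lor c d :: r else cs
  | _ => cs

/-- The five points of highest multiplicity, as masks. -/
def bigMask : Fin 5 → ℕ := ![2329, 547, 86, 3202, 172]

/-- The order in which the lines are examined, with the points completed by each line. -/
def searchLevels : List (ℕ × List ℕ) :=
  [(8, []), (7, [384]), (0, [129]), (9, [768]), (1, [258]), (6, [192, 576]), (5, [352, 547]),
    (11, [2080, 2112, 2560]), (10, [1056, 1089, 3202]), (2, [5, 516, 2052, 1284]),
    (3, [10, 72, 1544, 172]), (4, [48, 1040, 656, 86, 2329])]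

/-- The points, as masks. -/
def pointMasks : List ℕ := searchLevels.flatMap Prod.snd

/-- The criterion for the vectors of a configuration of classes to span at most a plane, or to be
supported at one point. -/
def isDegenerate : List ℕ → Bool
  | [] => true
  | [_] => true
  | [_, _] => true
  | cs => (match cs with
      | [b, c, _] => pointMasks.any fun m =>
        isSingle (Nat.land b m) && !Nat.beq (Nat.land c m) 0
      | _ => false)
    || (List.finRange 5).any fun a => cs.all fun c => Nat.beq (Nat.land c (bigMask a)) c

/-- The search through the possible supports. -/
def searchFrom : List (ℕ × List ℕ) → List ℕ → Bool
  | [], cs => isDegenerate cs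
  | l :: ls, cs => searchFrom ls (l.2.foldl mergeAt cs)
    && searchFrom ls (l.2.foldl mergeAt (2 ^ l.1 :: cs))

theorem searchFrom_searchLevels : searchFrom searchLevels [] = true := by
  decide +kernel

theorem exists_of_isSingle {x : ℕ} (h : isSingle x = true) :
    ∃ b, x.testBit b = true ∧ ∀ i, x.testBit i = true → i = b := by
  have h' : x = 2 ^ Nat.log2 x := Nat.eq_of_beq_eq_true h
  refine ⟨Nat.log2 x, ?_, fun i hi => ?_⟩
  · have h1 : (2 ^ Nat.log2 x).testBit (Nat.log2 x) = true := Nat.testBit_two_pow_self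
    rwa [← h'] at h1
  · rw [h', Nat.testBit_two_pow] at hi
    exact (of_decide_eq_true hi).symm

theorem exists_testBit_of_land {c m : ℕ} (h : Nat.beq (Nat.land c m) 0 = false) :
    ∃ i, c.testBit i = true ∧ m.testBit i = true := by
  have h0 : c &&& m ≠ 0 := fun h0 => by
    have h1 := Nat.ne_of_beq_eq_false h
    exact h1 h0
  obtain ⟨i, hi⟩ := Nat.exists_testBit_of_ne_zero h0
  rw [Nat.testBit_and, Bool.and_eq_true] at hi
  exact ⟨i, hi⟩

theorem not_testBit_of_land {c m i : ℕ} (h : Nat.beq (Nat.land c m) 0 = true)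
    (hc : c.testBit i = true) : m.testBit i ≠ true := fun hm => by
  have h0 : c &&& m = 0 := Nat.eq_of_beq_eq_true h
  have h1 : (c &&& m).testBit i = true := by rw [Nat.testBit_and, hc, hm]; rfl
  rw [h0, Nat.zero_testBit] at h1
  cases h1

theorem mem_splitMask (m : ℕ) (cs : List ℕ) :
    (∀ c, c ∈ cs ↔ c ∈ (splitMask m cs).1 ∨ c ∈ (splitMask m cs).2)
      ∧ (∀ c ∈ (splitMask m cs).1, Nat.beq (Nat.land c m) 0 = true)
      ∧ ∀ c ∈ (splitMask m cs).2, Nat.beq (Nat.land c m) 0 = false := by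
  induction cs with
  | nil => simp [splitMask]
  | cons c cs ih =>
    obtain ⟨h1, h2, h3⟩ := ih
    rcases hc : Nat.beq (Nat.land c m) 0 with _ | _
    · have e : splitMask m (c :: cs) = ((splitMask m cs).1, c :: (splitMask m cs).2) := by
        simp only [splitMask, hc, cond_false]
      rw [e]
      refine ⟨fun d => ?_, h2, fun d hd => ?_⟩
      · rw [List.mem_cons, h1, List.mem_cons]
        tauto
      · rcases List.mem_cons.1 hd with rfl | hd
        exacts [hc, h3 d hd]
    · have e : splitMask m (c :: cs) = (c :: (splitMask m cs).1, (splitMask m cs).2) := by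
        simp only [splitMask, hc, cond_true]
      rw [e]
      refine ⟨fun d => ?_, fun d hd => ?_, h3⟩
      · rw [List.mem_cons, h1, List.mem_cons]
        tauto
      · rcases List.mem_cons.1 hd with rfl | hd
        exacts [hc, h2 d hd]

/-- Classes of pairwise proportional nonzero vectors covering the nonzero vectors in `D`. -/
structure IsCover (V : ℕ → Fin 3 → ℂ) (D : ℕ → Prop) (cs : List ℕ) : Prop where
  exists_mem : ∀ i, D i → V i ≠ 0 → ∃ c ∈ cs, c.testBit i = true
  ne_zero : ∀ c ∈ cs, ∀ i, c.testBit i = true → V i ≠ 0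
  par : ∀ c ∈ cs, ∀ i j, c.testBit i = true → c.testBit j = true → Par (V i) (V j)

/-- The lines of a mask. -/
def maskSupport (m : ℕ) : Finset ℕ := {i ∈ Finset.range 12 | m.testBit i = true}

/-- The local condition at a point. -/
def IsLocal (V : ℕ → Fin 3 → ℂ) (m : ℕ) : Prop :=
  (∀ i, m.testBit i = true → i ∈ Finset.range 12) ∧
    ∀ i, m.testBit i = true → Par (V i) (∑ j ∈ maskSupport m, V j)

variable {V : ℕ → Fin 3 → ℂ} {D : ℕ → Prop} {cs : List ℕ} {m : ℕ}

theorem IsLocal.mem_support (hm : IsLocal V m) {i : ℕ} : i ∈ maskSupport m ↔ m.testBit i = true :=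
  ⟨fun h => (Finset.mem_filter.1 h).2, fun h => Finset.mem_filter.2 ⟨hm.1 i h, h⟩⟩

theorem IsCover.par_of_single {r : List ℕ} {c d : ℕ} (h : IsCover V D cs) (hm : IsLocal V m)
    (hD : ∀ i, m.testBit i = true → D i) (hcs : ∀ e, e ∈ cs ↔ e ∈ r ∨ e ∈ [c, d])
    (hr : ∀ e ∈ r, Nat.beq (Nat.land e m) 0 = true)
    (hd : Nat.beq (Nat.land d m) 0 = false) (hc : isSingle (Nat.land c m) = true) {i j : ℕ}
    (hi : c.testBit i = true) (hj : d.testBit j = true) : Par (V i) (V j) := by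
  have mc : c ∈ cs := (hcs c).2 (by simp)
  have md : d ∈ cs := (hcs d).2 (by simp)
  obtain ⟨b, hb, hb'⟩ := exists_of_isSingle hc
  have hb2 : c.testBit b = true ∧ m.testBit b = true := by
    rwa [← Bool.and_eq_true, ← Nat.testBit_and]
  obtain ⟨j₀, hj₀, hj₀m⟩ := exists_testBit_of_land hd
  have key : Par (V b) (V j₀) := by
    by_cases hS : ∑ j ∈ maskSupport m, V j = 0
    · rw [← Finset.add_sum_erase _ _ (hm.mem_support.2 hb2.2)] at hS
      rw [eq_neg_of_add_eq_zero_left hS]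
      refine Par.neg_left (Par.sum_left fun k hk => ?_)
      obtain ⟨hkb, hk⟩ := Finset.mem_erase.1 hk
      have hkm := hm.mem_support.1 hk
      by_cases h0 : V k = 0
      · rw [h0]
        exact Par.zero_left _
      obtain ⟨e, he, hek⟩ := h.exists_mem k (hD k hkm) h0
      rcases (hcs e).1 he with he | he
      · exact absurd hkm (not_testBit_of_land (hr e he) hek)
      rcases List.mem_pair.1 he with rfl | rfl
      · refine absurd (hb' k ?_) hkb
        exact (Nat.testBit_and e m k).trans (by rw [hek, hkm]; rfl)
      · exact h.par e md _ _ hek hj₀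
    · exact (hm.2 b hb2.2).trans (hm.2 j₀ hj₀m).symm hS
  exact ((h.par c mc _ _ hi hb2.1).trans key (h.ne_zero c mc _ hb2.1)).trans
    (h.par d md _ _ hj₀ hj) (h.ne_zero d md _ hj₀)

theorem IsCover.mergeAt (h : IsCover V D cs) (hm : IsLocal V m)
    (hD : ∀ i, m.testBit i = true → D i) : IsCover V D (mergeAt cs m) := by
  obtain ⟨h1, h2, h3⟩ := mem_splitMask m cs
  unfold _root_.mergeAt
  split
  · rename_i r c d e
    rw [e] at h1 h2 h3
    dsimp only at h1 h2 h3
    have hc := h3 c (by simp)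
    have hd := h3 d (by simp)
    have mc : c ∈ cs := (h1 c).2 (by simp)
    have md : d ∈ cs := (h1 d).2 (by simp)
    rcases hs : isSingle (Nat.land c m) || isSingle (Nat.land d m) with _ | _
    · exact h
    have hp : ∀ i j, c.testBit i = true → d.testBit j = true → Par (V i) (V j) := by
      intro i j hi hj
      rcases Bool.or_eq_true_iff.1 hs with hs | hs
      · exact h.par_of_single hm hD h1 h2 hd hs hi hj
      · exact (h.par_of_single hm hD (r := r) (c := d) (d := c) (fun e => by
          rw [h1 e]; simp only [List.mem_cons, List.not_mem_nil, or_false]; tauto)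
          h2 hc hs hj hi).symm
    have hl : ∀ i, (Nat.lor c d).testBit i = true ↔ c.testBit i = true ∨ d.testBit i = true :=
      fun i => by
        rw [← Bool.or_eq_true, ← Nat.testBit_or]
        rfl
    rw [cond_true]
    refine ⟨fun i hi h0 => ?_, fun e he i hi => ?_, fun e he i j hi hj => ?_⟩
    · obtain ⟨e, he, hei⟩ := h.exists_mem i hi h0
      rcases (h1 e).1 he with he | he
      · exact ⟨e, List.mem_cons_of_mem _ he, hei⟩
      · refine ⟨_, List.mem_cons_self, (hl i).2 ?_⟩
        rcases List.mem_pair.1 he with rfl | rfl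
        exacts [Or.inl hei, Or.inr hei]
    · rcases List.mem_cons.1 he with rfl | he
      · rcases (hl i).1 hi with hi | hi
        exacts [h.ne_zero c mc i hi, h.ne_zero d md i hi]
      · exact h.ne_zero e ((h1 e).2 (Or.inl he)) i hi
    · rcases List.mem_cons.1 he with rfl | he
      · rcases (hl i).1 hi with hi | hi <;> rcases (hl j).1 hj with hj | hj
        exacts [h.par c mc i j hi hj, hp i j hi hj, (hp j i hj hi).symm, h.par d md i j hi hj]
      · exact h.par e ((h1 e).2 (Or.inl he)) i j hi hj
  · exact h

theorem IsCover.foldl {ms : List ℕ} (h : IsCover V D cs) (hm : ∀ m ∈ ms, IsLocal V m)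
    (hD : ∀ m ∈ ms, ∀ i, m.testBit i = true → D i) :
    IsCover V D (ms.foldl _root_.mergeAt cs) := by
  induction ms generalizing cs with
  | nil => exact h
  | cons m ms ih =>
    exact ih (h.mergeAt (hm m List.mem_cons_self) (hD m List.mem_cons_self))
      (fun m' h' => hm m' (List.mem_cons_of_mem _ h'))
      fun m' hmem => hD m' (List.mem_cons_of_mem _ hmem)

/-- The vectors lie in a plane, or are supported at one of the five points. -/
def Degenerate (V : ℕ → Fin 3 → ℂ) : Prop :=
  (∃ n : Fin 3 → ℂ, n ≠ 0 ∧ ∀ i < 12, n ⬝ᵥ V i = 0) ∨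
    ∃ a, ∀ i < 12, V i ≠ 0 → (bigMask a).testBit i = true

theorem IsCover.exists_perp {c : ℕ} (h : IsCover V D cs) (hc : c ∈ cs) : ∃ u : Fin 3 → ℂ,
    ∀ n, n ⬝ᵥ u = 0 → ∀ i, c.testBit i = true → n ⬝ᵥ V i = 0 := by
  by_cases h0 : ∃ j, c.testBit j = true
  · obtain ⟨j, hj⟩ := h0
    exact ⟨V j, fun n hn i hi => (h.par c hc i j hi hj).dotProduct_eq_zero (h.ne_zero c hc j hj) hn⟩
  · exact ⟨0, fun _ _ i hi => absurd ⟨i, hi⟩ h0⟩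

theorem IsCover.degenerate_pair {c d : ℕ} (h : IsCover V (· < 12) cs) (hc : c ∈ cs) (hd : d ∈ cs)
    (hcs : ∀ n : Fin 3 → ℂ, (∀ i, c.testBit i = true → n ⬝ᵥ V i = 0) →
      (∀ i, d.testBit i = true → n ⬝ᵥ V i = 0) →
        ∀ e ∈ cs, ∀ i, e.testBit i = true → n ⬝ᵥ V i = 0) : Degenerate V := by
  obtain ⟨u, hu⟩ := h.exists_perp hc
  obtain ⟨w, hw⟩ := h.exists_perp hd
  obtain ⟨n, hn, h1, h2⟩ := exists_ne_zero_perp_pair u w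
  refine Or.inl ⟨n, hn, fun i hi => ?_⟩
  by_cases h0 : V i = 0
  · rw [h0, dotProduct_zero]
  obtain ⟨e, he, hei⟩ := h.exists_mem i hi h0
  exact hcs n (hu n h1) (hw n h2) e he i hei

theorem IsCover.degenerate (h : IsCover V (· < 12) cs) (hm : ∀ m ∈ pointMasks, IsLocal V m)
    (hcs : isDegenerate cs = true) : Degenerate V := by
  unfold isDegenerate at hcs
  split at hcs
  · refine Or.inl ⟨1, one_ne_zero, fun i hi => ?_⟩
    have : V i = 0 := by
      by_contra h0
      obtain ⟨c, hc, -⟩ := h.exists_mem i hi h0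
      cases hc
    rw [this, dotProduct_zero]
  · refine h.degenerate_pair List.mem_cons_self List.mem_cons_self fun n h1 _ e he => ?_
    rwa [List.mem_singleton.1 he]
  · refine h.degenerate_pair List.mem_cons_self (List.mem_cons_of_mem _ List.mem_cons_self)
      fun n h1 h2 e he => ?_
    rcases List.mem_pair.1 he with rfl | rfl
    exacts [h1, h2]
  · rcases Bool.or_eq_true_iff.1 hcs with hcs | hcs
    · split at hcs
      · rename_i b c d _ _ _ _
        obtain ⟨m, hmm, hs⟩ := List.any_eq_true.1 hcs
        rw [Bool.and_eq_true, Bool.not_eq_true'] at hs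
        obtain ⟨k, hk, hk'⟩ := exists_of_isSingle hs.1
        have hk2 : b.testBit k = true ∧ m.testBit k = true := by
          rwa [← Bool.and_eq_true, ← Nat.testBit_and]
        obtain ⟨j, hj, hjm⟩ := exists_testBit_of_land hs.2
        have hl := hm m hmm
        refine h.degenerate_pair (c := c) (d := d) (by simp) (by simp) fun n h1 h2 e he => ?_
        have key : n ⬝ᵥ V k = 0 := by
          by_cases hS : ∑ j ∈ maskSupport m, V j = 0
          · have hS' := congrArg (n ⬝ᵥ ·) hS
            rw [dotProduct_zero, dotProduct_sum,
              ← Finset.add_sum_erase _ _ (hl.mem_support.2 hk2.2)] at hS'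
            rw [← hS', left_eq_add]
            refine Finset.sum_eq_zero fun i hi => ?_
            obtain ⟨hik, hi⟩ := Finset.mem_erase.1 hi
            have him := hl.mem_support.1 hi
            by_cases h0 : V i = 0
            · rw [h0, dotProduct_zero]
            obtain ⟨e, he, hei⟩ := h.exists_mem i (Finset.mem_range.1 (hl.1 i him)) h0
            simp only [List.mem_cons, List.not_mem_nil, or_false] at he
            rcases he with rfl | rfl | rfl
            · refine absurd (hk' i ?_) hik
              exact (Nat.testBit_and e m i).trans (by rw [hei, him]; rfl)
            · exact h1 i hei
            · exact h2 i hei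
          · exact ((hl.2 k hk2.2).trans (hl.2 j hjm).symm hS).dotProduct_eq_zero
              (h.ne_zero c (by simp) j hj) (h1 j hj)
        simp only [List.mem_cons, List.not_mem_nil, or_false] at he
        rcases he with rfl | rfl | rfl
        · exact fun i hi => (h.par e (by simp) i k hi hk2.1).dotProduct_eq_zero
            (h.ne_zero e (by simp) k hk2.1) key
        · exact h1
        · exact h2
      · cases hcs
    · obtain ⟨a, -, ha⟩ := List.any_eq_true.1 hcs
      refine Or.inr ⟨a, fun i hi h0 => ?_⟩
      obtain ⟨c, hc, hci⟩ := h.exists_mem i hi h0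
      have hca : c &&& bigMask a = c := Nat.eq_of_beq_eq_true (List.all_eq_true.1 ha c hc)
      rw [← hca, Nat.testBit_and, Bool.and_eq_true] at hci
      exact hci.2

/-- Each point is only used after all its lines have been examined. -/
def checkLevels : ℕ → List (ℕ × List ℕ) → Bool
  | d, [] => Nat.beq d 4095
  | d, l :: ls => (l.2.all fun m => Nat.beq (Nat.land m (Nat.lor d (2 ^ l.1))) m)
    && checkLevels (Nat.lor d (2 ^ l.1)) ls

theorem degenerate_of_searchFrom {d : ℕ} (ls : List (ℕ × List ℕ))
    (hl : ∀ l ∈ ls, ∀ m ∈ l.2, IsLocal V m) (hm : ∀ m ∈ pointMasks, IsLocal V m)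
    (hd : checkLevels d ls = true) (h : IsCover V (fun i => d.testBit i = true) cs)
    (hs : searchFrom ls cs = true) : Degenerate V := by
  induction ls generalizing d cs with
  | nil =>
    refine IsCover.degenerate ⟨fun i hi => h.exists_mem i ?_, h.ne_zero, h.par⟩ hm hs
    rw [Nat.eq_of_beq_eq_true hd]
    have : ∀ i < 12, Nat.testBit 4095 i = true := by decide
    exact this i hi
  | cons x ls ih =>
    have hs' := Bool.and_eq_true_iff.1 hs
    have hd' := Bool.and_eq_true_iff.1 hd
    have hor : ∀ i, (Nat.lor d (2 ^ x.1)).testBit i = true → d.testBit i = true ∨ i = x.1 :=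
      fun i hi => by
        have h1 : (d ||| 2 ^ x.1).testBit i = true := hi
        rw [Nat.testBit_or, Bool.or_eq_true, Nat.testBit_two_pow] at h1
        exact h1.imp_right fun h2 => (of_decide_eq_true h2).symm
    have hx : ∀ m ∈ x.2, ∀ i, m.testBit i = true → (Nat.lor d (2 ^ x.1)).testBit i = true :=
      fun m hm i hi => by
        have h1 : m &&& Nat.lor d (2 ^ x.1) = m :=
          Nat.eq_of_beq_eq_true (List.all_eq_true.1 hd'.1 m hm)
        rw [← h1, Nat.testBit_and, Bool.and_eq_true] at hi
        exact hi.2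
    have hxl := hl x List.mem_cons_self
    have hl' : ∀ l ∈ ls, ∀ m ∈ l.2, IsLocal V m := fun l hlm => hl l (List.mem_cons_of_mem _ hlm)
    by_cases h0 : V x.1 = 0
    · refine ih hl' hd'.2 (IsCover.foldl ⟨fun i hi hi0 => ?_, h.ne_zero, h.par⟩ hxl hx) hs'.1
      rcases hor i hi with hi | rfl
      exacts [h.exists_mem i hi hi0, absurd h0 hi0]
    · have hb : ∀ i, (2 ^ x.1).testBit i = true → i = x.1 := fun i hi => by
        rw [Nat.testBit_two_pow] at hi
        exact (of_decide_eq_true hi).symm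
      refine ih hl' hd'.2 (IsCover.foldl ⟨fun i hi hi0 => ?_, fun c hc i hi => ?_,
        fun c hc i j hi hj => ?_⟩ hxl hx) hs'.2
      · rcases hor i hi with hi | rfl
        · obtain ⟨c, hc, hci⟩ := h.exists_mem i hi hi0
          exact ⟨c, List.mem_cons_of_mem _ hc, hci⟩
        · exact ⟨_, List.mem_cons_self, Nat.testBit_two_pow_self⟩
      · rcases List.mem_cons.1 hc with rfl | hc
        · rwa [hb i hi]
        · exact h.ne_zero c hc i hi
      · rcases List.mem_cons.1 hc with rfl | hc
        · rw [hb i hi, hb j hj]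
          exact Par.refl _
        · exact h.par c hc i j hi hj

/-- The isotropy conditions at all points for a pair of elements of `ℂ¹²`. -/
def Iso (y z : Fin 12 → ℂ) : Prop :=
  ∀ k, ∀ i ∈ points k, y i * ∑ j ∈ points k, z j = z i * ∑ j ∈ points k, y j

/-- The mask of a point. -/
def toMask (k : Fin 27) : ℕ := ∑ i ∈ points k, 2 ^ (i : ℕ)

theorem testBit_toMask (k : Fin 27) (i : Fin 12) :
    (toMask k).testBit i = true ↔ i ∈ points k := by
  revert k i
  decide +kernel

theorem exists_toMask {m : ℕ} (hm : m ∈ pointMasks) : ∃ k, toMask k = m := by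
  revert m
  decide +kernel

theorem toMask_lt (k : Fin 27) : toMask k < 2 ^ 12 := by
  revert k
  decide +kernel

theorem toMask_big (a : Fin 5) : toMask (Fin.castLE (by decide) a) = bigMask a := by
  revert a
  decide +kernel

theorem exists_point_of_iso {y : Fin 3 → Fin 12 → ℂ} (hy : ∀ a b, Iso (y a) (y b))
    (hli : LinearIndependent ℂ y) :
    ∃ a : Fin 5, ∀ b i, i ∉ points (Fin.castLE (by decide) a) → y b i = 0 := by
  set V : ℕ → Fin 3 → ℂ := fun n a => if h : n < 12 then y a ⟨n, h⟩ else 0 with hV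
  have hVf : ∀ i : Fin 12, V i = fun a => y a i := fun i => by
    simp [hV]
  have hloc : ∀ m ∈ pointMasks, IsLocal V m := by
    intro m hm
    obtain ⟨k, rfl⟩ := exists_toMask hm
    have hr : ∀ i, (toMask k).testBit i = true → i < 12 := fun i hi =>
      (Nat.pow_lt_pow_iff_right (by norm_num)).1 ((Nat.ge_two_pow_of_testBit hi).trans_lt
        (toMask_lt k))
    have hsum : ∑ j ∈ maskSupport (toMask k), V j = ∑ j ∈ points k, fun a => y a j := by
      symm
      refine Finset.sum_bij (fun j _ => (j : ℕ)) (fun j hj => ?_) (fun _ _ _ _ h => Fin.ext h)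
        (fun j hj => ?_) fun j _ => (hVf j).symm
      · exact Finset.mem_filter.2 ⟨Finset.mem_range.2 j.2, (testBit_toMask k j).2 hj⟩
      · have hj' := (Finset.mem_filter.1 hj).2
        exact ⟨⟨j, hr j hj'⟩, (testBit_toMask k ⟨j, hr j hj'⟩).1 hj', rfl⟩
    refine ⟨fun i hi => Finset.mem_range.2 (hr i hi), fun i hi a b => ?_⟩
    have := hVf ⟨i, hr i hi⟩
    rw [hsum, show V i = _ from this]
    simp only [Finset.sum_apply]
    exact hy a b k _ ((testBit_toMask k ⟨i, hr i hi⟩).1 hi)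
  have h := degenerate_of_searchFrom (d := 0) (cs := []) searchLevels
    (fun l hl m hm => hloc m (List.mem_flatMap.2 ⟨l, hl, hm⟩)) hloc (by decide +kernel)
    ⟨fun i hi => by simp at hi, by simp, by simp⟩ searchFrom_searchLevels
  rcases h with ⟨n, hn, h⟩ | ⟨a, ha⟩
  · refine absurd (funext fun a => Fintype.linearIndependent_iff.1 hli n (funext fun i => ?_) a) hn
    have := h i i.2
    rw [hVf] at this
    simpa [dotProduct, Finset.sum_apply] using this
  · refine ⟨a, fun b i hi => ?_⟩
    by_contra h0
    refine hi ((testBit_toMask _ i).1 ?_)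
    rw [toMask_big]
    refine ha i i.2 fun h1 => h0 ?_
    rw [hVf] at h1
    exact congrFun h1 b

end Classification

section Rigidity

/-- The five points of highest multiplicity. -/
abbrev big (a : Fin 5) : Finset (Fin 12) := points (Fin.castLE (by decide) a)

/-- The elements isotropic with a given one. -/
def isoSpace (z : Fin 12 → ℂ) : Submodule ℂ (Fin 12 → ℂ) where
  carrier := {y | Iso y z}
  zero_mem' := fun k i _ => by simp
  add_mem' := fun {x y} hx hy k i hi => by
    simp only [Pi.add_apply, Finset.sum_add_distrib, add_mul, mul_add, hx k i hi, hy k i hi]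
  smul_mem' := fun c y hy k i hi => by
    simp only [Pi.smul_apply, smul_eq_mul, ← Finset.mul_sum, mul_assoc, hy k i hi]
    ring

theorem Iso.symm {y z : Fin 12 → ℂ} (h : Iso y z) : Iso z y := fun k i hi => (h k i hi).symm

theorem Iso.refl (y : Fin 12 → ℂ) : Iso y y := fun _ _ _ => rfl

theorem Iso.sub_left {x y z : Fin 12 → ℂ} (h : Iso x z) (h' : Iso y z) : Iso (x - y) z :=
  (isoSpace z).sub_mem h h'

theorem Iso.sub_right {x y z : Fin 12 → ℂ} (h : Iso x y) (h' : Iso x z) : Iso x (y - z) :=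
  (h.symm.sub_left h'.symm).symm

theorem Iso.neg_right {x y : Fin 12 → ℂ} (h : Iso x y) : Iso x (-y) :=
  Iso.symm ((isoSpace x).neg_mem h.symm)

/-- The elements of sum zero. -/
def sumZero : Submodule ℂ (Fin 12 → ℂ) where
  carrier := {y | ∑ j, y j = 0}
  zero_mem' := by simp
  add_mem' := fun {x y} (hx : _ = _) (hy : _ = _) => by
    simp [Finset.sum_add_distrib, hx, hy]
  smul_mem' := fun c y (hy : _ = _) => by simp [← Finset.mul_sum, hy]

/-- The elements of sum zero supported at a set of lines. -/
def supportedOn (S : Finset (Fin 12)) : Submodule ℂ (Fin 12 → ℂ) where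
  carrier := {y | y ∈ sumZero ∧ ∀ i, i ∉ S → y i = 0}
  zero_mem' := ⟨sumZero.zero_mem, fun _ _ => rfl⟩
  add_mem' := fun {x y} hx hy => ⟨sumZero.add_mem hx.1 hy.1, fun i hi => by
    rw [Pi.add_apply, hx.2 i hi, hy.2 i hi, add_zero]⟩
  smul_mem' := fun c y hy => ⟨sumZero.smul_mem c hy.1, fun i hi => by
    rw [Pi.smul_apply, hy.2 i hi, smul_zero]⟩

/-- The difference of two basis vectors. -/
def diff (i j : Fin 12) : Fin 12 → ℂ := Pi.single i 1 - Pi.single j 1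

theorem diff_apply (i j l : Fin 12) :
    diff i j l = (if l = i then 1 else 0) - if l = j then 1 else 0 := by
  simp [diff, Pi.single_apply]

theorem diff_self (i : Fin 12) : diff i i = 0 := sub_self _

theorem neg_diff (i j : Fin 12) : -diff i j = diff j i := neg_sub _ _

theorem diff_add_diff (i j l : Fin 12) : diff i j + diff j l = diff i l := sub_add_sub_cancel _ _ _

theorem diff_sub_diff (i j l : Fin 12) : diff i l - diff j l = diff i j :=
  sub_sub_sub_cancel_right _ _ _

theorem diff_mem_sumZero (i j : Fin 12) : diff i j ∈ sumZero := by
  change ∑ l, diff i j l = 0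
  simp [diff_apply]

theorem diff_mem_supportedOn {i j : Fin 12} {S : Finset (Fin 12)} (hi : i ∈ S) (hj : j ∈ S) :
    diff i j ∈ supportedOn S := by
  refine ⟨diff_mem_sumZero i j, fun l hl => ?_⟩
  rw [diff_apply, if_neg fun h => hl (by rwa [h]), if_neg fun h => hl (by rwa [h]), sub_zero]

theorem eq_sum_diff {S : Finset (Fin 12)} {y : Fin 12 → ℂ} (hy : y ∈ supportedOn S) (l : Fin 12) :
    y = ∑ i ∈ S, y i • diff i l := by
  have hs : ∑ i ∈ S, y i = 0 := by
    rw [← hy.1]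
    exact Finset.sum_subset (Finset.subset_univ S) fun i _ hi => hy.2 i hi
  funext m
  simp only [Finset.sum_apply, Pi.smul_apply, diff_apply, smul_eq_mul, mul_sub,
    Finset.sum_sub_distrib]
  rw [← Finset.sum_mul, hs, zero_mul, sub_zero]
  simp only [mul_ite, mul_one, mul_zero, Finset.sum_ite_eq]
  split_ifs with h
  · rfl
  · exact hy.2 m h

theorem eq_smul_diff {i j : Fin 12} {y : Fin 12 → ℂ} (hy : y ∈ supportedOn {i, j}) :
    y = y i • diff i j := by
  by_cases h : i = j
  · subst h
    rw [diff_self, smul_zero]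
    have := eq_sum_diff hy i
    simpa [diff_self] using this
  · have := eq_sum_diff hy j
    rwa [Finset.sum_pair h, diff_self, smul_zero, add_zero] at this

theorem diff_apply_left {i j : Fin 12} (h : i ≠ j) : diff i j i = 1 := by
  rw [diff_apply, if_pos rfl, if_neg h, sub_zero]

theorem diff_ne_zero {i j : Fin 12} (h : i ≠ j) : diff i j ≠ 0 := fun h0 => by
  have h1 := diff_apply_left h
  rw [h0] at h1
  exact zero_ne_one h1

theorem card_big_inter (a b : Fin 5) (h : a ≠ b) : (big a ∩ big b).card = 1 := by
  revert a b
  decide +kernel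

theorem eq_of_mem_of_mem {a b : Fin 5} {y : Fin 12 → ℂ} (ha : y ∈ supportedOn (big a))
    (hb : y ∈ supportedOn (big b)) (h0 : y ≠ 0) : a = b := by
  by_contra h
  obtain ⟨i, hi⟩ := Finset.card_eq_one.1 (card_big_inter a b h)
  refine h0 ?_
  have hy : y ∈ supportedOn {i, i} := by
    refine ⟨ha.1, fun l hl => ?_⟩
    rw [Finset.pair_eq_singleton, ← hi, Finset.mem_inter, not_and_or] at hl
    exact hl.elim (ha.2 l) (hb.2 l)
  rw [eq_smul_diff hy, diff_self, smul_zero]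

/-- A line through each of the five points. -/
def baseLine : Fin 5 → Fin 12 := ![4, 0, 4, 11, 3]

/-- Three other lines through each of the five points. -/
def otherLine : Fin 5 → Fin 3 → Fin 12 :=
  ![![0, 3, 8], ![1, 5, 9], ![1, 2, 6], ![1, 7, 10], ![2, 5, 7]]

theorem otherLine_mem (a : Fin 5) (r : Fin 3) : otherLine a r ∈ big a := by
  revert a r
  decide +kernel

theorem baseLine_mem (a : Fin 5) : baseLine a ∈ big a := by
  revert a
  decide +kernel

theorem otherLine_inj (a : Fin 5) (r s : Fin 3) (h : otherLine a r = otherLine a s) : r = s := by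
  revert a r s
  decide +kernel

theorem otherLine_ne_baseLine (a : Fin 5) (r : Fin 3) : otherLine a r ≠ baseLine a := by
  revert a r
  decide +kernel

theorem linearIndependent_otherLine (a : Fin 5) :
    LinearIndependent ℂ fun r => diff (otherLine a r) (baseLine a) := by
  refine Fintype.linearIndependent_iff.2 fun g hg r => ?_
  have h := congrFun hg (otherLine a r)
  simp only [Finset.sum_apply, Pi.smul_apply, diff_apply, if_neg (otherLine_ne_baseLine a r),
    sub_zero, smul_eq_mul, mul_ite, mul_one, mul_zero, Pi.zero_apply] at h
  rw [Finset.sum_eq_single r (fun s _ hs => if_neg fun h => hs (otherLine_inj a r s h).symm)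
    (fun h => absurd (Finset.mem_univ r) h), if_pos rfl] at h
  exact h

/-- A linear automorphism of the elements of sum zero, respecting the pencils. -/
structure IsRigidPair (B B' : (Fin 12 → ℂ) →ₗ[ℂ] (Fin 12 → ℂ)) : Prop where
  mem : ∀ y ∈ sumZero, B y ∈ sumZero
  mem' : ∀ y ∈ sumZero, B' y ∈ sumZero
  inv : ∀ y ∈ sumZero, B' (B y) = y
  inv' : ∀ y ∈ sumZero, B (B' y) = y
  iso : ∀ k, Iso (B fun j => (pencilZero k j : ℂ)) (B fun j => (pencilOne k j : ℂ))
  iso' : ∀ k, Iso (B' fun j => (pencilZero k j : ℂ)) (B' fun j => (pencilOne k j : ℂ))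

namespace IsRigidPair

variable {B B' : (Fin 12 → ℂ) →ₗ[ℂ] (Fin 12 → ℂ)}

theorem symm (h : IsRigidPair B B') : IsRigidPair B' B :=
  ⟨h.mem', h.mem, h.inv', h.inv, h.iso', h.iso⟩

theorem ne_zero (h : IsRigidPair B B') {y : Fin 12 → ℂ} (hy : y ∈ sumZero) (h0 : y ≠ 0) :
    B y ≠ 0 := fun h1 => h0 (by rw [← h.inv y hy, h1, map_zero])

/-- Isotropy of the image of the differences of three lines. -/
def Tri (B : (Fin 12 → ℂ) →ₗ[ℂ] (Fin 12 → ℂ)) (i j l : Fin 12) : Prop :=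
  Iso (B (diff i l)) (B (diff j l))

theorem Tri.swap {i j l : Fin 12} (h : Tri B i j l) : Tri B j i l := Iso.symm h

theorem Tri.rot {i j l : Fin 12} (h : Tri B i j l) : Tri B i l j := by
  unfold Tri
  rw [← diff_sub_diff i j l, ← neg_diff j l, map_sub, map_neg]
  exact (Iso.sub_left h (Iso.refl _)).neg_right

theorem tri_pencil (h : IsRigidPair B B') (k : Fin 34) (hk : 10 ≤ k) :
    Tri B (pencil k 0) (pencil k 2) (pencil k 4) := by
  have h1 : ∀ k : Fin 34, 10 ≤ k → ∀ j, pencilZero k j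
      = (if j = pencil k 0 then 1 else 0) - if j = pencil k 4 then 1 else 0 := by
    decide +kernel
  have h2 : ∀ k : Fin 34, 10 ≤ k → ∀ j, pencilOne k j
      = (if j = pencil k 2 then 1 else 0) - if j = pencil k 4 then 1 else 0 := by
    decide +kernel
  have e1 : diff (pencil k 0) (pencil k 4) = fun j => (pencilZero k j : ℂ) := by
    funext j
    rw [h1 k hk j, diff_apply]
    push_cast
    rfl
  have e2 : diff (pencil k 2) (pencil k 4) = fun j => (pencilOne k j : ℂ) := by
    funext j
    rw [h2 k hk j, diff_apply]
    push_cast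
    rfl
  unfold Tri
  rw [e1, e2]
  exact h.iso k

theorem tri_big (h : IsRigidPair B B') {a : Fin 5} {i j : Fin 12} (hi : i ∈ big a)
    (hj : j ∈ big a) : Tri B i j (baseLine a) := by
  have key : ∀ a : Fin 5, ∀ i ∈ big a, ∀ j ∈ big a, i = j ∨ i = baseLine a ∨ j = baseLine a ∨
      (baseLine a = 4 ∧ (i = 0 ∧ j = 3 ∨ i = 3 ∧ j = 0)) ∨ ∃ k : Fin 34, 10 ≤ k ∧
        ((i = pencil k 0 ∧ j = pencil k 2 ∧ baseLine a = pencil k 4) ∨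
        (i = pencil k 2 ∧ j = pencil k 0 ∧ baseLine a = pencil k 4) ∨
        (i = pencil k 0 ∧ j = pencil k 4 ∧ baseLine a = pencil k 2) ∨
        (i = pencil k 4 ∧ j = pencil k 0 ∧ baseLine a = pencil k 2) ∨
        (i = pencil k 2 ∧ j = pencil k 4 ∧ baseLine a = pencil k 0) ∨
        (i = pencil k 4 ∧ j = pencil k 2 ∧ baseLine a = pencil k 0)) := by
    decide +kernel
  have t034 : Tri B 0 3 4 := by
    have e1 : Tri B 0 3 11 := h.tri_pencil 12 (by decide)
    have e2 : Tri B 0 4 11 := h.tri_pencil 14 (by decide)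
    have e3 : Tri B 3 4 11 := h.tri_pencil 25 (by decide)
    unfold Tri
    rw [← diff_sub_diff 0 4 11, ← diff_sub_diff 3 4 11, map_sub, map_sub]
    exact (Iso.sub_left e1 e3.swap).sub_right (Iso.sub_left e2 (Iso.refl _))
  rcases key a i hi j hj with rfl | rfl | rfl | ⟨e, h1 | h1⟩ | ⟨k, hk, h1⟩
  · exact Iso.refl _
  · unfold Tri
    rw [diff_self, map_zero]
    exact (isoSpace _).zero_mem
  · unfold Tri
    rw [diff_self, map_zero]
    exact Iso.symm ((isoSpace _).zero_mem)
  · rw [e, h1.1, h1.2]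
    exact t034
  · rw [e, h1.1, h1.2]
    exact t034.swap
  · have ht := h.tri_pencil k hk
    rcases h1 with ⟨e1, e2, e3⟩ | ⟨e1, e2, e3⟩ | ⟨e1, e2, e3⟩ | ⟨e1, e2, e3⟩ | ⟨e1, e2, e3⟩ |
      ⟨e1, e2, e3⟩ <;> rw [e1, e2, e3]
    exacts [ht, ht.swap, ht.rot, ht.rot.swap, ht.swap.rot, ht.swap.rot.swap]

theorem iso_big (h : IsRigidPair B B') {a : Fin 5} {y z : Fin 12 → ℂ}
    (hy : y ∈ supportedOn (big a)) (hz : z ∈ supportedOn (big a)) : Iso (B y) (B z) := by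
  rw [eq_sum_diff hy (baseLine a), eq_sum_diff hz (baseLine a), map_sum, map_sum]
  refine (isoSpace _).sum_mem fun i hi => ?_
  rw [map_smul]
  refine (isoSpace _).smul_mem _ (Iso.symm ((isoSpace _).sum_mem fun j hj => ?_))
  rw [map_smul]
  exact (isoSpace _).smul_mem _ (h.tri_big hj hi)

theorem exists_of_linearIndependent (h : IsRigidPair B B') {a : Fin 5} {y : Fin 3 → Fin 12 → ℂ}
    (hy : ∀ r, y r ∈ supportedOn (big a)) (hli : LinearIndependent ℂ y) :
    ∃ b, ∀ r, B (y r) ∈ supportedOn (big b) := by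
  have hli' : LinearIndependent ℂ fun r => B (y r) := by
    refine LinearIndependent.of_comp B' ?_
    convert hli using 1
    funext r
    exact h.inv _ (hy r).1
  obtain ⟨b, hb⟩ := exists_point_of_iso (fun r s => h.iso_big (hy r) (hy s)) hli'
  exact ⟨b, fun r => ⟨h.mem _ (hy r).1, hb r⟩⟩

theorem exists_perm (h : IsRigidPair B B') (a : Fin 5) :
    ∃ b, ∀ y ∈ supportedOn (big a), B y ∈ supportedOn (big b) := by
  set u := fun r => diff (otherLine a r) (baseLine a) with hu
  have hum : ∀ r, u r ∈ supportedOn (big a) := fun r =>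
    diff_mem_supportedOn (otherLine_mem a r) (baseLine_mem a)
  have hli := linearIndependent_otherLine a
  obtain ⟨b, hb⟩ := h.exists_of_linearIndependent hum hli
  refine ⟨b, fun y hy => ?_⟩
  have hli2 : LinearIndependent ℂ ![u 0, u 1] := by
    have := hli.comp ![(0 : Fin 3), 1] (by decide)
    convert this using 1
    funext r
    fin_cases r <;> rfl
  by_cases hs : y ∈ Submodule.span ℂ (Set.range ![u 0, u 1])
  · have : Submodule.span ℂ (Set.range ![u 0, u 1]) ≤ (supportedOn (big b)).comap B := by
      refine Submodule.span_le.2 ?_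
      rintro _ ⟨r, rfl⟩
      fin_cases r
      exacts [hb 0, hb 1]
    exact this hs
  · have hli3 : LinearIndependent ℂ ![y, u 0, u 1] := linearIndependent_finCons.2 ⟨hli2, hs⟩
    obtain ⟨b', hb'⟩ := h.exists_of_linearIndependent (a := a) (fun r => by
      fin_cases r
      exacts [hy, hum 0, hum 1]) hli3
    have e : b = b' := eq_of_mem_of_mem (hb 0) (hb' 1)
      (h.ne_zero (hum 0).1 (diff_ne_zero (otherLine_ne_baseLine a 0)))
    rw [e]
    exact hb' 0

end IsRigidPair

end Rigidity

section Rigidity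

/-- The line common to two of the five points. -/
def meet : Fin 5 → Fin 5 → Fin 12 :=
  ![![0, 0, 4, 11, 3], ![0, 0, 1, 1, 5], ![4, 1, 0, 1, 2], ![11, 1, 1, 0, 7], ![3, 5, 2, 7, 0]]

theorem meet_comm (a b : Fin 5) : meet a b = meet b a := by
  revert a b
  decide +kernel

theorem meet_mem_left {a b : Fin 5} (h : a ≠ b) : meet a b ∈ big a := by
  revert a b
  decide +kernel

theorem meet_mem_right {a b : Fin 5} (h : a ≠ b) : meet a b ∈ big b := by
  revert a b
  decide +kernel

theorem eq_meet {a b : Fin 5} (h : a ≠ b) {i : Fin 12} (ha : i ∈ big a) (hb : i ∈ big b) :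
    i = meet a b := by
  revert a b i
  decide +kernel

theorem eq_of_smul_diff {c d e : ℂ} {i j l : Fin 12} (hij : i ≠ j) (hjl : j ≠ l) (hil : i ≠ l)
    (h : c • diff i j + d • diff j l = e • diff i l) : c = e ∧ d = e := by
  have hi := congrFun h i
  have hl := congrFun h l
  simp only [Pi.add_apply, Pi.smul_apply, diff_apply, if_neg hij, if_neg hil, if_neg hil.symm,
    if_neg hjl.symm, smul_eq_mul, if_true] at hi hl
  constructor
  · linear_combination hi
  · linear_combination -hl

theorem mem_supportedOn_of_iso {c : ℂ} (hc : c ≠ 0) {i j : Fin 12} {η : Fin 12 → ℂ}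
    (h : Iso (c • diff i j) η) (hη : η ∈ sumZero) (S : Finset (Fin 12)) (hi : i ∈ S)
    (hS : ∀ l, l ∉ S → ∃ k, l ∈ points k ∧ i ∈ points k ∧ j ∉ points k) :
    η ∈ supportedOn S := by
  refine ⟨hη, fun l hl => ?_⟩
  obtain ⟨k, hlk, hik, hjk⟩ := hS l hl
  have h1 := h k l hlk
  have hli : l ≠ i := fun h => hl (by rwa [h])
  have hlj : l ≠ j := fun h => hjk (by rwa [← h])
  simp only [Pi.smul_apply, diff_apply, if_neg hli, if_neg hlj, smul_eq_mul, sub_zero, mul_zero,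
    zero_mul, ← Finset.mul_sum, Finset.sum_sub_distrib, Finset.sum_ite_eq', if_pos hik,
    if_neg hjk, mul_one] at h1
  exact (mul_eq_zero.1 h1.symm).resolve_right hc

namespace IsRigidPair

variable {B B' : (Fin 12 → ℂ) →ₗ[ℂ] (Fin 12 → ℂ)}

theorem not_zero_to_other (h : IsRigidPair B B') {b : Fin 5} (hb : b ≠ 0)
    (hB : ∀ y ∈ supportedOn (big 0), B y ∈ supportedOn (big b)) : False := by
  set x : Fin 4 → Fin 12 := ![0, 3, 8, 11] with hx
  have hxm : ∀ r, x r ∈ big 0 := by decide +kernel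
  have hx4 : ∀ r, x r ≠ 4 := by decide +kernel
  have hxi : ∀ r s, x r = x s → r = s := by decide +kernel
  have hum : ∀ r, diff (x r) 4 ∈ supportedOn (big 0) := fun r =>
    diff_mem_supportedOn (hxm r) (by decide +kernel)
  have hl : ∀ b : Fin 5, b ≠ 0 →
      big b = Finset.univ.image (Fin.cons (baseLine b) (otherLine b) : Fin 4 → Fin 12) := by
    decide +kernel
  have hinj : ∀ b : Fin 5, Function.Injective
      (Fin.cons (baseLine b) (otherLine b) : Fin 4 → Fin 12) :=
    fun b r s => by
      revert b r s
      decide +kernel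
  set f : Fin 4 → Fin 12 := Fin.cons (baseLine b) (otherLine b) with hf
  have hdet : (Matrix.of fun r s => B (diff (x s) 4) (f r)).det = 0 := by
    refine Matrix.exists_vecMul_eq_zero_iff.1 ⟨1, one_ne_zero, funext fun s => ?_⟩
    have h1 := hB _ (hum s)
    have h2 : ∑ i ∈ big b, B (diff (x s) 4) i = 0 := by
      rw [← h1.1]
      exact Finset.sum_subset (Finset.subset_univ _) fun i _ hi => h1.2 i hi
    rw [hl b hb, Finset.sum_image (hinj b).injOn] at h2
    simpa [Matrix.vecMul, dotProduct] using h2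
  obtain ⟨c, hc, hc'⟩ := Matrix.exists_mulVec_eq_zero_iff.2 hdet
  have hsum : ∑ s, c s • diff (x s) 4 ∈ supportedOn (big 0) :=
    Submodule.sum_mem _ fun s _ => Submodule.smul_mem _ _ (hum s)
  have h0 : B (∑ s, c s • diff (x s) 4) = 0 := by
    funext i
    by_cases hi : i ∈ big b
    · rw [hl b hb] at hi
      obtain ⟨r, -, rfl⟩ := Finset.mem_image.1 hi
      have := congrFun hc' r
      simp only [Matrix.mulVec, dotProduct, Matrix.of_apply, Pi.zero_apply] at this
      rw [Pi.zero_apply, ← this, map_sum, Finset.sum_apply]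
      refine Finset.sum_congr rfl fun s _ => ?_
      rw [map_smul, Pi.smul_apply, smul_eq_mul, mul_comm]
    · exact (hB _ hsum).2 i hi
  have h1 : ∑ s, c s • diff (x s) 4 = 0 := by
    rw [← h.inv _ hsum.1, h0, map_zero]
  refine hc (funext fun r => ?_)
  have h2 := congrFun h1 (x r)
  simp only [Finset.sum_apply, Pi.smul_apply, diff_apply, if_neg (hx4 r), sub_zero, smul_eq_mul,
    mul_ite, mul_one, mul_zero, Pi.zero_apply] at h2
  rw [Finset.sum_eq_single r (fun s _ hs => if_neg fun h => hs (hxi r s h).symm)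
    (fun h => absurd (Finset.mem_univ r) h), if_pos rfl] at h2
  exact h2

theorem exists_equiv (h : IsRigidPair B B') : ∃ τ : Equiv.Perm (Fin 5), τ 0 = 0 ∧
    ∀ a, ∀ y ∈ supportedOn (big a), B y ∈ supportedOn (big (τ a)) := by
  choose τ hτ using h.exists_perm
  choose τ' hτ' using h.symm.exists_perm
  have hne : ∀ a, ∃ y ∈ supportedOn (big a), y ≠ 0 := fun a =>
    ⟨_, diff_mem_supportedOn (otherLine_mem a 0) (baseLine_mem a),
      diff_ne_zero (otherLine_ne_baseLine a 0)⟩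
  have h1 : ∀ a, τ' (τ a) = a := fun a => by
    obtain ⟨y, hy, h0⟩ := hne a
    have := hτ' _ _ (hτ a y hy)
    rw [h.inv y hy.1] at this
    exact eq_of_mem_of_mem this hy h0
  have h2 : ∀ a, τ (τ' a) = a := fun a => by
    obtain ⟨y, hy, h0⟩ := hne a
    have := hτ _ _ (hτ' a y hy)
    rw [h.inv' y hy.1] at this
    exact eq_of_mem_of_mem this hy h0
  refine ⟨⟨τ, τ', h1, h2⟩, ?_, hτ⟩
  by_contra h0
  exact h.not_zero_to_other h0 (hτ 0)

theorem exists_smul_diff (h : IsRigidPair B B') {τ : Equiv.Perm (Fin 5)}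
    (hτ : ∀ a, ∀ y ∈ supportedOn (big a), B y ∈ supportedOn (big (τ a))) {x y z : Fin 5}
    (hxy : x ≠ y) (hxz : x ≠ z) (hyz : y ≠ z) {i j i' j' : Fin 12} (hi : meet x y = i)
    (hj : meet x z = j) (hij : i ≠ j) (hi' : meet (τ x) (τ y) = i') (hj' : meet (τ x) (τ z) = j') :
    i' ≠ j' ∧ ∃ c : ℂ, B (diff i j) = c • diff i' j' := by
  subst hi hj hi' hj'
  have hx := hτ x _ (diff_mem_supportedOn (meet_mem_left hxy) (meet_mem_left hxz))
  have hy := hτ y _ (diff_mem_supportedOn (meet_mem_right hxy) (meet_mem_left hyz))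
  have hz := hτ z _ (diff_mem_supportedOn (meet_mem_right hyz) (meet_mem_right hxz))
  have hs : B (diff (meet x y) (meet x z))
      ∈ supportedOn {meet (τ x) (τ y), meet (τ x) (τ z)} := by
    refine ⟨hx.1, fun l hl => ?_⟩
    rw [Finset.mem_insert, Finset.mem_singleton, not_or] at hl
    by_cases h1 : l ∈ big (τ x)
    · rw [← diff_add_diff _ (meet y z), map_add, Pi.add_apply,
        hy.2 l fun h2 => hl.1 (eq_meet (τ.injective.ne hxy) h1 h2),
        hz.2 l fun h2 => hl.2 (eq_meet (τ.injective.ne hxz) h1 h2), add_zero]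
    · exact hx.2 l h1
  have he := eq_smul_diff hs
  refine ⟨fun h0 => h.ne_zero (diff_mem_sumZero _ _) (diff_ne_zero hij) ?_, _, he⟩
  rw [he, h0, diff_self, smul_zero]

theorem tri_apply {c : ℂ} {i j l i' j' l' : Fin 12} {d e : ℂ} (hij : B (diff i j) = c • diff i' j')
    (hjl : B (diff j l) = d • diff j' l') (hil : B (diff i l) = e • diff i' l') (h1 : i' ≠ j')
    (h2 : j' ≠ l') (h3 : i' ≠ l') : c = e ∧ d = e := by
  refine eq_of_smul_diff h1 h2 h3 ?_
  rw [← hij, ← hjl, ← hil, ← map_add, diff_add_diff]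

/-- The incidence condition under which isotropy with `e_p - e_q` forces the support. -/
def Separates (p q : Fin 12) : Prop :=
  ∀ l, l ∉ ({p, q} : Finset (Fin 12)) → ∃ k, l ∈ points k ∧ p ∈ points k ∧ q ∉ points k

instance (p q : Fin 12) : Decidable (Separates p q) :=
  inferInstanceAs (Decidable (∀ _, _ → _))

theorem exists_smul_known (h : IsRigidPair B B') : ∃ c : ℂ, c ≠ 0 ∧
    (∀ i ∈ ({0, 1, 2, 3, 4, 5, 7, 11} : Finset (Fin 12)), B (diff i 0) = c • diff i 0) ∧
    ∀ a, ∀ y ∈ supportedOn (big a), B y ∈ supportedOn (big a) := by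
  obtain ⟨τ, h0, hτ⟩ := h.exists_equiv
  have hmeet : ∀ x y z : Fin 5, x ≠ y → x ≠ z → y ≠ z → meet x y ≠ meet x z →
      meet (τ x) (τ y) ≠ meet (τ x) (τ z) := fun x y z hxy hxz hyz hm =>
    (h.exists_smul_diff hτ hxy hxz hyz rfl rfl hm rfl rfl).1
  have h4 : τ 4 = 4 := by
    clear hτ
    revert τ
    decide +kernel
  obtain ⟨n21, c, e21⟩ := h.exists_smul_diff hτ (x := 0) (y := 2) (z := 1) (i := 4) (j := 0)
    (by decide) (by decide) (by decide) rfl rfl (by decide) rfl rfl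
  obtain ⟨n31, c3, e31⟩ := h.exists_smul_diff hτ (x := 0) (y := 3) (z := 1) (i := 11) (j := 0)
    (by decide) (by decide) (by decide) rfl rfl (by decide) rfl rfl
  obtain ⟨n41, c4, e41⟩ := h.exists_smul_diff hτ (x := 0) (y := 4) (z := 1) (i := 3) (j := 0)
    (by decide) (by decide) (by decide) rfl rfl (by decide) rfl rfl
  obtain ⟨n23, _, e23⟩ := h.exists_smul_diff hτ (x := 0) (y := 2) (z := 3) (i := 4) (j := 11)
    (by decide) (by decide) (by decide) rfl rfl (by decide) rfl rfl
  obtain ⟨n34, _, e34⟩ := h.exists_smul_diff hτ (x := 0) (y := 3) (z := 4) (i := 11) (j := 3)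
    (by decide) (by decide) (by decide) rfl rfl (by decide) rfl rfl
  rw [(tri_apply e23 e31 e21 n23 n31 n21).2] at e31
  rw [(tri_apply e34 e41 e31 n34 n41 n31).2] at e41
  obtain ⟨n10, _, e10⟩ := h.exists_smul_diff hτ (x := 1) (y := 2) (z := 0) (i := 1) (j := 0)
    (by decide) (by decide) (by decide) rfl rfl (by decide) rfl (meet_comm _ _)
  obtain ⟨n12, _, e12⟩ := h.exists_smul_diff hτ (x := 2) (y := 0) (z := 1) (i := 4) (j := 1)
    (by decide) (by decide) (by decide) rfl rfl (by decide) (meet_comm _ _) (meet_comm _ _)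
  rw [(tri_apply e12 e10 e21 n12 n10 n21).2] at e10
  obtain ⟨n50, _, e50⟩ := h.exists_smul_diff hτ (x := 1) (y := 4) (z := 0) (i := 5) (j := 0)
    (by decide) (by decide) (by decide) rfl rfl (by decide) rfl (meet_comm _ _)
  obtain ⟨n35, _, e35⟩ := h.exists_smul_diff hτ (x := 4) (y := 0) (z := 1) (i := 3) (j := 5)
    (by decide) (by decide) (by decide) rfl rfl (by decide) (meet_comm _ _) (meet_comm _ _)
  rw [(tri_apply e35 e50 e41 n35 n50 n41).2] at e50
  obtain ⟨n24, _, e24⟩ := h.exists_smul_diff hτ (x := 2) (y := 4) (z := 0) (i := 2) (j := 4)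
    (by decide) (by decide) (by decide) rfl rfl (by decide) rfl (meet_comm _ _)
  obtain ⟨n32, _, e32⟩ := h.exists_smul_diff hτ (x := 4) (y := 0) (z := 2) (i := 3) (j := 2)
    (by decide) (by decide) (by decide) rfl rfl (by decide) (meet_comm _ _) (meet_comm _ _)
  obtain ⟨m34, _, f34⟩ := h.exists_smul_diff hτ (x := 0) (y := 4) (z := 2) (i := 3) (j := 4)
    (by decide) (by decide) (by decide) rfl rfl (by decide) rfl rfl
  rw [(tri_apply e32 e24 f34 n32 n24 m34).2, (tri_apply f34 e21 e41 m34 n21 n41).1] at e24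
  obtain ⟨n70, _, e711⟩ := h.exists_smul_diff hτ (x := 3) (y := 4) (z := 0) (i := 7) (j := 11)
    (by decide) (by decide) (by decide) rfl rfl (by decide) rfl (meet_comm _ _)
  obtain ⟨n37, _, e37⟩ := h.exists_smul_diff hτ (x := 4) (y := 0) (z := 3) (i := 3) (j := 7)
    (by decide) (by decide) (by decide) rfl rfl (by decide) (meet_comm _ _) (meet_comm _ _)
  obtain ⟨m311, _, f311⟩ := h.exists_smul_diff hτ (x := 0) (y := 4) (z := 3) (i := 3) (j := 11)
    (by decide) (by decide) (by decide) rfl rfl (by decide) rfl rfl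
  rw [(tri_apply e37 e711 f311 n37 n70 m311).2, (tri_apply f311 e31 e41 m311 n31 n41).1] at e711
  have hc : c ≠ 0 := fun hc => h.ne_zero (diff_mem_sumZero 4 0) (diff_ne_zero (by decide))
    (by rw [e21, hc, zero_smul])
  have e70 : B (diff 7 0) = c • diff (meet (τ 3) (τ 4)) (meet (τ 0) (τ 1)) := by
    rw [← diff_add_diff 7 11 0, map_add, e711, e31, ← smul_add, diff_add_diff]
  have e20 : B (diff 2 0) = c • diff (meet (τ 2) (τ 4)) (meet (τ 0) (τ 1)) := by
    rw [← diff_add_diff 2 4 0, map_add, e24, e21, ← smul_add, diff_add_diff]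
  have e47 : B (diff 4 7) = c • diff (meet (τ 0) (τ 2)) (meet (τ 3) (τ 4)) := by
    rw [← diff_sub_diff 4 7 0, map_sub, e21, e70, ← smul_sub, diff_sub_diff]
  have t479 : Iso (B (diff 4 7)) (B (diff 9 7)) :=
    (show Tri B 4 7 9 from h.tri_pencil 29 (by decide)).rot
  rw [e47] at t479
  have hd : ∀ S : Finset (Fin 12), S = {meet (τ 0) (τ 2), meet (τ 3) (τ 4)} →
      ¬ ∀ l, l ∉ S → ∃ k, l ∈ points k ∧ meet (τ 0) (τ 2) ∈ points k
        ∧ meet (τ 3) (τ 4) ∉ points k := by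
    intro S hS hk
    have hs := mem_supportedOn_of_iso hc t479 (h.mem _ (diff_mem_sumZero 9 7)) S
      (by rw [hS]; exact Finset.mem_insert_self _ _) hk
    rw [hS] at hs
    have he := eq_smul_diff hs
    set d := B (diff 9 7) (meet (τ 0) (τ 2))
    have h1 : B (c • diff 9 7 - d • diff 4 7) = 0 := by
      rw [map_sub, map_smul, map_smul, he, e47, smul_comm, sub_self]
    have h2 : c • diff 9 7 - d • diff 4 7 = 0 := by
      rw [← h.inv _ (sumZero.sub_mem (sumZero.smul_mem _ (diff_mem_sumZero 9 7))
        (sumZero.smul_mem _ (diff_mem_sumZero 4 7))), h1, map_zero]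
    have h3 := congrFun h2 9
    simp [diff_apply] at h3
    exact hc h3
  have hτ1 : ∀ x, τ x = x := by
    clear hτ e21 e31 e41 e10 e50 e23 e34 e12 e35 e24 e32 f34 e711 e37 f311 e70 e20 e47 t479
    have hd' : ¬ Separates (meet (τ 0) (τ 2)) (meet (τ 3) (τ 4)) := hd _ rfl
    clear hd n21 n31 n41 n23 n34 n10 n12 n50 n35 n24 n32 m34 n70 n37 m311
    revert τ
    decide +kernel
  obtain rfl : τ = 1 := Equiv.ext hτ1
  refine ⟨c, hc, fun i hi => ?_, hτ⟩
  simp only [Finset.mem_insert, Finset.mem_singleton] at hi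
  rcases hi with rfl | rfl | rfl | rfl | rfl | rfl | rfl | rfl
  · rw [diff_self, map_zero, smul_zero]
  exacts [e10, e20, e41, e21, e50, e70, e31]

theorem eq_smul_of_tri (h : IsRigidPair B B') {c : ℂ}
    (hτ : ∀ a, ∀ y ∈ supportedOn (big a), B y ∈ supportedOn (big a)) (hc : c ≠ 0)
    {n r s t : Fin 12} (ht : Tri B r n s) (hr : B (diff r 0) = c • diff r 0)
    (hs : B (diff s 0) = c • diff s 0) (ht0 : B (diff t 0) = c • diff t 0) (a : Fin 5)
    (hna : n ∈ big a) (hta : t ∈ big a) (hra : r ∉ big a) (hsa : s ∉ big a) (hrs : r ≠ s)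
    (hS : ∀ l, l ∉ ({n, s, r} : Finset (Fin 12)) →
      ∃ k, l ∈ points k ∧ r ∈ points k ∧ s ∉ points k) :
    B (diff n 0) = c • diff n 0 := by
  have hnr : r ≠ n := fun e => hra (by rwa [e])
  have hns : s ≠ n := fun e => hsa (by rwa [e])
  have htr : r ≠ t := fun e => hra (by rwa [e])
  have e1 : B (diff r s) = c • diff r s := by
    rw [← diff_sub_diff r s 0, map_sub, hr, hs, smul_sub]
  have e2 : B (diff t s) = c • diff t s := by
    rw [← diff_sub_diff t s 0, map_sub, ht0, hs, smul_sub]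
  have h1 := hτ a _ (diff_mem_supportedOn hna hta)
  have h2 : B (diff n s) = B (diff n t) + c • diff t s := by
    rw [← e2, ← map_add, diff_add_diff]
  have ht' : Iso (c • diff r s) (B (diff n s)) := by
    rw [← e1]
    exact ht
  have h3 := mem_supportedOn_of_iso hc ht' (h.mem _ (diff_mem_sumZero n s)) {n, s, r}
    (by simp) hS
  have h4 : B (diff n s) ∈ supportedOn {n, s} := by
    refine ⟨h3.1, fun l hl => ?_⟩
    by_cases hlr : l = r
    · rw [h2, hlr, Pi.add_apply, h1.2 r hra, Pi.smul_apply, diff_apply, if_neg htr, if_neg hrs]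
      simp
    · refine h3.2 l fun h => hl ?_
      simp only [Finset.mem_insert, Finset.mem_singleton] at h ⊢
      tauto
  have h5 := eq_smul_diff h4
  have h6 := congrFun h5 s
  have hst : s ≠ t := fun e => hsa (by rwa [e])
  rw [h2, Pi.add_apply, h1.2 s hsa, Pi.smul_apply, Pi.smul_apply, diff_apply, diff_apply,
    if_neg hst, if_neg hns, if_pos rfl, ← h2] at h6
  have h7 : B (diff n s) n = c := by
    simp only [smul_eq_mul] at h6
    linear_combination h6
  rw [h7] at h5
  rw [← diff_add_diff n s 0, map_add, h5, hs, smul_add]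

theorem exists_smul (h : IsRigidPair B B') : ∃ c : ℂ, c ≠ 0 ∧ ∀ y ∈ sumZero, B y = c • y := by
  obtain ⟨c, hc, hk, hτ⟩ := h.exists_smul_known
  have e9 : B (diff 9 0) = c • diff 9 0 := h.eq_smul_of_tri hτ hc (n := 9) (r := 4) (s := 7)
    (t := 5) (show Tri B 4 7 9 from h.tri_pencil 29 (by decide)).rot (hk 4 (by decide))
    (hk 7 (by decide)) (hk 5 (by decide)) 1 (by decide +kernel) (by decide +kernel)
    (by decide +kernel) (by decide +kernel) (by decide) (by decide +kernel)
  have e10 : B (diff 10 0) = c • diff 10 0 := h.eq_smul_of_tri hτ hc (n := 10) (r := 3) (s := 9)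
    (t := 7) (show Tri B 3 9 10 from h.tri_pencil 28 (by decide)).rot (hk 3 (by decide))
    e9 (hk 7 (by decide)) 3 (by decide +kernel) (by decide +kernel)
    (by decide +kernel) (by decide +kernel) (by decide) (by decide +kernel)
  have e8 : B (diff 8 0) = c • diff 8 0 := h.eq_smul_of_tri hτ hc (n := 8) (r := 2) (s := 10)
    (t := 0) (show Tri B 2 8 10 from h.tri_pencil 23 (by decide)) (hk 2 (by decide))
    e10 (hk 0 (by decide)) 0 (by decide +kernel) (by decide +kernel)
    (by decide +kernel) (by decide +kernel) (by decide) (by decide +kernel)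
  have e6 : B (diff 6 0) = c • diff 6 0 := h.eq_smul_of_tri hτ hc (n := 6) (r := 0) (s := 10)
    (t := 1) (show Tri B 0 6 10 from h.tri_pencil 15 (by decide)) (hk 0 (by decide))
    e10 (hk 1 (by decide)) 2 (by decide +kernel) (by decide +kernel)
    (by decide +kernel) (by decide +kernel) (by decide) (by decide +kernel)
  refine ⟨c, hc, fun y hy => ?_⟩
  have hy' : y ∈ supportedOn Finset.univ := ⟨hy, fun i hi => absurd (Finset.mem_univ i) hi⟩
  rw [eq_sum_diff hy' 0, map_sum, Finset.smul_sum]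
  refine Finset.sum_congr rfl fun i _ => ?_
  rw [map_smul, smul_comm]
  congr 1
  have hi : i ∈ ({0, 1, 2, 3, 4, 5, 7, 11} : Finset (Fin 12)) ∨ i = 9 ∨ i = 10 ∨ i = 8 ∨ i = 6 := by
    revert i
    decide
  rcases hi with hi | rfl | rfl | rfl | rfl
  exacts [hk i hi, e9, e10, e8, e6]

end IsRigidPair

end Rigidity

section Transfer

namespace PencilModel

variable {G G' : Type*} [Group G] [Group G'] {ζ ζ' : ℂ} (M : PencilModel G ζ)

/-- The character of the group defined by a combination of the winding numbers. -/
noncomputable def char (y : Fin 12 → ℂ) (p : G) : ℂ := ∑ j, y j * M.w j p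

variable (M' : PencilModel G' ζ')

theorem char_add (y z : Fin 12 → ℂ) (p : G) : M.char (y + z) p = M.char y p + M.char z p := by
  simp only [char, Pi.add_apply, add_mul, Finset.sum_add_distrib]

theorem char_smul (c : ℂ) (y : Fin 12 → ℂ) (p : G) : M.char (c • y) p = c * M.char y p := by
  simp only [char, Pi.smul_apply, smul_eq_mul, mul_assoc, Finset.mul_sum]

theorem char_mul (y : Fin 12 → ℂ) (p q : G) : M.char y (p * q) = M.char y p + M.char y q := by
  simp only [char, M.w_mul, Int.cast_add, mul_add, Finset.sum_add_distrib]

theorem exists_meridian (i : Fin 12) :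
    ∃ p, ∀ j, M.w j p = (if j = i then 1 else 0) - (if 11 = i then 1 else 0) := by
  have h : ∀ i, ∃ k, i ∈ points k := by decide +kernel
  obtain ⟨k, hk⟩ := h i
  obtain ⟨p, _, _, hp, _⟩ := M.exists_commute k i hk
  exact ⟨p, hp⟩

/-- A meridian of a line. -/
noncomputable def meridian (i : Fin 12) : G := (M.exists_meridian i).choose

theorem w_meridian (i j : Fin 12) :
    M.w j (M.meridian i) = (if j = i then 1 else 0) - (if 11 = i then 1 else 0) :=
  (M.exists_meridian i).choose_spec j

theorem char_of_indicator {y : Fin 12 → ℂ} (hy : y ∈ sumZero) (S : Finset (Fin 12)) {p : G}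
    (hp : ∀ j, M.w j p = (if j ∈ S then 1 else 0) - (if 11 ∈ S then 1 else 0)) :
    M.char y p = ∑ j ∈ S, y j := by
  have hy' : ∑ j, y j = 0 := hy
  simp only [char, hp, Int.cast_sub, Int.cast_ite, Int.cast_one, Int.cast_zero, mul_sub,
    Finset.sum_sub_distrib]
  rw [← Finset.sum_mul, hy', zero_mul, sub_zero]
  simp

theorem char_meridian {y : Fin 12 → ℂ} (hy : y ∈ sumZero) (i : Fin 12) :
    M.char y (M.meridian i) = y i := by
  rw [M.char_of_indicator hy {i}, Finset.sum_singleton]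
  simpa only [Finset.mem_singleton] using M.w_meridian i

theorem eq_of_char_eq {y z : Fin 12 → ℂ} (hy : y ∈ sumZero) (hz : z ∈ sumZero)
    (h : ∀ p, M.char y p = M.char z p) : y = z := by
  funext i
  rw [← M.char_meridian hy, h, M.char_meridian hz]

theorem iso_of_commute {y z : Fin 12 → ℂ} (hy : y ∈ sumZero) (hz : z ∈ sumZero)
    (h : ∀ p q, Commute p q → M.char y p * M.char z q = M.char z p * M.char y q) : Iso y z := by
  intro k i hi
  obtain ⟨p, q, hpq, hp, hq⟩ := M.exists_commute k i hi
  have h1 := h p q hpq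
  rw [M.char_of_indicator hy (points k) hq, M.char_of_indicator hz (points k) hq,
    M.char_of_indicator hy {i} (by simpa only [Finset.mem_singleton] using hp),
    M.char_of_indicator hz {i} (by simpa only [Finset.mem_singleton] using hp),
    Finset.sum_singleton, Finset.sum_singleton] at h1
  exact h1

theorem pencilZero_mem_sumZero (k : Fin 34) : (fun j => (pencilZero k j : ℂ)) ∈ sumZero := by
  change ∑ j, (pencilZero k j : ℂ) = 0
  exact_mod_cast sum_pencilZero k

theorem pencilOne_mem_sumZero (k : Fin 34) : (fun j => (pencilOne k j : ℂ)) ∈ sumZero := by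
  change ∑ j, (pencilOne k j : ℂ) = 0
  exact_mod_cast sum_pencilOne k

theorem char_pencilZero (k : Fin 34) (p : G) :
    M.char (fun j => (pencilZero k j : ℂ)) p = M.a k p := by
  rw [M.a_eq, char]
  push_cast
  rfl

theorem char_pencilOne (k : Fin 34) (p : G) :
    M.char (fun j => (pencilOne k j : ℂ)) p = M.b k p := by
  rw [M.b_eq, char]
  push_cast
  rfl

/-- The map on combinations of winding numbers induced by a homomorphism. -/
noncomputable def transfer (φ : G →* G') : (Fin 12 → ℂ) →ₗ[ℂ] (Fin 12 → ℂ) where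
  toFun y i := M'.char y (φ (M.meridian i))
  map_add' y z := funext fun _ => M'.char_add y z _
  map_smul' c y := funext fun _ => M'.char_smul c y _

variable {M M'} in
theorem transfer_spec (φ : G →* G') (y : Fin 12 → ℂ) :
    M.transfer M' φ y ∈ sumZero ∧ ∀ p, M.char (M.transfer M' φ y) p = M'.char y (φ p) := by
  obtain ⟨z, hz, h⟩ := M.exists_eq_sum (fun p => M'.char y (φ p))
    fun p q => by rw [map_mul, M'.char_mul]
  have hz' : M.transfer M' φ y = z := by
    funext i
    rw [← M.char_meridian hz i]
    exact h (M.meridian i)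
  rw [hz']
  exact ⟨hz, fun p => (h p).symm⟩

theorem transfer_transfer (φ : G ≃* G') {y : Fin 12 → ℂ} (hy : y ∈ sumZero) :
    M'.transfer M (φ.symm : G' →* G) (M.transfer M' (φ : G →* G') y) = y := by
  refine M'.eq_of_char_eq (transfer_spec _ _).1 hy fun q => ?_
  rw [(transfer_spec _ _).2, (transfer_spec _ _).2]
  congr 1
  exact φ.apply_symm_apply q

theorem iso_transfer (φ : G →* G') (k : Fin 34) :
    Iso (M.transfer M' φ fun j => (pencilZero k j : ℂ))
      (M.transfer M' φ fun j => (pencilOne k j : ℂ)) := by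
  refine M.iso_of_commute (transfer_spec _ _).1 (transfer_spec _ _).1 fun p q h => ?_
  simp only [(transfer_spec _ _).2, char_pencilZero, char_pencilOne]
  rw [M'.commute_ab k (h.map φ), mul_comm]

theorem isRigidPair (φ : G ≃* G') :
    IsRigidPair (M.transfer M' (φ : G →* G')) (M'.transfer M (φ.symm : G' →* G)) where
  mem _ _ := (transfer_spec _ _).1
  mem' _ _ := (transfer_spec _ _).1
  inv _ hy := M.transfer_transfer M' φ hy
  inv' _ hy := M'.transfer_transfer M φ.symm hy
  iso k := iso_transfer _ _ _ k
  iso' k := iso_transfer _ _ _ k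

theorem exists_int_transfer (φ : G →* G') : ∃ n : ℤ, M.transfer M' φ (diff 0 1) 0 = n := by
  refine ⟨M'.w 0 (φ (M.meridian 0)) - M'.w 1 (φ (M.meridian 0)), ?_⟩
  change ∑ j : Fin 12, diff 0 1 j * (M'.w j (φ (M.meridian 0)) : ℂ) = _
  simp [diff_apply, sub_mul, Finset.sum_sub_distrib]

/-- An isomorphism preserves the winding numbers up to a common sign. -/
theorem exists_sign (φ : G ≃* G') : ∃ c : ℤ, (c = 1 ∨ c = -1) ∧
    ∀ y ∈ sumZero, ∀ p, M'.char y (φ p) = c * M.char y p := by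
  obtain ⟨c, hc, h⟩ := (M.isRigidPair M' φ).exists_smul
  obtain ⟨n, hn⟩ := M.exists_int_transfer M' (φ : G →* G')
  obtain ⟨m, hm⟩ := M'.exists_int_transfer M (φ.symm : G' →* G)
  have h1 := (M.isRigidPair M' φ).inv _ (diff_mem_sumZero 0 1)
  rw [h _ (diff_mem_sumZero 0 1), map_smul] at h1
  have h2 := congrFun h1 0
  rw [h _ (diff_mem_sumZero 0 1)] at hn
  rw [Pi.smul_apply, diff_apply_left (by decide), smul_eq_mul, mul_one] at hn
  rw [Pi.smul_apply, hm, diff_apply_left (by decide), hn, smul_eq_mul] at h2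
  refine ⟨n, Int.eq_one_or_neg_one_of_mul_eq_one (by exact_mod_cast h2), fun y hy p => ?_⟩
  rw [← hn, ← char_smul, ← h y hy]
  exact ((transfer_spec (φ : G →* G') y).2 p).symm

end PencilModel

end Transfer

section Certificate

/-- The coefficients of the linear form in `y` expressing isotropy of `y` and `z`, localized at a
line through a multiple point. -/
def isoForm (z : Fin 12 → ℤ) (k : Fin 27) (i j : Fin 12) : ℤ :=
  (if j = i then ∑ l ∈ points k, z l else 0) - if j ∈ points k then z i else 0

theorem sum_isoForm {y : Fin 12 → ℂ} {z : Fin 12 → ℤ} (h : Iso y fun j => (z j : ℂ)) {k : Fin 27}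
    {i : Fin 12} (hi : i ∈ points k) : ∑ j, (isoForm z k i j : ℂ) * y j = 0 := by
  have h1 := h k i hi
  simp only [isoForm, Int.cast_sub, Int.cast_ite, Int.cast_sum, Int.cast_zero, sub_mul, ite_mul,
    zero_mul, Finset.sum_sub_distrib, Finset.sum_ite_eq', Finset.mem_univ, if_true,
    Finset.sum_ite_mem, Finset.univ_inter, ← Finset.mul_sum]
  linear_combination h1

/-- Multipliers of the relations between the pencils. -/
def multiplier : Fin 11 → Fin 12 → ℤ :=
  ![![0, 0, 1, 1, 0, 1, 0, 1, 0, 0, 0, 0],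
    ![-2, 0, 0, 2, -2, 0, 0, 0, -2, -1, -1, -2],
    ![0, 0, 2, 0, -2, -1, 2, 0, 2, 0, 0, 0],
    ![-2, 2, 0, 0, -1, 0, 0, 0, 0, 0, 1, 0],
    ![2, 0, 0, 0, 1, 0, 0, -1, 0, 1, 0, 0],
    ![0, 0, 0, 0, -2, 0, -2, 0, 2, 0, 2, 0],
    ![0, 0, 0, -2, 0, 0, 0, -2, 0, 0, 0, 0],
    ![-2, 0, 0, 0, -2, 0, -2, 0, -2, 0, 0, -2],
    ![0, 0, 2, 2, 0, 2, 0, 2, 0, 0, 0, 0],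
    ![0, 0, 0, -2, 0, 0, 0, 2, 0, 0, 0, 0],
    ![0, 0, 0, 2, 0, 0, 0, 0, 0, 0, 0, 0]]

/-- The exponents of the distinguishing invariant. -/
def weight (k : Fin 34) (j : Fin 12) : ℤ :=
  if (k, j) ∈ ({(2, 0), (2, 1), (15, 10), (17, 4), (28, 9), (28, 10)} : Finset (Fin 34 × Fin 12))
  then 1
  else if (k, j) ∈ ({(1, 0), (1, 9), (12, 3), (31, 6), (31, 8)} : Finset (Fin 34 × Fin 12))
  then -1
  else 0

/-- Entries `(b, k, i, c)` stand for `c` times an isotropy condition at the line `i` through the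
point `k`. -/
def certificate : Fin 34 → List (Bool × Fin 27 × Fin 12 × ℤ) :=
  ![[(true, 4, 3, -1)],
    [(false, 5, 0, 5), (true, 23, 6, -5), (false, 7, 10, -4), (true, 0, 11, -2)],
    [(true, 9, 8, -2), (false, 10, 0, -2), (true, 1, 5, -5), (true, 17, 5, -2),
      (true, 25, 8, -5)],
    [(true, 18, 4, -3), (true, 5, 10, 2), (true, 2, 4, -2), (true, 6, 2, -2)],
    [(false, 11, 0, 2), (false, 8, 7, -1)],
    [(false, 1, 1, 2), (true, 2, 6, -2), (true, 6, 10, -2)],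
    [(true, 4, 2, 2), (false, 17, 4, 2)],
    [(true, 0, 4, -2), (true, 16, 6, -2)],
    [(false, 4, 2, -2)],
    [(false, 4, 3, -1), (false, 4, 7, 1)],
    [(false, 9, 5, -2), (false, 4, 2, 2), (true, 17, 5, 2), (false, 4, 5, -1)],
    [(true, 13, 1, -1), (false, 0, 0, -1), (false, 7, 3, 3), (true, 3, 1, -1)],
    [(true, 0, 11, 2), (true, 4, 3, 1), (true, 7, 3, -1)],
    [(true, 9, 5, 5), (true, 6, 10, 2), (true, 2, 2, 2), (true, 9, 8, 4)],
    [(false, 3, 7, -3), (false, 26, 11, -1), (false, 3, 11, -2), (true, 18, 4, -1)],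
    [(true, 18, 4, 3), (true, 9, 8, 2), (true, 3, 1, -2), (false, 5, 10, -2)],
    [(false, 0, 3, -2), (true, 8, 7, -2)],
    [(true, 18, 4, 1), (false, 9, 6, 1), (false, 1, 0, 2), (true, 9, 8, 3), (true, 2, 4, 2)],
    [(true, 4, 7, -1), (true, 8, 7, -1), (true, 11, 7, -2)],
    [(false, 0, 4, 1), (true, 26, 9, 1), (true, 0, 8, 2), (false, 3, 11, -2)],
    [(true, 0, 3, -2), (true, 9, 6, -2)],
    [(true, 4, 7, -2)],
    [(false, 23, 11, 2), (true, 9, 8, 4), (true, 5, 6, -2)],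
    [(false, 4, 5, 2), (false, 2, 2, 2), (true, 13, 8, -2), (false, 6, 10, 2)],
    [(false, 16, 6, 2), (true, 0, 8, 2)],
    [(true, 8, 7, -2)],
    [(false, 4, 7, -1)],
    [(false, 4, 3, 2)],
    [(true, 8, 7, 2), (false, 0, 3, -2), (false, 7, 10, -4)],
    [(false, 1, 0, -2), (false, 0, 3, -2), (false, 8, 4, -1)],
    [(true, 24, 7, 2)],
    [(false, 1, 0, -2), (true, 9, 6, -1), (false, 6, 2, 2), (true, 0, 11, 2)],
    [(false, 4, 7, -2), (true, 7, 3, 2)],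
    []]

theorem certificate_mem (k : Fin 34) : ∀ e ∈ certificate k, e.2.2.1 ∈ points e.2.1 := by
  revert k
  decide +kernel

theorem certificate_spec (k : Fin 34) (j : Fin 12) :
    (∑ R, ∑ l, if (pencilRel R l).1 = k then (pencilRel R l).2 * multiplier R j else 0)
      - 5 * weight k j
    = ((certificate k).map fun e =>
        e.2.2.2 * isoForm (if e.1 then pencilOne k else pencilZero k) e.2.1 e.2.2.1 j).sum := by
  revert k j
  decide +kernel

theorem sum_weight_eq_zero {η : Fin 34 → Fin 12 → ℂ}
    (h0 : ∀ k, Iso (η k) fun j => (pencilZero k j : ℂ))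
    (h1 : ∀ k, Iso (η k) fun j => (pencilOne k j : ℂ))
    (h : ∀ R j, ∑ l, ((pencilRel R l).2 : ℂ) * η (pencilRel R l).1 j = 0) :
    ∑ k, ∑ j, (weight k j : ℂ) * η k j = 0 := by
  have hc : ∀ k, ∑ j, ((((certificate k).map fun e => e.2.2.2 *
      isoForm (if e.1 then pencilOne k else pencilZero k) e.2.1 e.2.2.1 j).sum : ℤ) : ℂ)
        * η k j = 0 := fun k => by
    have hm := certificate_mem k
    generalize certificate k = L at hm ⊢
    induction L with
    | nil => simp
    | cons e L ih =>
      simp only [List.map_cons, List.sum_cons, Int.cast_add, add_mul, Finset.sum_add_distrib]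
      rw [ih fun e he => hm e (List.mem_cons_of_mem _ he), add_zero]
      simp only [Int.cast_mul, mul_assoc, ← Finset.mul_sum]
      rw [sum_isoForm _ (hm e List.mem_cons_self), mul_zero]
      split_ifs
      exacts [h1 k, h0 k]
  have hr : ∑ k, ∑ j, ((∑ R, ∑ l, if (pencilRel R l).1 = k then
      (pencilRel R l).2 * multiplier R j else 0 : ℤ) : ℂ) * η k j = 0 := by
    have h2 : ∀ R j, ∑ l, ∑ k, (if (pencilRel R l).1 = k then
        ((pencilRel R l).2 : ℂ) * multiplier R j * η k j else 0) = 0 := fun R j => by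
      simp only [Finset.sum_ite_eq, Finset.mem_univ, if_true]
      rw [← mul_zero (multiplier R j : ℂ), ← h R j, Finset.mul_sum]
      exact Finset.sum_congr rfl fun l _ => by ring
    simp only [Int.cast_sum, Int.cast_ite, Int.cast_mul, Int.cast_zero, Finset.sum_mul, ite_mul,
      zero_mul]
    rw [Finset.sum_comm]
    refine Finset.sum_eq_zero fun j _ => ?_
    rw [Finset.sum_comm]
    refine Finset.sum_eq_zero fun R _ => ?_
    rw [Finset.sum_comm]
    exact h2 R j
  have h5 : (5 : ℂ) * ∑ k, ∑ j, (weight k j : ℂ) * η k j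
      = (∑ k, ∑ j, ((∑ R, ∑ l, if (pencilRel R l).1 = k then
        (pencilRel R l).2 * multiplier R j else 0 : ℤ) : ℂ) * η k j)
      - ∑ k, ∑ j, ((((certificate k).map fun e => e.2.2.2 *
        isoForm (if e.1 then pencilOne k else pencilZero k) e.2.1 e.2.2.1 j).sum : ℤ) : ℂ)
          * η k j := by
    rw [← Finset.sum_sub_distrib, Finset.mul_sum]
    refine Finset.sum_congr rfl fun k _ => ?_
    rw [← Finset.sum_sub_distrib, Finset.mul_sum]
    refine Finset.sum_congr rfl fun j _ => ?_
    rw [← certificate_spec, Int.cast_sub, Int.cast_mul, Int.cast_ofNat]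
    ring
  rw [hr, Finset.sum_eq_zero fun k _ => hc k, sub_zero] at h5
  exact (mul_eq_zero.1 h5).resolve_left (by norm_num)

end Certificate

section Invariant

namespace Cyc

/-- The product of a finite family. -/
def prod : {n : ℕ} → (Fin n → Cyc) → Cyc
  | 0, _ => (1, 0, 0, 0)
  | _ + 1, f => mul (f 0) (prod fun i => f i.succ)

variable {ζ : ℂ}

theorem ev_prod (hζ : 1 + ζ + ζ ^ 2 + ζ ^ 3 + ζ ^ 4 = 0) {n : ℕ} (f : Fin n → Cyc) :
    ev ζ (prod f) = ∏ i, ev ζ (f i) := by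
  induction n with
  | zero => simp [prod, ev]
  | succ n ih => rw [prod, ev_mul hζ, ih, Fin.prod_univ_succ]

end Cyc

theorem prod_zpow_eq_zpow_sum {ι : Type*} (s : Finset ι) {x : ℂ} (hx : x ≠ 0) (f : ι → ℤ) :
    ∏ i ∈ s, x ^ f i = x ^ ∑ i ∈ s, f i := by
  classical
  induction s using Finset.induction_on with
  | empty => simp
  | insert i s hi ih => rw [Finset.prod_insert hi, ih, Finset.sum_insert hi, zpow_add₀ hx]

/-- The pairing of the weights with the zeros of the pencils. -/
def weightZero (k : Fin 34) : ℤ := ∑ j, weight k j * pencilZero k j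

/-- The pairing of the weights with the ones of the pencils. -/
def weightOne (k : Fin 34) : ℤ := ∑ j, weight k j * pencilOne k j

/-- The exponents of the coefficients of the pencils in the invariant. -/
def coeffExp (k : Fin 34) : Fin 3 → ℤ :=
  ![-weightOne k, weightZero k, weightOne k - weightZero k]

variable {ζ : ℂ}

theorem prod_pencilCoeff (hζ : 1 + ζ + ζ ^ 2 + ζ ^ 3 + ζ ^ 4 = 0) :
    ∏ k, ∏ r, Cyc.ev ζ (pencilCoeff k r) ^ coeffExp k r = ζ ^ 2 := by
  have h1 : Cyc.prod (fun k => Cyc.prod fun r =>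
        Cyc.prod fun _ : Fin (coeffExp k r).toNat => pencilCoeff k r)
      = Cyc.mul (0, 0, 1, 0) (Cyc.prod fun k => Cyc.prod fun r =>
        Cyc.prod fun _ : Fin (-coeffExp k r).toNat => pencilCoeff k r) := by
    decide +kernel
  have h2 := congrArg (Cyc.ev ζ) h1
  have h3 : Cyc.ev ζ (0, 0, 1, 0) = ζ ^ 2 := by simp [Cyc.ev]
  simp only [Cyc.ev_mul hζ, Cyc.ev_prod hζ, h3, Finset.prod_const, Finset.card_univ,
    Fintype.card_fin] at h2
  have h4 : ∀ k r, Cyc.ev ζ (pencilCoeff k r) ^ coeffExp k r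
      = Cyc.ev ζ (pencilCoeff k r) ^ (coeffExp k r).toNat
        / Cyc.ev ζ (pencilCoeff k r) ^ (-coeffExp k r).toNat := fun k r => by
    rw [← zpow_natCast, ← zpow_natCast, ← zpow_sub₀ (pencilCoeff_ne_zero hζ k r),
      Int.toNat_sub_toNat_neg]
  simp only [h4, Finset.prod_div_distrib]
  rw [h2, mul_div_cancel_right₀]
  exact Finset.prod_ne_zero_iff.2 fun k _ => Finset.prod_ne_zero_iff.2 fun r _ =>
    pow_ne_zero _ (pencilCoeff_ne_zero hζ k r)

theorem prod_pencilFun_zpow_weight (hζ : 1 + ζ + ζ ^ 2 + ζ ^ 3 + ζ ^ 4 = 0) {v : Fin 3 → ℂ}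
    (hv : ∀ j, lin ζ j v ≠ 0) :
    ∏ k, ∏ j, ((1 - pencilFun ζ k v) ^ pencilZero k j * pencilFun ζ k v ^ (-pencilOne k j))
      ^ weight k j = ζ ^ 2 := by
  have h1 : ∀ k, ∏ j, ((1 - pencilFun ζ k v) ^ pencilZero k j
      * pencilFun ζ k v ^ (-pencilOne k j)) ^ weight k j
      = (∏ r, Cyc.ev ζ (pencilCoeff k r) ^ coeffExp k r)
        * ∏ l, lin ζ l v ^ (weightZero k * pencilOne k l - weightOne k * pencilZero k l) := by
    intro k
    have h0 := pencilCoeff_ne_zero hζ k 0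
    have h2 := pencilCoeff_ne_zero hζ k 2
    have h3 := pencilCoeff_ne_zero hζ k 1
    simp only [mul_zpow, ← zpow_mul, Finset.prod_mul_distrib]
    rw [prod_zpow_eq_zpow_sum _ (one_sub_pencilFun_ne_zero hζ k hv),
      prod_zpow_eq_zpow_sum _ (pencilFun_ne_zero hζ k hv)]
    have e0 : ∑ j, pencilZero k j * weight k j = weightZero k :=
      Finset.sum_congr rfl fun j _ => mul_comm _ _
    have e1 : ∑ j, -pencilOne k j * weight k j = -weightOne k := by
      rw [weightOne, ← Finset.sum_neg_distrib]
      exact Finset.sum_congr rfl fun j _ => by ring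
    rw [e0, e1, one_sub_pencilFun hζ k hv, pencilFun, mul_zpow, mul_zpow, ← Finset.prod_zpow,
      ← Finset.prod_zpow, mul_mul_mul_comm, ← Finset.prod_mul_distrib]
    congr 1
    · rw [Fin.prod_univ_three]
      simp only [coeffExp, Matrix.cons_val_zero, Matrix.cons_val_one, Matrix.cons_val]
      rw [div_zpow, div_zpow, zpow_sub₀ h2, zpow_neg, zpow_neg]
      field_simp
    · refine Finset.prod_congr rfl fun l _ => ?_
      rw [← zpow_mul, ← zpow_mul, ← zpow_add₀ (hv l)]
      congr 1
      ring
  simp only [h1, Finset.prod_mul_distrib]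
  rw [prod_pencilCoeff hζ, Finset.prod_comm]
  have h2 : ∀ l, ∑ k, (weightZero k * pencilOne k l - weightOne k * pencilZero k l) = 0 := by
    decide +kernel
  simp only [prod_zpow_eq_zpow_sum _ (hv _), h2, zpow_zero, Finset.prod_const_one, mul_one]

end Invariant

section Distinction

namespace PencilModel

variable {G G' : Type*} [Group G] [Group G'] {ζ ζ' : ℂ} (M : PencilModel G ζ)
  (M' : PencilModel G' ζ')

theorem exp_sum_weight (q : Fin 12 → G) {c : ℤ}
    (ha : ∀ k j, M.a k (q j) = c * pencilZero k j) (hb : ∀ k j, M.b k (q j) = c * pencilOne k j)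
    (hζ : 1 + ζ + ζ ^ 2 + ζ ^ 3 + ζ ^ 4 = 0) :
    Complex.exp (2 * Real.pi * Complex.I * ∑ k, ∑ j, (weight k j : ℂ) *
      (M.g k (q j) + c ^ 2 * pencilZero k j * pencilOne k j / 2)) = (ζ ^ 2) ^ c := by
  rw [Finset.mul_sum, Complex.exp_sum, ← prod_pencilFun_zpow_weight hζ M.lin_ne_zero,
    ← Finset.prod_zpow]
  refine Finset.prod_congr rfl fun k _ => ?_
  rw [Finset.mul_sum, Complex.exp_sum, ← Finset.prod_zpow]
  refine Finset.prod_congr rfl fun j _ => ?_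
  have h := M.exp_g k (q j)
  rw [ha, hb] at h
  rw [mul_left_comm, Complex.exp_int_mul, ← zpow_mul, mul_comm (weight k j), zpow_mul, mul_zpow,
    ← zpow_mul, ← zpow_mul, mul_comm _ c, neg_mul_comm, mul_neg, mul_comm (pencilOne k j), ← h]
  push_cast
  ring_nf

variable {M M'} in
/-- The iterated integrals of corresponding elements differ by characters. -/
theorem exists_char_eq_sub (φ : G ≃* G') {c : ℤ} (hc : c = 1 ∨ c = -1)
    (h : ∀ y ∈ sumZero, ∀ p, M'.char y (φ p) = c * M.char y p) (k : Fin 34) :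
    ∃ η ∈ sumZero, (∀ p, M'.g k (φ p) - M.g k p = M.char η p) ∧
      (Iso η fun j => (pencilZero k j : ℂ)) ∧ Iso η fun j => (pencilOne k j : ℂ) := by
  have hc2 : (c : ℂ) * c = 1 := by rcases hc with rfl | rfl <;> norm_num
  have ha : ∀ p, (M'.a k (φ p) : ℂ) = c * M.a k p := fun p => by
    rw [← char_pencilZero, ← char_pencilZero, h _ (pencilZero_mem_sumZero k)]
  have hb : ∀ p, (M'.b k (φ p) : ℂ) = c * M.b k p := fun p => by
    rw [← char_pencilOne, ← char_pencilOne, h _ (pencilOne_mem_sumZero k)]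
  obtain ⟨η, hη, he⟩ := M.exists_eq_sum (fun p => M'.g k (φ p) - M.g k p) fun p q => by
    rw [map_mul, M'.g_mul, M.g_mul, ha, ha, hb, hb]
    linear_combination (-(M.a k p * M.b k q - M.b k p * M.a k q) / 2 : ℂ) * hc2
  refine ⟨η, hη, he, ?_, ?_⟩
  · refine M.iso_of_commute hη (pencilZero_mem_sumZero k) fun p q hpq => ?_
    have h1 := M'.commute_ag k (hpq.map φ)
    have h2 := M.commute_ag k hpq
    rw [ha, ha] at h1
    rw [char_pencilZero, char_pencilZero, char, char, ← he, ← he]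
    linear_combination -(c : ℂ) * h1 + h2 - (M.a k q * M'.g k (φ p)
      - M.a k p * M'.g k (φ q)) * hc2
  · refine M.iso_of_commute hη (pencilOne_mem_sumZero k) fun p q hpq => ?_
    have h1 := M'.commute_bg k (hpq.map φ)
    have h2 := M.commute_bg k hpq
    rw [hb, hb] at h1
    rw [char_pencilOne, char_pencilOne, char, char, ← he, ← he]
    linear_combination -(c : ℂ) * h1 + h2 - (M.b k q * M'.g k (φ p)
      - M.b k p * M'.g k (φ q)) * hc2

/-- An isomorphism identifies the invariants up to inversion. -/
theorem sq_zpow_eq (M : PencilModel G ζ) (M' : PencilModel G' ζ') (φ : G ≃* G')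
    (hζ : 1 + ζ + ζ ^ 2 + ζ ^ 3 + ζ ^ 4 = 0)
    (hζ' : 1 + ζ' + ζ' ^ 2 + ζ' ^ 3 + ζ' ^ 4 = 0) :
    ∃ c : ℤ, (c = 1 ∨ c = -1) ∧ (ζ' ^ 2) ^ c = ζ ^ 2 := by
  obtain ⟨c, hc, h⟩ := M.exists_sign M' φ
  refine ⟨c, hc, ?_⟩
  have hc2 : (c : ℂ) ^ 2 = 1 := by rcases hc with rfl | rfl <;> norm_num
  choose η hη hg h0 h1 using exists_char_eq_sub φ hc h
  have hrel : ∀ R j, ∑ l, ((pencilRel R l).2 : ℂ) * η (pencilRel R l).1 j = 0 := fun R j => by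
    simp only [← M.char_meridian (hη _) j, ← hg, mul_sub, Finset.sum_sub_distrib, M.sum_g,
      M'.sum_g, sub_zero]
  have hs := sum_weight_eq_zero h0 h1 hrel
  have ha : ∀ k j, M.a k (M.meridian j) = 1 * pencilZero k j := fun k j => by
    have := M.char_meridian (pencilZero_mem_sumZero k) j
    rw [char_pencilZero] at this
    rw [one_mul]
    exact_mod_cast this
  have hb : ∀ k j, M.b k (M.meridian j) = 1 * pencilOne k j := fun k j => by
    have := M.char_meridian (pencilOne_mem_sumZero k) j
    rw [char_pencilOne] at this
    rw [one_mul]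
    exact_mod_cast this
  have ha' : ∀ k j, M'.a k (φ (M.meridian j)) = c * pencilZero k j := fun k j => by
    have := h _ (pencilZero_mem_sumZero k) (M.meridian j)
    rw [M.char_meridian (pencilZero_mem_sumZero k), char_pencilZero] at this
    exact_mod_cast this
  have hb' : ∀ k j, M'.b k (φ (M.meridian j)) = c * pencilOne k j := fun k j => by
    have := h _ (pencilOne_mem_sumZero k) (M.meridian j)
    rw [M.char_meridian (pencilOne_mem_sumZero k), char_pencilOne] at this
    exact_mod_cast this
  have e := M.exp_sum_weight M.meridian ha hb hζ
  have e' := M'.exp_sum_weight (fun j => φ (M.meridian j)) ha' hb' hζ'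
  rw [zpow_one] at e
  rw [← e, ← e']
  congr 2
  rw [← sub_eq_zero, ← hs, ← Finset.sum_sub_distrib]
  refine Finset.sum_congr rfl fun k _ => ?_
  rw [← Finset.sum_sub_distrib]
  refine Finset.sum_congr rfl fun j _ => ?_
  rw [← M.char_meridian (hη k) j, ← hg, hc2]
  push_cast
  ring

end PencilModel

end Distinction

theorem one_add_xi_add_eq_zero : 1 + xi + xi ^ 2 + xi ^ 3 + xi ^ 4 = 0 := by
  have h : IsPrimitiveRoot xi 5 := Complex.isPrimitiveRoot_exp 5 (by norm_num)
  have := h.geom_sum_eq_zero (by norm_num)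
  simpa [Finset.sum_range_succ] using this

theorem xi_sq_cyclotomic :
    1 + xi ^ 2 + (xi ^ 2) ^ 2 + (xi ^ 2) ^ 3 + (xi ^ 2) ^ 4 = 0 := by
  linear_combination (1 - xi + xi ^ 2 - xi ^ 3 + xi ^ 4) * one_add_xi_add_eq_zero

theorem statement0 (x : ↥(unionA xi)ᶜ) (y : ↥(unionA (xi ^ 2))ᶜ) :
    IsEmpty (FundamentalGroup (↥(unionA xi)ᶜ) x ≃* FundamentalGroup (↥(unionA (xi ^ 2))ᶜ) y) := by
  refine ⟨fun φ => ?_⟩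
  have h1 := one_add_xi_add_eq_zero
  have h2 := xi_sq_cyclotomic
  obtain ⟨c, hc, h⟩ := (pencilModel h1 (chartHomeomorph h1 x)).sq_zpow_eq
    (pencilModel h2 (chartHomeomorph h2 y))
    (((fundamentalGroupCongr (chartHomeomorph h1) x).symm.trans φ).trans
      (fundamentalGroupCongr (chartHomeomorph h2) y)) h1 h2
  have h5 : xi ^ 5 = 1 := by linear_combination (xi - 1) * h1
  have h0 : xi ≠ 0 := fun h => by simp [h] at h5
  have hx : xi = 1 := by
    rcases hc with rfl | rfl
    · rw [zpow_one] at h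
      linear_combination -(xi ^ 3 + 1) * xi * h + (xi ^ 3 + 1 - xi) * h5
    · have h6 := mul_inv_cancel₀ (pow_ne_zero 2 (pow_ne_zero 2 h0))
      rw [zpow_neg_one] at h
      rw [h] at h6
      linear_combination h6 - xi * h5
  rw [hx] at h1
  norm_num at h1
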